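/- Let Ω ⊂ ℝⁿ be a smooth bounded open convex domain with diameter D and outward unit normal n(x) at x ∈ ∂Ω, and let T > 0. Let A : ℝⁿ × [0,T] → (symmetric n×n matrices) and b : ℝⁿ × [0,T] → ℝ be continuous with A(p,t) positive semidefinite for all (p,t), and suppose there is a continuous function α : [0,∞) × [0,T] → ℝ such that 0 < α(R,t) ≤ R² · inf{ vᵀA(p,t)v / (v·p)² : |p| = R, v·p ≠ 0 } for all R > 0 and t ∈ [0,T]. Let u, continuous on Ω̄ × (0,T), be a viscosity solution of ∂_t u = tr(A(Du,t) D²u) + b(Du,t) in Ω × (0,T) with the Neumann condition ⟨Du(x,t), n(x)⟩ = 0 on ∂Ω × (0,T), in the viscosity sense for boundary value problems. Define the modulus of continuity ω(s,t) := sup{ (u(y,t) − u(x,t))/2 : x, y ∈ Ω̄, |y − x| = 2s } for s ∈ [0, D/2] and t ∈ (0,T), and assume ω(s,t) is nondecreasing in s for each t. Then ω is a viscosity subsolution of the one-dimensional equation ω_t = α(|ω′|, t) ω″ on (0, D/2) × (0,T): whenever φ is C^{2,1} and ω − φ attains a local maximum at a point (s₀,t₀) ∈ (0, D/2) × (0,T),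 one has ∂_t φ(s₀,t₀) ≤ α(|∂_s φ(s₀,t₀)|, t₀) · ∂_s² φ(s₀,t₀). -/

import Mathlib

open Set
open scoped RealInnerProductSpace

/-- A `C^{2,1}` test function on `ℝⁿ × (0,T)`, presented by its data: `φ` together with
its time derivative `φt`, spatial gradient `Dφ` and spatial Hessian matrix `D2φ`,
all continuous. -/
def IsC21Test (n : ℕ) (T : ℝ) (φ φt : EuclideanSpace ℝ (Fin n) × ℝ → ℝ)
    (Dφ : EuclideanSpace ℝ (Fin n) × ℝ → EuclideanSpace ℝ (Fin n))
    (D2φ : EuclideanSpace ℝ (Fin n) × ℝ → Matrix (Fin n) (Fin n) ℝ) : Prop :=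
  (∀ w : EuclideanSpace ℝ (Fin n) × ℝ, w.2 ∈ Ioo (0 : ℝ) T →
    HasDerivAt (fun s => φ (w.1, s)) (φt w) w.2) ∧
  (∀ w : EuclideanSpace ℝ (Fin n) × ℝ, w.2 ∈ Ioo (0 : ℝ) T →
    HasGradientAt (fun x => φ (x, w.2)) (Dφ w) w.1) ∧
  (∀ w : EuclideanSpace ℝ (Fin n) × ℝ, w.2 ∈ Ioo (0 : ℝ) T →
    HasFDerivAt (fun x => Dφ (x, w.2))
      (LinearMap.toContinuousLinearMap (Matrix.toEuclideanLin (D2φ w))) w.1) ∧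
  ContinuousOn φt (univ ×ˢ Ioo (0 : ℝ) T) ∧
  ContinuousOn Dφ (univ ×ˢ Ioo (0 : ℝ) T) ∧
  ContinuousOn D2φ (univ ×ˢ Ioo (0 : ℝ) T)

/-- `u` is a viscosity subsolution of the Neumann problem
`∂ₜu = F(x, Du, D²u, t)` in `Ω × (0,T)`, `⟨Du, ν⟩ + c = 0` on `∂Ω × (0,T)`. -/
def IsViscositySubsolnNeumann (n : ℕ) (Ω : Set (EuclideanSpace ℝ (Fin n))) (T : ℝ)
    (ν : EuclideanSpace ℝ (Fin n) → EuclideanSpace ℝ (Fin n))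
    (F : EuclideanSpace ℝ (Fin n) → EuclideanSpace ℝ (Fin n) →
      Matrix (Fin n) (Fin n) ℝ → ℝ → ℝ)
    (c : EuclideanSpace ℝ (Fin n) → ℝ)
    (u : EuclideanSpace ℝ (Fin n) × ℝ → ℝ) : Prop :=
  ∀ (φ φt : EuclideanSpace ℝ (Fin n) × ℝ → ℝ)
    (Dφ : EuclideanSpace ℝ (Fin n) × ℝ → EuclideanSpace ℝ (Fin n))
    (D2φ : EuclideanSpace ℝ (Fin n) × ℝ → Matrix (Fin n) (Fin n) ℝ),
    IsC21Test n T φ φt Dφ D2φ →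
    ∀ (x₀ : EuclideanSpace ℝ (Fin n)) (t₀ : ℝ), x₀ ∈ closure Ω → t₀ ∈ Ioo (0 : ℝ) T →
    IsLocalMaxOn (fun w => u w - φ w) (closure Ω ×ˢ Ioo (0 : ℝ) T) (x₀, t₀) →
    ((x₀ ∈ Ω → φt (x₀, t₀) ≤ F x₀ (Dφ (x₀, t₀)) (D2φ (x₀, t₀)) t₀) ∧
     (x₀ ∈ frontier Ω →
       min (φt (x₀, t₀) - F x₀ (Dφ (x₀, t₀)) (D2φ (x₀, t₀)) t₀)
         (⟪Dφ (x₀, t₀), ν x₀⟫ + c x₀) ≤ 0))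

/-- `u` is a viscosity supersolution of the Neumann problem
`∂ₜu = F(x, Du, D²u, t)` in `Ω × (0,T)`, `⟨Du, ν⟩ + c = 0` on `∂Ω × (0,T)`. -/
def IsViscositySupersolnNeumann (n : ℕ) (Ω : Set (EuclideanSpace ℝ (Fin n))) (T : ℝ)
    (ν : EuclideanSpace ℝ (Fin n) → EuclideanSpace ℝ (Fin n))
    (F : EuclideanSpace ℝ (Fin n) → EuclideanSpace ℝ (Fin n) →
      Matrix (Fin n) (Fin n) ℝ → ℝ → ℝ)
    (c : EuclideanSpace ℝ (Fin n) → ℝ)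
    (u : EuclideanSpace ℝ (Fin n) × ℝ → ℝ) : Prop :=
  ∀ (φ φt : EuclideanSpace ℝ (Fin n) × ℝ → ℝ)
    (Dφ : EuclideanSpace ℝ (Fin n) × ℝ → EuclideanSpace ℝ (Fin n))
    (D2φ : EuclideanSpace ℝ (Fin n) × ℝ → Matrix (Fin n) (Fin n) ℝ),
    IsC21Test n T φ φt Dφ D2φ →
    ∀ (x₀ : EuclideanSpace ℝ (Fin n)) (t₀ : ℝ), x₀ ∈ closure Ω → t₀ ∈ Ioo (0 : ℝ) T →
    IsLocalMinOn (fun w => u w - φ w) (closure Ω ×ˢ Ioo (0 : ℝ) T) (x₀, t₀) →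
    ((x₀ ∈ Ω → φt (x₀, t₀) ≥ F x₀ (Dφ (x₀, t₀)) (D2φ (x₀, t₀)) t₀) ∧
     (x₀ ∈ frontier Ω →
       max (φt (x₀, t₀) - F x₀ (Dφ (x₀, t₀)) (D2φ (x₀, t₀)) t₀)
         (⟪Dφ (x₀, t₀), ν x₀⟫ + c x₀) ≥ 0))

section ConvexSecondOrder

open Filter Topology MeasureTheory

variable {P : Type*} [NormedAddCommGroup P] [InnerProductSpace ℝ P]

/-- `s` is a subgradient of `G` at `x`. -/
def IsSubgradientAt (G : P → ℝ) (x s : P) : Prop := ∀ y, G x + ⟪s, y - x⟫ ≤ G y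

/-- `G` has the second-order Taylor expansion at `x` with gradient `s` and Hessian `R`. -/
def HasQuadExpansionAt (G : P → ℝ) (x s : P) (R : P →L[ℝ] P) : Prop :=
  ∀ ε > 0, ∀ᶠ h in 𝓝 (0 : P), |G (x + h) - G x - ⟪s, h⟫ - ⟪R h, h⟫ / 2| ≤ ε * ‖h‖ ^ 2

theorem le_of_forall_le_add_mul {a b c : ℝ} (h : ∀ t ∈ Ioc (0 : ℝ) 1, a ≤ b + t * c) :
    a ≤ b := by
  have ht : Tendsto (fun t : ℝ => b + t * c) (𝓝[>] 0) (𝓝 (b + 0 * c)) :=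
    ((continuous_const.add (continuous_id.mul continuous_const)).tendsto 0).mono_left
      nhdsWithin_le_nhds
  rw [zero_mul, add_zero] at ht
  exact ge_of_tendsto ht (mem_of_superset (Ioc_mem_nhdsGT one_pos) h)

theorem abs_sub_le_of_abs_sub_le_add_sq {H : ℝ → ℝ} {K C : ℝ}
    (h : ∀ t ∈ Icc (0 : ℝ) 1, ∀ t' ∈ Icc (0 : ℝ) 1,
      |H t - H t'| ≤ K * |t - t'| + C * (t - t') ^ 2) : |H 0 - H 1| ≤ K := by
  have key : ∀ N : ℕ, |H 0 - H 1| ≤ K + C * (1 / ((N : ℝ) + 1)) := by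
    intro N
    have hN : (0 : ℝ) < (N : ℝ) + 1 := by positivity
    have := dist_le_range_sum_of_dist_le (f := fun k : ℕ => H (k / ((N : ℝ) + 1))) (N + 1)
      (d := fun _ => K * (1 / ((N : ℝ) + 1)) + C * (1 / ((N : ℝ) + 1)) ^ 2) (by
        intro k hk
        have hk' : (k : ℝ) + 1 ≤ (N : ℝ) + 1 := by exact_mod_cast hk
        have hk0 : (0 : ℝ) ≤ k := by positivity
        have e : (k : ℝ) / ((N : ℝ) + 1) - ((k + 1 : ℕ) : ℝ) / ((N : ℝ) + 1)
            = -(1 / ((N : ℝ) + 1)) := by push_cast; ring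
        have h1 := h (k / ((N : ℝ) + 1))
          ⟨by positivity, by rw [div_le_one hN]; linarith⟩ ((k + 1 : ℕ) / ((N : ℝ) + 1))
          ⟨by positivity, by rw [div_le_one hN]; push_cast; linarith⟩
        rw [e, abs_neg, neg_sq, abs_of_pos (by positivity : 0 < 1 / ((N : ℝ) + 1))] at h1
        rw [Real.dist_eq]
        exact h1)
    have e2 : ((N + 1 : ℕ) : ℝ) / ((N : ℝ) + 1) = 1 := by
      push_cast; exact div_self hN.ne'
    rw [Real.dist_eq] at this
    simp only [Nat.cast_zero, zero_div, e2, Finset.sum_const, Finset.card_range, nsmul_eq_mul]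
      at this
    refine this.trans (le_of_eq ?_)
    push_cast
    field_simp
  have ht : Tendsto (fun N : ℕ => K + C * (1 / ((N : ℝ) + 1))) atTop (𝓝 (K + C * 0)) :=
    (tendsto_one_div_add_atTop_nhds_zero_nat.const_mul C).const_add K
  rw [mul_zero, add_zero] at ht
  exact ge_of_tendsto' ht key

namespace IsSubgradientAt

variable {G : P → ℝ} {x s x' s' : P}

theorem inner_sub_nonneg (h : IsSubgradientAt G x s) (h' : IsSubgradientAt G x' s') :
    0 ≤ ⟪s' - s, x' - x⟫ := by
  have h1 := h x'
  have h2 := h' x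
  have e : ⟪s', x - x'⟫ = -⟪s', x' - x⟫ := by rw [← inner_neg_right, neg_sub]
  rw [inner_sub_left]
  linarith

theorem eq_of_forall_le (h : IsSubgradientAt G x s) {C : ℝ} (hC : 0 ≤ C)
    (hle : ∀ y, G y ≤ G x + ⟪s', y - x⟫ + C * ‖y - x‖ ^ 2) : s = s' := by
  set t : ℝ := 1 / (2 * (C + 1)) with ht
  have ht0 : 0 < t := by positivity
  have hCt : C * t ≤ 1 / 2 := by
    rw [ht, mul_one_div, div_le_div_iff₀ (by positivity) (by norm_num)]; linarith
  have h1 := (h (x + t • (s - s'))).trans (hle (x + t • (s - s')))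
  rw [add_sub_cancel_left, norm_smul, mul_pow, Real.norm_eq_abs, sq_abs, inner_smul_right,
    inner_smul_right] at h1
  have h2 : ⟪s, s - s'⟫ - ⟪s', s - s'⟫ = ‖s - s'‖ ^ 2 := by
    rw [← inner_sub_left, real_inner_self_eq_norm_sq]
  have h3 : t * ‖s - s'‖ ^ 2 ≤ t * (C * t) * ‖s - s'‖ ^ 2 := by rw [← h2] at h1 ⊢; linarith
  have h4 : t * (C * t) ≤ t * (1 / 2) := mul_le_mul_of_nonneg_left hCt ht0.le
  have h5 : ‖s - s'‖ ^ 2 ≤ 0 := by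
    by_contra hcon
    push Not at hcon
    nlinarith [mul_le_mul_of_nonneg_right h4 hcon.le, mul_pos ht0 hcon]
  have h6 : ‖s - s'‖ = 0 := by nlinarith [norm_nonneg (s - s')]
  exact sub_eq_zero.1 (norm_eq_zero.1 h6)

theorem norm_sub_le (h : IsSubgradientAt G x s) {C : ℝ} (hC : 0 < C)
    (hle : ∀ y, G y ≤ G x + ⟪s, y - x⟫ + C * ‖y - x‖ ^ 2) (h' : IsSubgradientAt G x' s') :
    ‖s' - s‖ ≤ 4 * C * ‖x' - x‖ := by
  set t : ℝ := 1 / (4 * C) with ht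
  have ht0 : 0 < t := by positivity
  have hCt : C * t = 1 / 4 := by rw [ht]; field_simp
  have h1 := h x'
  have h2 := (h' (x' + t • (s' - s))).trans (hle (x' + t • (s' - s)))
  have e1 : x' + t • (s' - s) - x = (x' - x) + t • (s' - s) := by abel
  rw [add_sub_cancel_left, e1, inner_add_right, inner_smul_right, inner_smul_right] at h2
  have e2 : ⟪s', s' - s⟫ - ⟪s, s' - s⟫ = ‖s' - s‖ ^ 2 := by
    rw [← inner_sub_left, real_inner_self_eq_norm_sq]
  have h3 : ‖(x' - x) + t • (s' - s)‖ ^ 2 ≤ 2 * ‖x' - x‖ ^ 2 + 2 * t ^ 2 * ‖s' - s‖ ^ 2 := by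
    have h4 := norm_add_le (x' - x) (t • (s' - s))
    rw [norm_smul, Real.norm_eq_abs, abs_of_pos ht0] at h4
    have h5 := pow_le_pow_left₀ (norm_nonneg _) h4 2
    nlinarith [sq_nonneg (‖x' - x‖ - t * ‖s' - s‖)]
  have h6 : t * ‖s' - s‖ ^ 2 ≤ C * (2 * ‖x' - x‖ ^ 2 + 2 * t ^ 2 * ‖s' - s‖ ^ 2) := by
    have := mul_le_mul_of_nonneg_left h3 hC.le
    rw [← e2] at this ⊢
    linarith
  have h7 : C * (2 * t ^ 2 * ‖s' - s‖ ^ 2) = t * ‖s' - s‖ ^ 2 / 2 := by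
    linear_combination (2 * t * ‖s' - s‖ ^ 2) * hCt
  have h8 : ‖s' - s‖ ^ 2 ≤ (4 * C * ‖x' - x‖) ^ 2 := by
    have h9 : t * ‖s' - s‖ ^ 2 ≤ 4 * C * ‖x' - x‖ ^ 2 := by linarith
    have h10 := mul_le_mul_of_nonneg_left h9 (by positivity : 0 ≤ 4 * C)
    have h11 : 4 * C * (t * ‖s' - s‖ ^ 2) = ‖s' - s‖ ^ 2 := by
      linear_combination (4 * ‖s' - s‖ ^ 2) * hCt
    rw [h11] at h10
    linarith
  exact (sq_le_sq₀ (norm_nonneg _) (by positivity)).1 h8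

theorem norm_sub_le_of_sub {z z' : P} (h : IsSubgradientAt G x (z - x))
    (h' : IsSubgradientAt G x' (z' - x')) : ‖x' - x‖ ≤ ‖z' - z‖ := by
  have h1 := h.inner_sub_nonneg h'
  have e : z' - x' - (z - x) = (z' - z) - (x' - x) := by abel
  rw [e, inner_sub_left, real_inner_self_eq_norm_sq] at h1
  have h2 := real_inner_le_norm (z' - z) (x' - x)
  by_contra hcon
  push Not at hcon
  nlinarith [norm_nonneg (z' - z)]

end IsSubgradientAt

theorem convexOn_of_exists_isSubgradientAt {G : P → ℝ}
    (hG : ∀ x, ∃ s, IsSubgradientAt G x s) : ConvexOn ℝ univ G := by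
  refine ⟨convex_univ, fun x _ y _ a b ha hb hab => ?_⟩
  obtain ⟨s, hs⟩ := hG (a • x + b • y)
  have h1 := mul_le_mul_of_nonneg_left (hs x) ha
  have h2 := mul_le_mul_of_nonneg_left (hs y) hb
  have h3 : a * ⟪s, x - (a • x + b • y)⟫ + b * ⟪s, y - (a • x + b • y)⟫ = 0 := by
    rw [← inner_smul_right, ← inner_smul_right, ← inner_add_right]
    have : a • (x - (a • x + b • y)) + b • (y - (a • x + b • y)) = 0 := by
      have hb' : b = 1 - a := by linarith
      subst hb'
      module
    rw [this, inner_zero_right]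
  have h4 : a * G (a • x + b • y) + b * G (a • x + b • y) = G (a • x + b • y) := by
    rw [← add_mul, hab, one_mul]
  simp only [smul_eq_mul]
  nlinarith

variable [FiniteDimensional ℝ P]

theorem continuous_of_exists_isSubgradientAt {G : P → ℝ}
    (hG : ∀ x, ∃ s, IsSubgradientAt G x s) : Continuous G :=
  (convexOn_of_exists_isSubgradientAt hG).locallyLipschitz.continuous

/-- Minty's theorem: `1 + ∂G` is onto. -/
theorem exists_isSubgradientAt_sub {G : P → ℝ} (hG : ∀ x, ∃ s, IsSubgradientAt G x s) (z : P) :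
    ∃ x, IsSubgradientAt G x (z - x) := by
  obtain ⟨s, hs⟩ := hG z
  have hc : Continuous fun x => G x + ‖x - z‖ ^ 2 / 2 := by
    have := continuous_of_exists_isSubgradientAt hG
    fun_prop
  obtain ⟨x, -, hx⟩ := (isCompact_closedBall z (2 * ‖s‖)).exists_isMinOn
    ⟨z, Metric.mem_closedBall_self (by positivity)⟩ hc.continuousOn
  have hmin : ∀ y, G x + ‖x - z‖ ^ 2 / 2 ≤ G y + ‖y - z‖ ^ 2 / 2 := by
    intro y
    by_cases hy : y ∈ Metric.closedBall z (2 * ‖s‖)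
    · exact hx hy
    · rw [mem_closedBall_iff_norm, not_le] at hy
      have h1 := hx (Metric.mem_closedBall_self (by positivity) : z ∈ Metric.closedBall z (2 * ‖s‖))
      simp only [mem_ofPred_eq, sub_self, norm_zero] at h1
      have h2 := hs y
      have h3 := neg_le_of_abs_le (abs_real_inner_le_norm s (y - z))
      nlinarith [norm_nonneg s]
  refine ⟨x, fun y => ?_⟩
  refine le_of_forall_le_add_mul (c := ‖y - x‖ ^ 2 / 2) fun t ht => ?_
  have h1 := hmin (x + t • (y - x))
  have h2 := (convexOn_of_exists_isSubgradientAt hG).2 (mem_univ x) (mem_univ y)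
    (by linarith [ht.2] : 0 ≤ 1 - t) ht.1.le (by ring)
  have e1 : (1 - t) • x + t • y = x + t • (y - x) := by module
  have e2 : x + t • (y - x) - z = (x - z) + t • (y - x) := by abel
  rw [e1] at h2
  rw [e2, norm_add_sq_real, norm_smul, mul_pow, Real.norm_eq_abs, sq_abs, inner_smul_right] at h1
  have e3 : ⟪z - x, y - x⟫ = -⟪x - z, y - x⟫ := by rw [← inner_neg_left, neg_sub]
  rw [e3]
  simp only [smul_eq_mul] at h2
  have h3 : t * (G x + -⟪x - z, y - x⟫) ≤ t * (G y + t * (‖y - x‖ ^ 2 / 2)) := by nlinarith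
  exact le_of_mul_le_mul_left h3 ht.1

omit [FiniteDimensional ℝ P] in
theorem hasQuadExpansionAt_of_subgradient {G : P → ℝ} (hG : ∀ x, ∃ s, IsSubgradientAt G x s)
    {x s : P} {R : P →L[ℝ] P}
    (hR : ∀ κ > 0, ∃ r > 0, ∀ x' s', ‖x' - x‖ < r → IsSubgradientAt G x' s' →
      ‖s' - s - R (x' - x)‖ ≤ κ * ‖x' - x‖) : HasQuadExpansionAt G x s R := by
  intro κ hκ
  obtain ⟨r, hr, hr'⟩ := hR κ hκ
  filter_upwards [Metric.ball_mem_nhds (0 : P) hr] with v hv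
  rw [mem_ball_zero_iff] at hv
  have step : ∀ t ∈ Icc (0 : ℝ) 1, ∀ t' ∈ Icc (0 : ℝ) 1,
      (G (x + t' • v) - t' * ⟪s, v⟫ - t' ^ 2 / 2 * ⟪R v, v⟫)
        - (G (x + t • v) - t * ⟪s, v⟫ - t ^ 2 / 2 * ⟪R v, v⟫)
      ≤ κ * ‖v‖ ^ 2 * |t - t'| + |⟪R v, v⟫| / 2 * (t - t') ^ 2 := by
    intro t ht t' ht'
    obtain ⟨s', hs'⟩ := hG (x + t' • v)
    have hn : ‖x + t' • v - x‖ ≤ ‖v‖ := by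
      rw [add_sub_cancel_left, norm_smul, Real.norm_eq_abs, abs_of_nonneg ht'.1]
      exact mul_le_of_le_one_left (norm_nonneg _) ht'.2
    have h1 := hr' _ s' (hn.trans_lt hv) hs'
    have h2 : |⟪s' - s - R (x + t' • v - x), v⟫| ≤ κ * ‖v‖ ^ 2 := by
      refine (abs_real_inner_le_norm _ _).trans ?_
      rw [pow_two, ← mul_assoc]
      gcongr
      exact h1.trans (by gcongr)
    rw [add_sub_cancel_left, map_smul, inner_sub_left, inner_sub_left, real_inner_smul_left] at h2
    have h3 := hs' (x + t • v)
    have e : x + t • v - (x + t' • v) = (t - t') • v := by module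
    rw [e, real_inner_smul_right] at h3
    have h4 : -((t - t') * (⟪s', v⟫ - ⟪s, v⟫ - t' * ⟪R v, v⟫))
        ≤ κ * ‖v‖ ^ 2 * |t - t'| := by
      refine (neg_le_abs _).trans ?_
      rw [abs_mul, mul_comm]
      gcongr
    have h5 : (t - t') ^ 2 / 2 * ⟪R v, v⟫ ≤ |⟪R v, v⟫| / 2 * (t - t') ^ 2 := by
      nlinarith [le_abs_self ⟪R v, v⟫, sq_nonneg (t - t')]
    nlinarith
  have h := abs_sub_le_of_abs_sub_le_add_sq (K := κ * ‖v‖ ^ 2) (C := |⟪R v, v⟫| / 2)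
    (H := fun t => G (x + t • v) - t * ⟪s, v⟫ - t ^ 2 / 2 * ⟪R v, v⟫) (by
      intro t ht t' ht'
      rw [abs_le]
      have h1 := step t ht t' ht'
      have h2 := step t' ht' t ht
      rw [abs_sub_comm t' t] at h2
      constructor <;> nlinarith)
  rw [abs_sub_comm] at h
  simp only [one_smul, zero_smul, add_zero] at h
  convert h using 2
  ring

end ConvexSecondOrder

section QuadraticTouching

open Filter Topology MeasureTheory

variable {P : Type*} [NormedAddCommGroup P] [InnerProductSpace ℝ P] [FiniteDimensional ℝ P]

/-- A Lipschitz map is differentiable at some preimage of a small vector, provided it hits all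
small vectors. -/
theorem exists_differentiableAt_of_lipschitzWith {J N : P → P} {C C' : NNReal}
    (hJ : LipschitzWith C J) (hN : LipschitzWith C' N) {r : ℝ} (hr : 0 < r) {S : P → Prop}
    (hS : ∀ e, ‖e‖ < r → ∃ z, S z ∧ N z = e) : ∃ z, S z ∧ DifferentiableAt ℝ J z := by
  borelize P
  by_contra! hcon
  have hnull : μH[(Module.finrank ℝ P : ℝ)] {z | ¬ DifferentiableAt ℝ J z} = 0 :=
    ae_iff.1 hJ.ae_differentiableAt
  have himg : μH[(Module.finrank ℝ P : ℝ)] (N '' {z | ¬ DifferentiableAt ℝ J z}) = 0 :=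
    le_antisymm ((hN.hausdorffMeasure_image_le (Nat.cast_nonneg _) _).trans (by simp [hnull]))
      zero_le
  have hsub : Metric.ball (0 : P) r ⊆ N '' {z | ¬ DifferentiableAt ℝ J z} := by
    intro e he
    rw [mem_ball_zero_iff] at he
    obtain ⟨z, hSz, hz⟩ := hS e he
    exact ⟨z, hcon z hSz, hz⟩
  exact (Metric.measure_ball_pos μH[(Module.finrank ℝ P : ℝ)] (0 : P) hr).ne'
    (measure_mono_null hsub himg)

theorem exists_inverse_of_hasFDerivAt {J : P → P} {L : P →L[ℝ] P} {z : P} {C : ℝ} (hC : 0 < C)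
    (hL : HasFDerivAt J L z) (hexp : ∀ z', ‖z' - z‖ ≤ C * ‖J z' - J z‖) :
    ∃ M : P →L[ℝ] P, ∀ κ > 0, ∃ r > 0, ∀ z', ‖J z' - J z‖ < r →
      ‖z' - z - M (J z' - J z)‖ ≤ κ * ‖J z' - J z‖ := by
  have hanti : ∀ v, ‖v‖ ≤ C * ‖L v‖ := by
    intro v
    have h1 : Tendsto (fun t : ℝ => t⁻¹ • (J (z + t • v) - J z)) (𝓝[≠] 0) (𝓝 (L v)) :=
      hL.hasLineDerivAt v |>.tendsto_slope_zero
    refine le_of_tendsto_of_tendsto tendsto_const_nhds (h1.norm.const_mul C) ?_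
    filter_upwards [self_mem_nhdsWithin] with t ht
    have h2 := hexp (z + t • v)
    rw [add_sub_cancel_left, norm_smul] at h2
    rw [norm_smul, norm_inv]
    have ht' : 0 < ‖t‖ := norm_pos_iff.2 ht
    calc ‖v‖ = ‖t‖⁻¹ * (‖t‖ * ‖v‖) := by field_simp
      _ ≤ ‖t‖⁻¹ * (C * ‖J (z + t • v) - J z‖) := by gcongr
      _ = _ := by ring
  have hinj : Function.Injective (L : P →ₗ[ℝ] P) := by
    rw [← LinearMap.ker_eq_bot, LinearMap.ker_eq_bot']
    intro v hv
    have hv' : L v = 0 := hv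
    have := hanti v
    rw [hv', norm_zero, mul_zero] at this
    exact norm_le_zero_iff.1 this
  let e := LinearEquiv.ofInjectiveEndo (L : P →ₗ[ℝ] P) hinj
  have he : ∀ v, L (e.symm v) = v := fun v => e.apply_symm_apply v
  refine ⟨LinearMap.toContinuousLinearMap e.symm.toLinearMap, fun κ hκ => ?_⟩
  have hlo := hL.isLittleO.def (c := κ / C ^ 2) (by positivity)
  obtain ⟨r, hr, hr'⟩ := Metric.eventually_nhds_iff.1 hlo
  refine ⟨r / C, by positivity, fun z' hz' => ?_⟩
  have hz : ‖z' - z‖ < r := by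
    refine (hexp z').trans_lt ?_
    rw [lt_div_iff₀ hC] at hz'
    linarith
  have h1 := hr' (by rw [dist_eq_norm]; exact hz : dist z' z < r)
  change ‖z' - z - e.symm (J z' - J z)‖ ≤ _
  calc _ ≤ C * ‖L (z' - z - e.symm (J z' - J z))‖ := hanti _
    _ = C * ‖J z' - J z - L (z' - z)‖ := by rw [map_sub, he, norm_sub_rev]
    _ ≤ C * (κ / C ^ 2 * ‖z' - z‖) := by gcongr
    _ ≤ C * (κ / C ^ 2 * (C * ‖J z' - J z‖)) := by gcongr; exact hexp z'
    _ = κ * ‖J z' - J z‖ := by field_simp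

omit [FiniteDimensional ℝ P] in
theorem HasQuadExpansionAt.symmetrize [CompleteSpace P] {G : P → ℝ} {x s : P} {R : P →L[ℝ] P}
    (h : HasQuadExpansionAt G x s R) :
    ∃ R' : P →L[ℝ] P, (∀ v w, ⟪R' v, w⟫ = ⟪v, R' w⟫) ∧ HasQuadExpansionAt G x s R' := by
  refine ⟨(1 / 2 : ℝ) • (R + ContinuousLinearMap.adjoint R), fun v w => ?_, fun ε hε => ?_⟩
  · simp only [smul_apply, add_apply, inner_smul_left,
      inner_smul_right, inner_add_left, inner_add_right, ContinuousLinearMap.adjoint_inner_left,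
      ContinuousLinearMap.adjoint_inner_right, RCLike.conj_to_real]
    ring
  · filter_upwards [h ε hε] with v hv
    have : ⟪((1 / 2 : ℝ) • (R + ContinuousLinearMap.adjoint R)) v, v⟫ = ⟪R v, v⟫ := by
      simp only [smul_apply, add_apply, inner_smul_left,
        inner_add_left, ContinuousLinearMap.adjoint_inner_left, RCLike.conj_to_real]
      rw [real_inner_comm v (R v)]
      ring
    rwa [this]

/-- Jensen's lemma combined with Alexandrov's theorem: a convex function touched from above at `c`
by a quadratic function has, arbitrarily close to `c`, a point of twice differentiability at which
it is again touched from above by almost the same quadratic function. -/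
theorem exists_hasQuadExpansionAt_of_le_quadratic {G : P → ℝ}
    (hG : ∀ x, ∃ s, IsSubgradientAt G x s) {c p : P} {B : P →L[ℝ] P}
    (hB : ∀ v w, ⟪B v, w⟫ = ⟪v, B w⟫)
    (hle : ∀ x, G x ≤ G c + ⟪p, x - c⟫ + ⟪B (x - c), x - c⟫ / 2) {ρ : ℝ} (hρ : 0 < ρ) :
    ∃ (a s : P) (R : P →L[ℝ] P), ‖a - c‖ < ρ ∧ ‖s - p‖ < ρ ∧
      (∀ v w, ⟪R v, w⟫ = ⟪v, R w⟫) ∧ HasQuadExpansionAt G a s R ∧ IsSubgradientAt G a s ∧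
      ∀ h, G (a + h) ≤ G a + ⟪s, h⟫ + (⟪B h, h⟫ + ρ * ‖h‖ ^ 2) / 2 := by
  have hGc := continuous_of_exists_isSubgradientAt hG
  choose J hJ using exists_isSubgradientAt_sub hG
  have hJlip : LipschitzWith 1 J := LipschitzWith.of_dist_le_mul fun z z' => by
    rw [NNReal.coe_one, one_mul, dist_eq_norm, dist_eq_norm]
    exact (hJ z').norm_sub_le_of_sub (hJ z)
  set N : P → P := fun z => z - J z - p - B (J z - c) - ρ • (J z - c) with hN
  obtain ⟨C', hNlip⟩ : ∃ C', LipschitzWith C' N :=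
    ⟨_, (((LipschitzWith.id.sub hJlip).sub (LipschitzWith.const p)).sub
      (B.lipschitz.comp (hJlip.sub (LipschitzWith.const c)))).sub
      ((lipschitzWith_smul ρ).comp (hJlip.sub (LipschitzWith.const c)))⟩
  -- global maxima of the tilted functions
  have hmax : ∀ e : P, ∃ x, ‖x - c‖ ≤ 2 * ‖e‖ / ρ ∧ ∀ y,
      G y - ⟪p + e, y - c⟫ - ⟪B (y - c), y - c⟫ / 2 - ρ * ‖y - c‖ ^ 2 / 2
      ≤ G x - ⟪p + e, x - c⟫ - ⟪B (x - c), x - c⟫ / 2 - ρ * ‖x - c‖ ^ 2 / 2 := by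
    intro e
    have hcont : Continuous fun y => G y - ⟪p + e, y - c⟫ - ⟪B (y - c), y - c⟫ / 2
        - ρ * ‖y - c‖ ^ 2 / 2 := by fun_prop
    have hcm : c ∈ Metric.closedBall c (2 * ‖e‖ / ρ) :=
      Metric.mem_closedBall_self (by positivity)
    obtain ⟨x, hx, hx'⟩ := (isCompact_closedBall c (2 * ‖e‖ / ρ)).exists_isMaxOn
      ⟨c, hcm⟩ hcont.continuousOn
    refine ⟨x, mem_closedBall_iff_norm.1 hx, fun y => ?_⟩
    by_cases hy : y ∈ Metric.closedBall c (2 * ‖e‖ / ρ)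
    · exact hx' hy
    · rw [mem_closedBall_iff_norm, not_le, div_lt_iff₀ hρ] at hy
      have h1 := hx' hcm
      simp only [mem_ofPred_eq, sub_self, norm_zero, inner_zero_right] at h1
      have h2 := hle y
      have h3 := neg_le_of_abs_le (abs_real_inner_le_norm e (y - c))
      simp only [inner_add_left] at h1 ⊢
      nlinarith [norm_nonneg (y - c), norm_nonneg e]
  set r : ℝ := min (ρ ^ 2 / 4) (ρ / (4 * (1 + (‖B‖ + ρ) / ρ))) with hr
  have hr0 : 0 < r := by positivity
  -- consequences of maximality
  have key : ∀ e x, (∀ y,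
      G y - ⟪p + e, y - c⟫ - ⟪B (y - c), y - c⟫ / 2 - ρ * ‖y - c‖ ^ 2 / 2
      ≤ G x - ⟪p + e, x - c⟫ - ⟪B (x - c), x - c⟫ / 2 - ρ * ‖x - c‖ ^ 2 / 2) →
      ∀ h, G (x + h) ≤ G x + ⟪p + e + B (x - c) + ρ • (x - c), h⟫
        + (⟪B h, h⟫ + ρ * ‖h‖ ^ 2) / 2 := by
    intro e x hx h
    have h1 := hx (x + h)
    have e1 : x + h - c = (x - c) + h := by abel
    have e2 : ⟪B h, x - c⟫ = ⟪B (x - c), h⟫ := by rw [hB, real_inner_comm]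
    rw [e1, norm_add_sq_real, map_add] at h1
    simp only [inner_add_left, inner_add_right, real_inner_smul_left] at h1 ⊢
    rw [e2] at h1
    linarith
  set C : ℝ := (‖B‖ + ρ) / 2 with hCdef
  have hC0 : 0 < C := by positivity
  have key2 : ∀ x s : P, (∀ h, G (x + h) ≤ G x + ⟪s, h⟫ + (⟪B h, h⟫ + ρ * ‖h‖ ^ 2) / 2) →
      ∀ y, G y ≤ G x + ⟪s, y - x⟫ + C * ‖y - x‖ ^ 2 := by
    intro x s h y
    have h1 := h (y - x)
    rw [add_sub_cancel] at h1
    have h2 := (real_inner_le_norm (B (y - x)) (y - x)).trans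
      (mul_le_mul_of_nonneg_right (B.le_opNorm (y - x)) (norm_nonneg _))
    have h3 : C * ‖y - x‖ ^ 2 = (‖B‖ * ‖y - x‖ * ‖y - x‖ + ρ * ‖y - x‖ ^ 2) / 2 := by
      rw [hCdef]; ring
    linarith
  have hNz : ∀ e x, (∀ h, G (x + h) ≤ G x + ⟪p + e + B (x - c) + ρ • (x - c), h⟫
        + (⟪B h, h⟫ + ρ * ‖h‖ ^ 2) / 2) →
      J (x + (p + e + B (x - c) + ρ • (x - c))) = x := by
    intro e x h
    obtain ⟨s, hs⟩ := hG x
    have hs' := hs.eq_of_forall_le hC0.le (key2 x _ h)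
    have h1 := (hJ (x + s)).norm_sub_le_of_sub
      (show IsSubgradientAt G x (x + s - x) by rwa [add_sub_cancel_left])
    rw [sub_self, norm_zero] at h1
    rw [← hs']
    exact (sub_eq_zero.1 (norm_le_zero_iff.1 h1)).symm
  obtain ⟨z, ⟨e, x, her, hxc, hx, rfl⟩, hzd⟩ := exists_differentiableAt_of_lipschitzWith hJlip hNlip
    hr0 (S := fun z => ∃ e x, ‖e‖ < r ∧ ‖x - c‖ ≤ 2 * ‖e‖ / ρ ∧
      (∀ h, G (x + h) ≤ G x + ⟪p + e + B (x - c) + ρ • (x - c), h⟫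
        + (⟪B h, h⟫ + ρ * ‖h‖ ^ 2) / 2) ∧ z = x + (p + e + B (x - c) + ρ • (x - c))) (by
      intro e he
      obtain ⟨x, hxc, hx⟩ := hmax e
      have h1 := hNz e x (key e x hx)
      refine ⟨x + (p + e + B (x - c) + ρ • (x - c)), ⟨e, x, he, hxc, key e x hx, rfl⟩, ?_⟩
      rw [hN]
      simp only [h1]
      abel)
  have hJx := hNz e x hx
  have hJz := hJ (x + (p + e + B (x - c) + ρ • (x - c)))
  set s : P := p + e + B (x - c) + ρ • (x - c) with hs
  rw [hJx, add_sub_cancel_left] at hJz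
  obtain ⟨M, hM⟩ := exists_inverse_of_hasFDerivAt (C := 1 + 4 * C) (by positivity)
    hzd.hasFDerivAt (fun z' => by
      have h1 := hJz.norm_sub_le hC0 (key2 x s hx) (hJ z')
      rw [hJx]
      calc ‖z' - (x + s)‖ = ‖(J z' - x) + (z' - J z' - s)‖ := by congr 1; abel
        _ ≤ ‖J z' - x‖ + 4 * C * ‖J z' - x‖ := (norm_add_le _ _).trans (by gcongr)
        _ = _ := by ring)
  have hexp : HasQuadExpansionAt G x s (M - ContinuousLinearMap.id ℝ P) := by
    refine hasQuadExpansionAt_of_subgradient hG fun κ hκ => ?_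
    obtain ⟨r', hr', h⟩ := hM κ hκ
    refine ⟨r', hr', fun x' s' hx' hs' => ?_⟩
    have h1 := (hJ (x' + s')).norm_sub_le_of_sub
      (show IsSubgradientAt G x' (x' + s' - x') by rwa [add_sub_cancel_left])
    rw [sub_self, norm_zero] at h1
    have h2 : J (x' + s') = x' := (sub_eq_zero.1 (norm_le_zero_iff.1 h1)).symm
    have h3 := h (x' + s')
    rw [hJx, h2] at h3
    refine (le_of_eq ?_).trans (h3 hx')
    rw [sub_apply, ContinuousLinearMap.id_apply]
    congr 1
    abel
  obtain ⟨R, hRs, hR⟩ := hexp.symmetrize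
  refine ⟨x, s, R, ?_, ?_, hRs, hR, hJz, hx⟩
  · refine hxc.trans_lt ?_
    rw [div_lt_iff₀ hρ]
    have : r ≤ ρ ^ 2 / 4 := min_le_left _ _
    nlinarith
  · have h1 : ‖s - p‖ ≤ ‖e‖ + (‖B‖ + ρ) * ‖x - c‖ := by
      have e1 : s - p = e + (B (x - c) + ρ • (x - c)) := by rw [hs]; abel
      rw [e1, add_mul]
      refine (norm_add_le _ _).trans (add_le_add_right ((norm_add_le _ _).trans ?_) _)
      rw [norm_smul, Real.norm_eq_abs, abs_of_pos hρ]
      exact add_le_add_left (B.le_opNorm _) _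
    set q := (‖B‖ + ρ) / ρ with hq
    have hq0 : 0 ≤ q := by positivity
    have h2 : (‖B‖ + ρ) * ‖x - c‖ ≤ 2 * q * ‖e‖ := by
      calc _ ≤ (‖B‖ + ρ) * (2 * ‖e‖ / ρ) := by gcongr
        _ = _ := by rw [hq]; ring
    have h3 : r ≤ ρ / (4 * (1 + q)) := min_le_right _ _
    rw [le_div_iff₀ (by positivity)] at h3
    nlinarith [norm_nonneg e]

end QuadraticTouching

section SumTheorem

open Filter Topology

theorem inner_map_smul_self {P : Type*} [NormedAddCommGroup P] [InnerProductSpace ℝ P]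
    (R : P →L[ℝ] P) (t : ℝ) (h : P) : ⟪R (t • h), t • h⟫ = t ^ 2 * ⟪R h, h⟫ := by
  rw [map_smul, inner_smul_left, inner_smul_right, RCLike.conj_to_real]
  ring

theorem HasQuadExpansionAt.tendsto {P : Type*} [NormedAddCommGroup P] [InnerProductSpace ℝ P]
    {G : P → ℝ} {a s : P} {R : P →L[ℝ] P} (hR : HasQuadExpansionAt G a s R) (h : P) :
    Tendsto (fun t : ℝ => 2 * (G (a + t • h) - G a - ⟪s, t • h⟫) / t ^ 2) (𝓝[>] 0)
      (𝓝 ⟪R h, h⟫) := by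
  rw [Metric.tendsto_nhds]
  intro δ hδ
  have h1 : Tendsto (fun t : ℝ => t • h) (𝓝[>] 0) (𝓝 0) := by
    have : Continuous fun t : ℝ => t • h := by fun_prop
    simpa using (this.tendsto 0).mono_left nhdsWithin_le_nhds
  have hpos : 0 < δ / (4 * (‖h‖ ^ 2 + 1)) := by positivity
  filter_upwards [h1.eventually (hR _ hpos), self_mem_nhdsWithin] with t ht ht0
  rw [mem_Ioi] at ht0
  have e : 2 * (G (a + t • h) - G a - ⟪s, t • h⟫) / t ^ 2 - ⟪R h, h⟫
      = 2 * (G (a + t • h) - G a - ⟪s, t • h⟫ - ⟪R (t • h), t • h⟫ / 2) / t ^ 2 := by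
    rw [inner_map_smul_self]
    have : t ≠ 0 := ht0.ne'
    field_simp
  rw [Real.dist_eq, e, abs_div, abs_mul, abs_two, abs_of_pos (pow_pos ht0 2),
    div_lt_iff₀ (pow_pos ht0 2)]
  rw [norm_smul, mul_pow, Real.norm_eq_abs, sq_abs] at ht
  have h2 : δ / (4 * (‖h‖ ^ 2 + 1)) * ‖h‖ ^ 2 ≤ δ / 4 := by
    rw [div_mul_eq_mul_div, div_le_div_iff₀ (by positivity) (by norm_num)]
    nlinarith [sq_nonneg ‖h‖]
  nlinarith [pow_pos ht0 2, mul_le_mul_of_nonneg_left h2 (pow_pos ht0 2).le]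

/-- The Legendre-type transform over `K` which encodes the sup-convolution of
`z ↦ f z - ⟪p, z⟫` with parameter `L`. -/
noncomputable def supTransform {P : Type*} [NormedAddCommGroup P] [InnerProductSpace ℝ P]
    (K : Set P) (f : P → ℝ) (p : P) (L : ℝ) (w : P) : ℝ :=
  sSup ((fun z => f z - ⟪p, z⟫ - L * ‖z‖ ^ 2 / 2 + L * ⟪z, w⟫) '' K)

variable {P : Type*} [NormedAddCommGroup P] [InnerProductSpace ℝ P]

theorem exists_isGreatest_supTransform {K : Set P} (hK : IsCompact K) (hne : K.Nonempty)
    {f : P → ℝ} (hf : ContinuousOn f K) (p : P) (L : ℝ) (w : P) :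
    ∃ z ∈ K, supTransform K f p L w = f z - ⟪p, z⟫ - L * ‖z‖ ^ 2 / 2 + L * ⟪z, w⟫ ∧
      ∀ z' ∈ K, f z' - ⟪p, z'⟫ - L * ‖z'‖ ^ 2 / 2 + L * ⟪z', w⟫ ≤ supTransform K f p L w := by
  have hc : ContinuousOn (fun z => f z - ⟪p, z⟫ - L * ‖z‖ ^ 2 / 2 + L * ⟪z, w⟫) K := by fun_prop
  obtain ⟨z, hz, h1, h2⟩ := hK.exists_sSup_image_eq_and_ge hne hc
  exact ⟨z, hz, h1, fun z' hz' => (h2 z' hz').trans h1.ge⟩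

theorem le_quadratic_of_sq_le {B : P →L[ℝ] P} (hB : ∀ v w, ⟪B v, w⟫ = ⟪v, B w⟫) {M η L : ℝ}
    (hM : ∀ v w, ⟪B v, w⟫ ≤ M * ‖v‖ * ‖w‖) (hη : 0 < η) (hL : M + M ^ 2 / η ≤ L) (v e : P) :
    ⟪B (v + e), v + e⟫ - L * ‖e‖ ^ 2 ≤ ⟪B v, v⟫ + η * ‖v‖ ^ 2 := by
  have e1 : ⟪B (v + e), v + e⟫ = ⟪B v, v⟫ + 2 * ⟪B v, e⟫ + ⟪B e, e⟫ := by
    rw [map_add, inner_add_left, inner_add_right, inner_add_right, hB e v, real_inner_comm (B v) e]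
    ring
  have h1 := hM v e
  have h2 := hM e e
  have h3 := mul_le_mul_of_nonneg_right hL (sq_nonneg ‖e‖)
  have h4 : 2 * (M * ‖v‖ * ‖e‖) ≤ η * ‖v‖ ^ 2 + M ^ 2 / η * ‖e‖ ^ 2 := by
    have : 0 ≤ (η * ‖v‖ - M * ‖e‖) ^ 2 / η := by positivity
    have e2 : (η * ‖v‖ - M * ‖e‖) ^ 2 / η
        = η * ‖v‖ ^ 2 - 2 * (M * ‖v‖ * ‖e‖) + M ^ 2 / η * ‖e‖ ^ 2 := by
      field_simp; ring
    linarith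
  rw [e1]
  nlinarith

/-- Jensen's lemma for a function on a compact set touched from above by a quadratic: nearby
second-order upper contact via the sup-convolution. -/
theorem exists_supTransform_expansion [FiniteDimensional ℝ P] {K : Set P} (hK : IsCompact K)
    {f : P → ℝ} (hf : ContinuousOn f K) {c p : P} (hc : c ∈ K) {B : P →L[ℝ] P}
    (hB : ∀ v w, ⟪B v, w⟫ = ⟪v, B w⟫) {M η L : ℝ} (hM : ∀ v w, ⟪B v, w⟫ ≤ M * ‖v‖ * ‖w‖)
    (hη : 0 < η) (hL : M + M ^ 2 / η ≤ L) (hL0 : 0 < L)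
    (hle : ∀ z ∈ K, f z ≤ f c + ⟪p, z - c⟫ + ⟪B (z - c), z - c⟫ / 2) {ρ : ℝ} (hρ : 0 < ρ) :
    ∃ z ∈ K, ∃ (a q : P) (R : P →L[ℝ] P), ‖z - c‖ < ρ ∧ ‖q - p‖ < ρ ∧
      (∀ v w, ⟪R v, w⟫ = ⟪v, R w⟫) ∧
      HasQuadExpansionAt (supTransform K f p L) a (L • z) R ∧
      (∀ h, z + h ∈ K → f (z + h) ≤ f z + ⟪q, h⟫ - L * ‖h‖ ^ 2 / 2 +
        (supTransform K f p L (a + h) - supTransform K f p L a - ⟪L • z, h⟫)) ∧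
      (∀ h, 0 ≤ ⟪R h, h⟫) ∧ ∀ h, ⟪R h, h⟫ ≤ ⟪B h, h⟫ + (η + L + ρ) * ‖h‖ ^ 2 := by
  set G := supTransform K f p L
  have hG : ∀ w, ∃ z ∈ K, G w = f z - ⟪p, z⟫ - L * ‖z‖ ^ 2 / 2 + L * ⟪z, w⟫ ∧
      ∀ z' ∈ K, f z' - ⟪p, z'⟫ - L * ‖z'‖ ^ 2 / 2 + L * ⟪z', w⟫ ≤ G w :=
    exists_isGreatest_supTransform hK ⟨c, hc⟩ hf p L
  have hGsub : ∀ w, ∀ z ∈ K, G w = f z - ⟪p, z⟫ - L * ‖z‖ ^ 2 / 2 + L * ⟪z, w⟫ →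
      IsSubgradientAt G w (L • z) := by
    intro w z hz hw y
    obtain ⟨-, -, -, h⟩ := hG y
    have := h z hz
    rw [hw, inner_smul_left, inner_sub_right]
    simp only [RCLike.conj_to_real]
    linarith
  have hB0 : ∀ w, G w ≤ f c - ⟪p, c⟫ - L * ‖c‖ ^ 2 / 2 + L * ⟪c, w⟫ +
      (⟪B (w - c), w - c⟫ + (η + L) * ‖w - c‖ ^ 2) / 2 := by
    intro w
    obtain ⟨z, hz, h1, -⟩ := hG w
    have h2 := hle z hz
    have h3 := le_quadratic_of_sq_le hB hM hη hL (w - c) (z - w)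
    rw [show w - c + (z - w) = z - c by abel] at h3
    have e1 : ‖z - w‖ ^ 2 = ‖z‖ ^ 2 - 2 * ⟪z, w⟫ + ‖w‖ ^ 2 := norm_sub_sq_real z w
    have e2 : ‖w - c‖ ^ 2 = ‖w‖ ^ 2 - 2 * ⟪w, c⟫ + ‖c‖ ^ 2 := norm_sub_sq_real w c
    rw [real_inner_comm] at e2
    rw [inner_sub_right] at h2
    rw [h1]
    nlinarith
  have hGc : G c = f c - ⟪p, c⟫ + L * ‖c‖ ^ 2 / 2 := by
    obtain ⟨-, -, -, h⟩ := hG c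
    have h1 := h c hc
    have h2 := hB0 c
    simp only [sub_self, map_zero, inner_zero_left, norm_zero] at h2
    rw [real_inner_self_eq_norm_sq] at h1 h2
    linarith
  obtain ⟨a, s, R, hac, hs, hR, hexp, hsub, hup⟩ :=
    exists_hasQuadExpansionAt_of_le_quadratic (G := G) (c := c) (p := L • c)
      (B := B + (η + L) • ContinuousLinearMap.id ℝ P)
      (fun w => by obtain ⟨z, hz, h1, -⟩ := hG w; exact ⟨_, hGsub w z hz h1⟩)
      (fun v w => by
        simp only [add_apply, smul_apply, ContinuousLinearMap.id_apply, inner_add_left,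
          inner_add_right, inner_smul_left, inner_smul_right, hB v w, RCLike.conj_to_real])
      (fun w => by
        refine (hB0 w).trans (le_of_eq ?_)
        simp only [hGc, add_apply, smul_apply, ContinuousLinearMap.id_apply, inner_add_left,
          inner_smul_left, inner_sub_right c, real_inner_self_eq_norm_sq, RCLike.conj_to_real]
        ring)
      (ρ := min (min (ρ / 2) (ρ * L)) (ρ / (2 * L))) (by positivity)
  have hup' : ∀ h, G (a + h) ≤ G a + ⟪s, h⟫ + (⟪B h, h⟫ + (η + L + ρ) * ‖h‖ ^ 2) / 2 := by
    intro h
    refine (hup h).trans ?_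
    simp only [add_apply, smul_apply, ContinuousLinearMap.id_apply, inner_add_left,
      inner_smul_left, real_inner_self_eq_norm_sq, RCLike.conj_to_real]
    have : min (min (ρ / 2) (ρ * L)) (ρ / (2 * L)) ≤ ρ :=
      (min_le_left _ _).trans ((min_le_left _ _).trans (by linarith))
    nlinarith [mul_le_mul_of_nonneg_right this (sq_nonneg ‖h‖)]
  obtain ⟨z, hz, haz, hmax⟩ := hG a
  have hsz : L • z = s := by
    have hM0 := fun h : P => hM h h
    refine (hGsub a z hz haz).eq_of_forall_le (C := (|M| + (η + L + ρ)) / 2) (by positivity) ?_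
    intro y
    have h1 := hup' (y - a)
    rw [add_sub_cancel] at h1
    have h2 := hM0 (y - a)
    have h3 : M * ‖y - a‖ * ‖y - a‖ ≤ |M| * ‖y - a‖ ^ 2 := by
      rw [mul_assoc, ← sq]
      exact mul_le_mul_of_nonneg_right (le_abs_self M) (sq_nonneg _)
    linarith
  subst hsz
  have hzc : ‖z - c‖ < ρ := by
    rw [← smul_sub, norm_smul, Real.norm_eq_abs, abs_of_pos hL0] at hs
    have : L * ‖z - c‖ < ρ * L := hs.trans_le ((min_le_left _ _).trans (min_le_right _ _))
    nlinarith
  have hzc2 : L * ‖z - c‖ < ρ / 2 := by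
    rw [← smul_sub, norm_smul, Real.norm_eq_abs, abs_of_pos hL0] at hs
    exact hs.trans_le ((min_le_left _ _).trans (min_le_left _ _))
  have hac2 : L * ‖a - c‖ < ρ / 2 := by
    have := hac.trans_le (min_le_right _ _)
    rw [lt_div_iff₀ (by positivity)] at this
    linarith
  refine ⟨z, hz, a, p + L • (z - a), R, hzc, ?_, hR, hexp, fun h hh => ?_, fun h => ?_,
    fun h => ?_⟩
  · rw [add_sub_cancel_left, norm_smul, Real.norm_eq_abs, abs_of_pos hL0]
    have := norm_sub_le (z - c) (a - c)
    rw [sub_sub_sub_cancel_right] at this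
    nlinarith
  · obtain ⟨-, -, -, h1⟩ := hG (a + h)
    have h2 := h1 (z + h) hh
    rw [norm_add_sq_real] at h2
    rw [haz]
    simp only [inner_add_left, inner_add_right, inner_smul_left, inner_sub_left,
      RCLike.conj_to_real, real_inner_self_eq_norm_sq, real_inner_comm h a] at h2 ⊢
    nlinarith
  · refine ge_of_tendsto (hexp.tendsto h) ?_
    filter_upwards [self_mem_nhdsWithin] with t ht
    have h1 := hsub (a + t • h)
    rw [add_sub_cancel_left] at h1
    have : 0 ≤ G (a + t • h) - G a - ⟪L • z, t • h⟫ := by linarith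
    positivity
  · refine le_of_tendsto (hexp.tendsto h) ?_
    filter_upwards [self_mem_nhdsWithin] with t ht
    rw [mem_Ioi] at ht
    have h1 := hup' (t • h)
    rw [div_le_iff₀ (pow_pos ht 2)]
    rw [inner_map_smul_self, norm_smul, mul_pow, Real.norm_eq_abs, sq_abs] at h1
    linarith

end SumTheorem

section ProductSum

open Filter Topology

variable {E : Type*} [NormedAddCommGroup E] [InnerProductSpace ℝ E]

theorem isCompact_withLp_prod {E F : Type*} [NormedAddCommGroup E] [NormedAddCommGroup F]
    {K : Set (E × F)} (hK : IsCompact K) :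
    IsCompact {z : WithLp 2 (E × F) | (z.fst, z.snd) ∈ K} := by
  have : {z : WithLp 2 (E × F) | (z.fst, z.snd) ∈ K} = WithLp.toLp 2 '' K := by
    ext z
    constructor
    · exact fun hz => ⟨(z.fst, z.snd), hz, rfl⟩
    · rintro ⟨w, hw, rfl⟩
      exact hw
  rw [this]
  exact hK.image (WithLp.prod_continuous_toLp 2 E F)

theorem supTransform_prod {K₁ K₂ : Set E} (hK₁ : IsCompact K₁) (hK₂ : IsCompact K₂)
    (hne₁ : K₁.Nonempty) (hne₂ : K₂.Nonempty) {f₁ f₂ : E → ℝ} (hf₁ : ContinuousOn f₁ K₁)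
    (hf₂ : ContinuousOn f₂ K₂) (p₁ p₂ : E) (L : ℝ) (w : WithLp 2 (E × E)) :
    supTransform {z : WithLp 2 (E × E) | (z.fst, z.snd) ∈ K₁ ×ˢ K₂}
        (fun z => f₁ z.fst + f₂ z.snd) (WithLp.toLp 2 (p₁, p₂)) L w
      = supTransform K₁ f₁ p₁ L w.fst + supTransform K₂ f₂ p₂ L w.snd := by
  have hf : ContinuousOn (fun z : WithLp 2 (E × E) => f₁ z.fst + f₂ z.snd)
      {z : WithLp 2 (E × E) | (z.fst, z.snd) ∈ K₁ ×ˢ K₂} :=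
    (hf₁.comp (by fun_prop) fun z hz => hz.1).add (hf₂.comp (by fun_prop) fun z hz => hz.2)
  obtain ⟨c₁, hc₁⟩ := hne₁
  obtain ⟨c₂, hc₂⟩ := hne₂
  obtain ⟨z₁, hz₁, h1, h1'⟩ := exists_isGreatest_supTransform hK₁ ⟨c₁, hc₁⟩ hf₁ p₁ L w.fst
  obtain ⟨z₂, hz₂, h2, h2'⟩ := exists_isGreatest_supTransform hK₂ ⟨c₂, hc₂⟩ hf₂ p₂ L w.snd
  obtain ⟨z, hz, h3, h3'⟩ := exists_isGreatest_supTransform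
    (isCompact_withLp_prod (hK₁.prod hK₂)) ⟨WithLp.toLp 2 (c₁, c₂), hc₁, hc₂⟩ hf
    (WithLp.toLp 2 (p₁, p₂)) L w
  have h4 := h3' (WithLp.toLp 2 (z₁, z₂)) ⟨hz₁, hz₂⟩
  have h5 := h1' z.fst hz.1
  have h6 := h2' z.snd hz.2
  simp only [WithLp.prod_inner_apply, WithLp.prod_norm_sq_eq_of_L2, WithLp.ofLp_fst,
    WithLp.ofLp_snd, WithLp.toLp_fst, WithLp.toLp_snd] at h3 h4 ⊢
  refine le_antisymm ?_ ?_ <;> linarith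

theorem HasQuadExpansionAt.inner_add_of_separable {P : Type*} [NormedAddCommGroup P]
    [InnerProductSpace ℝ P] {G : P → ℝ} {a s : P} {R : P →L[ℝ] P}
    (hR : HasQuadExpansionAt G a s R) {h k : P}
    (hG : ∀ t : ℝ, G (a + t • (h + k)) + G a = G (a + t • h) + G (a + t • k)) :
    ⟪R (h + k), h + k⟫ = ⟪R h, h⟫ + ⟪R k, k⟫ := by
  refine tendsto_nhds_unique (hR.tendsto (h + k)) (((hR.tendsto h).add (hR.tendsto k)).congr ?_)
  intro t
  have e : ⟪s, t • (h + k)⟫ = ⟪s, t • h⟫ + ⟪s, t • k⟫ := by rw [smul_add, inner_add_right]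
  rw [e, ← add_div]
  congr 1
  linear_combination -2 * hG t

/-- The theorem on sums: second-order upper contact for each summand of `f₁ + f₂` touched from
above by a quadratic. -/
theorem exists_upper_jets_of_add_le [FiniteDimensional ℝ E] {K₁ K₂ : Set E}
    (hK₁ : IsCompact K₁) (hK₂ : IsCompact K₂) {f₁ f₂ : E → ℝ} (hf₁ : ContinuousOn f₁ K₁)
    (hf₂ : ContinuousOn f₂ K₂) {c₁ c₂ : E} (hc₁ : c₁ ∈ K₁) (hc₂ : c₂ ∈ K₂) {p₁ p₂ : E}
    {B : WithLp 2 (E × E) →L[ℝ] WithLp 2 (E × E)} (hB : ∀ v w, ⟪B v, w⟫ = ⟪v, B w⟫)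
    {M η L : ℝ} (hM : ∀ v w, ⟪B v, w⟫ ≤ M * ‖v‖ * ‖w‖) (hη : 0 < η)
    (hL : M + M ^ 2 / η ≤ L) (hL0 : 0 < L)
    (hle : ∀ z₁ ∈ K₁, ∀ z₂ ∈ K₂, f₁ z₁ + f₂ z₂ ≤ f₁ c₁ + f₂ c₂ + ⟪p₁, z₁ - c₁⟫ + ⟪p₂, z₂ - c₂⟫ +
      ⟪B (WithLp.toLp 2 (z₁ - c₁, z₂ - c₂)), WithLp.toLp 2 (z₁ - c₁, z₂ - c₂)⟫ / 2)
    {ρ : ℝ} (hρ : 0 < ρ) :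
    ∃ z₁ ∈ K₁, ∃ z₂ ∈ K₂, ∃ (q₁ q₂ : E) (X₁ X₂ : E →L[ℝ] E),
      ‖z₁ - c₁‖ < ρ ∧ ‖z₂ - c₂‖ < ρ ∧ ‖q₁ - p₁‖ < ρ ∧ ‖q₂ - p₂‖ < ρ ∧
      (∀ v w, ⟪X₁ v, w⟫ = ⟪v, X₁ w⟫) ∧ (∀ v w, ⟪X₂ v, w⟫ = ⟪v, X₂ w⟫) ∧
      (∀ δ > 0, ∀ᶠ h in 𝓝 (0 : E), z₁ + h ∈ K₁ →
        f₁ (z₁ + h) ≤ f₁ z₁ + ⟪q₁, h⟫ + ⟪X₁ h, h⟫ / 2 + δ * ‖h‖ ^ 2) ∧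
      (∀ δ > 0, ∀ᶠ h in 𝓝 (0 : E), z₂ + h ∈ K₂ →
        f₂ (z₂ + h) ≤ f₂ z₂ + ⟪q₂, h⟫ + ⟪X₂ h, h⟫ / 2 + δ * ‖h‖ ^ 2) ∧
      (∀ h, -(L * ‖h‖ ^ 2) ≤ ⟪X₁ h, h⟫) ∧ (∀ h, -(L * ‖h‖ ^ 2) ≤ ⟪X₂ h, h⟫) ∧
      ∀ h k, ⟪X₁ h, h⟫ + ⟪X₂ k, k⟫ ≤
        ⟪B (WithLp.toLp 2 (h, k)), WithLp.toLp 2 (h, k)⟫ + (η + ρ) * (‖h‖ ^ 2 + ‖k‖ ^ 2) := by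
  have hf : ContinuousOn (fun z : WithLp 2 (E × E) => f₁ z.fst + f₂ z.snd)
      {z : WithLp 2 (E × E) | (z.fst, z.snd) ∈ K₁ ×ˢ K₂} :=
    (hf₁.comp (by fun_prop) fun z hz => hz.1).add (hf₂.comp (by fun_prop) fun z hz => hz.2)
  obtain ⟨z, hz, a, q, R, hzc, hqp, hR, hexp, hjet, hlow, hup⟩ := exists_supTransform_expansion
    (isCompact_withLp_prod (hK₁.prod hK₂)) hf (c := WithLp.toLp 2 (c₁, c₂))
    (p := WithLp.toLp 2 (p₁, p₂)) ⟨hc₁, hc₂⟩ hB hM hη hL hL0 (fun z hz => by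
      have := hle z.fst hz.1 z.snd hz.2
      have e : z - WithLp.toLp 2 (c₁, c₂) = WithLp.toLp 2 (z.fst - c₁, z.snd - c₂) := rfl
      rw [e, WithLp.prod_inner_apply]
      simpa [add_assoc] using this) hρ
  set G := supTransform {z : WithLp 2 (E × E) | (z.fst, z.snd) ∈ K₁ ×ˢ K₂}
    (fun z => f₁ z.fst + f₂ z.snd) (WithLp.toLp 2 (p₁, p₂)) L with hGdef
  have hG := supTransform_prod hK₁ hK₂ ⟨c₁, hc₁⟩ ⟨c₂, hc₂⟩ hf₁ hf₂ p₁ p₂ L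
  rw [← hGdef] at hG
  let i₁ : E →L[ℝ] WithLp 2 (E × E) := (WithLp.prodContinuousLinearEquiv 2 ℝ E E).symm ∘L
    ContinuousLinearMap.inl ℝ E E
  let i₂ : E →L[ℝ] WithLp 2 (E × E) := (WithLp.prodContinuousLinearEquiv 2 ℝ E E).symm ∘L
    ContinuousLinearMap.inr ℝ E E
  have hi₁ : ∀ h, i₁ h = WithLp.toLp 2 (h, 0) := fun h => rfl
  have hi₂ : ∀ h, i₂ h = WithLp.toLp 2 (0, h) := fun h => rfl
  have hn₁ : ∀ h, ‖i₁ h‖ ^ 2 = ‖h‖ ^ 2 := fun h => by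
    rw [hi₁, WithLp.prod_norm_sq_eq_of_L2]; simp
  have hn₂ : ∀ h, ‖i₂ h‖ ^ 2 = ‖h‖ ^ 2 := fun h => by
    rw [hi₂, WithLp.prod_norm_sq_eq_of_L2]; simp
  have hsplit : ∀ h k : E, WithLp.toLp 2 (h, k) = i₁ h + i₂ k := fun h k => by
    rw [hi₁, hi₂, ← WithLp.toLp_add]; simp
  have hsep : ∀ h k : E, ⟪R (i₁ h + i₂ k), i₁ h + i₂ k⟫ = ⟪R (i₁ h), i₁ h⟫ + ⟪R (i₂ k), i₂ k⟫ := by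
    intro h k
    refine hexp.inner_add_of_separable fun t => ?_
    rw [hG, hG, hG, hG]
    simp [hi₁, hi₂]
    ring
  have hX : ∀ i : E →L[ℝ] WithLp 2 (E × E), ∀ v w,
      ⟪(ContinuousLinearMap.adjoint i ∘L R ∘L i - L • ContinuousLinearMap.id ℝ E) v, w⟫
        = ⟪R (i v), i w⟫ - L * ⟪v, w⟫ := by
    intro i v w
    simp [inner_sub_left, inner_smul_left, ContinuousLinearMap.adjoint_inner_left]
  have hXs : ∀ i : E →L[ℝ] WithLp 2 (E × E), ∀ v w,
      ⟪(ContinuousLinearMap.adjoint i ∘L R ∘L i - L • ContinuousLinearMap.id ℝ E) v, w⟫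
        = ⟪v, (ContinuousLinearMap.adjoint i ∘L R ∘L i - L • ContinuousLinearMap.id ℝ E) w⟫ := by
    intro i v w
    rw [← real_inner_comm v, hX, hX, hR (i v), real_inner_comm v w, real_inner_comm (i v)]
  have hloc : ∀ i : E →L[ℝ] WithLp 2 (E × E), (∀ h, ‖i h‖ ^ 2 = ‖h‖ ^ 2) → ∀ δ > 0,
      ∀ᶠ h in 𝓝 (0 : E), z + i h ∈ {z : WithLp 2 (E × E) | (z.fst, z.snd) ∈ K₁ ×ˢ K₂} →
        f₁ (z + i h).fst + f₂ (z + i h).snd ≤ f₁ z.fst + f₂ z.snd + ⟪q, i h⟫ +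
          (⟪R (i h), i h⟫ - L * ⟪h, h⟫) / 2 + δ * ‖h‖ ^ 2 := by
    intro i hi δ hδ
    have hi0 : Tendsto i (𝓝 0) (𝓝 0) := by simpa using i.continuous.tendsto 0
    filter_upwards [hi0.eventually (hexp δ hδ)] with h hh hK
    have h1 := hjet (i h) hK
    have h2 := (abs_le.1 hh).2
    rw [hi] at h1 h2
    rw [real_inner_self_eq_norm_sq]
    linarith
  have hle_fst : ∀ w : WithLp 2 (E × E), ‖w.fst‖ ≤ ‖w‖ := fun w => by
    have := WithLp.prod_norm_sq_eq_of_L2 w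
    rw [← sq_le_sq₀ (norm_nonneg _) (norm_nonneg _)]
    nlinarith [sq_nonneg ‖w.snd‖]
  have hle_snd : ∀ w : WithLp 2 (E × E), ‖w.snd‖ ≤ ‖w‖ := fun w => by
    have := WithLp.prod_norm_sq_eq_of_L2 w
    rw [← sq_le_sq₀ (norm_nonneg _) (norm_nonneg _)]
    nlinarith [sq_nonneg ‖w.fst‖]
  refine ⟨z.fst, hz.1, z.snd, hz.2, q.fst, q.snd,
    ContinuousLinearMap.adjoint i₁ ∘L R ∘L i₁ - L • ContinuousLinearMap.id ℝ E,
    ContinuousLinearMap.adjoint i₂ ∘L R ∘L i₂ - L • ContinuousLinearMap.id ℝ E,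
    (hle_fst _).trans_lt hzc, (hle_snd _).trans_lt hzc, (hle_fst _).trans_lt hqp,
    (hle_snd _).trans_lt hqp, hXs i₁, hXs i₂, fun δ hδ => ?_, fun δ hδ => ?_,
    fun h => ?_, fun h => ?_, fun h k => ?_⟩
  · filter_upwards [hloc i₁ hn₁ δ hδ] with h hh hK
    rw [hX]
    have h1 := hh (by simpa [hi₁] using ⟨hK, hz.2⟩)
    simp [hi₁, WithLp.prod_inner_apply] at h1 ⊢
    linarith
  · filter_upwards [hloc i₂ hn₂ δ hδ] with h hh hK
    rw [hX]
    have h1 := hh (by simpa [hi₂] using ⟨hz.1, hK⟩)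
    simp [hi₂, WithLp.prod_inner_apply] at h1 ⊢
    linarith
  · rw [hX, real_inner_self_eq_norm_sq]
    linarith [hlow (i₁ h)]
  · rw [hX, real_inner_self_eq_norm_sq]
    linarith [hlow (i₂ h)]
  · have h1 := hup (i₁ h + i₂ k)
    rw [hsep, ← hsplit, WithLp.prod_norm_sq_eq_of_L2] at h1
    rw [hX, hX, real_inner_self_eq_norm_sq, real_inner_self_eq_norm_sq]
    simp only [WithLp.toLp_fst, WithLp.toLp_snd] at h1
    linarith

end ProductSum

section ParabolicSum

open Filter Topology

variable {V : Type*} [NormedAddCommGroup V] [InnerProductSpace ℝ V] [FiniteDimensional ℝ V]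

/-- The inclusion of the space variable into space-time. -/
noncomputable def spaceIncl (V : Type*) [NormedAddCommGroup V] [InnerProductSpace ℝ V] :
    V →L[ℝ] WithLp 2 (V × ℝ) :=
  (WithLp.prodContinuousLinearEquiv 2 ℝ V ℝ).symm ∘L ContinuousLinearMap.inl ℝ V ℝ

theorem spaceIncl_apply {V : Type*} [NormedAddCommGroup V] [InnerProductSpace ℝ V] (h : V) :
    spaceIncl V h = WithLp.toLp 2 (h, 0) := rfl

/-- The spatial block of a symmetric operator on space-time, increased by `ν`. -/
noncomputable def spaceBlock (X : WithLp 2 (V × ℝ) →L[ℝ] WithLp 2 (V × ℝ)) (ν : ℝ) : V →L[ℝ] V :=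
  ContinuousLinearMap.adjoint (spaceIncl V) ∘L X ∘L spaceIncl V + ν • ContinuousLinearMap.id ℝ V

theorem inner_spaceBlock (X : WithLp 2 (V × ℝ) →L[ℝ] WithLp 2 (V × ℝ)) (ν : ℝ) (v w : V) :
    ⟪spaceBlock X ν v, w⟫ = ⟪X (spaceIncl V v), spaceIncl V w⟫ + ν * ⟪v, w⟫ := by
  simp [spaceBlock, inner_add_left, inner_smul_left, ContinuousLinearMap.adjoint_inner_left]

theorem spaceBlock_symm {X : WithLp 2 (V × ℝ) →L[ℝ] WithLp 2 (V × ℝ)}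
    (hX : ∀ v w, ⟪X v, w⟫ = ⟪v, X w⟫) (ν : ℝ) (v w : V) :
    ⟪spaceBlock X ν v, w⟫ = ⟪v, spaceBlock X ν w⟫ := by
  rw [← real_inner_comm v, inner_spaceBlock, inner_spaceBlock, hX, real_inner_comm v w,
    real_inner_comm (spaceIncl V v)]

/-- A second-order upper contact in rescaled space-time controls the function with an error
quadratic in time. -/
theorem eventually_le_of_rescaled {K : Set (V × ℝ)} {f : V × ℝ → ℝ} {l ν : ℝ} (hl : 0 < l)
    (hν : 0 < ν) {z q : WithLp 2 (V × ℝ)} {X : WithLp 2 (V × ℝ) →L[ℝ] WithLp 2 (V × ℝ)}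
    (hX : ∀ v w, ⟪X v, w⟫ = ⟪v, X w⟫)
    (hf : ∀ δ > 0, ∀ᶠ h in 𝓝 (0 : WithLp 2 (V × ℝ)), ((z + h).fst, l * (z + h).snd) ∈ K →
      f ((z + h).fst, l * (z + h).snd) ≤
        f (z.fst, l * z.snd) + ⟪q, h⟫ + ⟪X h, h⟫ / 2 + δ * ‖h‖ ^ 2) :
    ∃ C : ℝ, ∀ᶠ w in 𝓝[K] (z.fst, l * z.snd), f w ≤ f (z.fst, l * z.snd) +
      ⟪q.fst, w.1 - z.fst⟫ + q.snd / l * (w.2 - l * z.snd) +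
      ⟪spaceBlock X ν (w.1 - z.fst), w.1 - z.fst⟫ / 2 + C * (w.2 - l * z.snd) ^ 2 := by
  refine ⟨(‖X‖ ^ 2 / ν + ‖X‖ / 2 + ν / 4) / l ^ 2, ?_⟩
  have hcont : Continuous fun w : V × ℝ =>
      (WithLp.toLp 2 (w.1 - z.fst, (w.2 - l * z.snd) / l) : WithLp 2 (V × ℝ)) :=
    (WithLp.prod_continuous_toLp 2 V ℝ).comp (by fun_prop)
  have htend : Tendsto (fun w : V × ℝ =>
      (WithLp.toLp 2 (w.1 - z.fst, (w.2 - l * z.snd) / l) : WithLp 2 (V × ℝ)))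
      (𝓝[K] (z.fst, l * z.snd)) (𝓝 0) := by
    have := hcont.tendsto (z.fst, l * z.snd)
    simp only [sub_self, zero_div] at this
    exact this.mono_left nhdsWithin_le_nhds
  filter_upwards [htend.eventually (hf (ν / 4) (by positivity)), self_mem_nhdsWithin] with w hw hwK
  set h := w.1 - z.fst with hh
  set σ := (w.2 - l * z.snd) / l with hσ
  have hlσ : w.2 - l * z.snd = l * σ := by rw [hσ]; field_simp
  have e1 : (z + WithLp.toLp 2 (h, σ)).fst = w.1 := by simp [hh]
  have e2 : l * (z + WithLp.toLp 2 (h, σ)).snd = w.2 := by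
    simp only [WithLp.add_snd, WithLp.toLp_snd]; linarith
  rw [e1, e2] at hw
  have h1 := hw hwK
  set τ : WithLp 2 (V × ℝ) := WithLp.toLp 2 (0, σ) with hτ
  have hsplit : WithLp.toLp 2 (h, σ) = spaceIncl V h + τ := by
    rw [spaceIncl_apply, hτ, ← WithLp.toLp_add]; simp
  have hτn : ‖τ‖ = |σ| := WithLp.norm_toLp_snd 2 V ℝ σ
  have hin : ‖spaceIncl V h‖ = ‖h‖ := WithLp.norm_toLp_fst 2 V ℝ h
  have hform : ⟪X (spaceIncl V h + τ), spaceIncl V h + τ⟫ =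
      ⟪X (spaceIncl V h), spaceIncl V h⟫ + 2 * ⟪X (spaceIncl V h), τ⟫ + ⟪X τ, τ⟫ := by
    rw [map_add, inner_add_left, inner_add_right, inner_add_right, hX τ,
      real_inner_comm (X (spaceIncl V h)) τ]
    ring
  have hc1 : ⟪X (spaceIncl V h), τ⟫ ≤ ‖X‖ * ‖h‖ * |σ| := by
    refine (real_inner_le_norm _ _).trans ?_
    rw [hτn, ← hin]
    exact mul_le_mul_of_nonneg_right (X.le_opNorm _) (abs_nonneg _)
  have hc2 : ⟪X τ, τ⟫ ≤ ‖X‖ * σ ^ 2 := by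
    refine (real_inner_le_norm _ _).trans ?_
    rw [← sq_abs σ, ← hτn, sq, ← mul_assoc]
    exact mul_le_mul_of_nonneg_right (X.le_opNorm _) (norm_nonneg _)
  have hc3 : ‖X‖ * ‖h‖ * |σ| ≤ ν / 4 * ‖h‖ ^ 2 + ‖X‖ ^ 2 / ν * σ ^ 2 := by
    have h2 : 0 ≤ (ν * ‖h‖ - 2 * ‖X‖ * |σ|) ^ 2 / (4 * ν) := by positivity
    have h3 : (ν * ‖h‖ - 2 * ‖X‖ * |σ|) ^ 2 / (4 * ν)
        = ν / 4 * ‖h‖ ^ 2 - ‖X‖ * ‖h‖ * |σ| + ‖X‖ ^ 2 / ν * |σ| ^ 2 := by field_simp; ring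
    rw [sq_abs] at h3
    linarith
  have hnorm : ‖(WithLp.toLp 2 (h, σ) : WithLp 2 (V × ℝ))‖ ^ 2 = ‖h‖ ^ 2 + σ ^ 2 := by
    rw [WithLp.prod_norm_sq_eq_of_L2]; simp
  have hinner : ⟪q, WithLp.toLp 2 (h, σ)⟫ = ⟪q.fst, h⟫ + q.snd * σ := by
    rw [WithLp.prod_inner_apply]; simp [mul_comm]
  rw [hnorm, hinner, hsplit, hform] at h1
  rw [inner_spaceBlock, real_inner_self_eq_norm_sq, hlσ]
  have e3 : q.snd / l * (l * σ) = q.snd * σ := by field_simp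
  have e4 : (‖X‖ ^ 2 / ν + ‖X‖ / 2 + ν / 4) / l ^ 2 * (l * σ) ^ 2
      = (‖X‖ ^ 2 / ν + ‖X‖ / 2 + ν / 4) * σ ^ 2 := by field_simp
  rw [e3, e4]
  linarith

/-- The parabolic theorem on sums. The bound `L` on the spatial second-order terms does not
depend on the size `C` of the quadratic terms in time. -/
theorem exists_parabolic_upper_jets_of_add_le {K₁ K₂ : Set (V × ℝ)}
    (hK₁ : IsCompact K₁) (hK₂ : IsCompact K₂) {f₁ f₂ : V × ℝ → ℝ} (hf₁ : ContinuousOn f₁ K₁)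
    (hf₂ : ContinuousOn f₂ K₂) {c₁ c₂ : V × ℝ} (hc₁ : c₁ ∈ K₁) (hc₂ : c₂ ∈ K₂) {p₁ p₂ : V}
    {r₁ r₂ : ℝ} {m : V →L[ℝ] V} (hm : ∀ v w, ⟪m v, w⟫ = ⟪v, m w⟫) {M ν L C : ℝ} (hM0 : 0 ≤ M)
    (hM : ∀ v w, ⟪m v, w⟫ ≤ M * ‖v‖ * ‖w‖) (hν : 0 < ν)
    (hL : 2 * M + ν + (2 * M + ν) ^ 2 / ν ≤ L)
    (hle : ∀ z₁ ∈ K₁, ∀ z₂ ∈ K₂, f₁ z₁ + f₂ z₂ ≤ f₁ c₁ + f₂ c₂ + ⟪p₁, z₁.1 - c₁.1⟫ +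
      ⟪p₂, z₂.1 - c₂.1⟫ + r₁ * (z₁.2 - c₁.2) + r₂ * (z₂.2 - c₂.2) +
      (⟪m ((z₁.1 - c₁.1) - (z₂.1 - c₂.1)), (z₁.1 - c₁.1) - (z₂.1 - c₂.1)⟫ +
        ν * (‖z₁.1 - c₁.1‖ ^ 2 + ‖z₂.1 - c₂.1‖ ^ 2)) / 2 +
      C * ((z₁.2 - c₁.2) ^ 2 + (z₂.2 - c₂.2) ^ 2)) {ρ : ℝ} (hρ : 0 < ρ) :
    ∃ z₁ ∈ K₁, ∃ z₂ ∈ K₂, ∃ (q₁ q₂ : V) (s₁ s₂ : ℝ) (X₁ X₂ : V →L[ℝ] V) (C₁ C₂ : ℝ),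
      dist z₁ c₁ < ρ ∧ dist z₂ c₂ < ρ ∧ ‖q₁ - p₁‖ < ρ ∧ ‖q₂ - p₂‖ < ρ ∧
      |s₁ - r₁| < ρ ∧ |s₂ - r₂| < ρ ∧
      (∀ v w, ⟪X₁ v, w⟫ = ⟪v, X₁ w⟫) ∧ (∀ v w, ⟪X₂ v, w⟫ = ⟪v, X₂ w⟫) ∧
      (∀ᶠ w in 𝓝[K₁] z₁, f₁ w ≤ f₁ z₁ + ⟪q₁, w.1 - z₁.1⟫ + s₁ * (w.2 - z₁.2) +
        ⟪X₁ (w.1 - z₁.1), w.1 - z₁.1⟫ / 2 + C₁ * (w.2 - z₁.2) ^ 2) ∧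
      (∀ᶠ w in 𝓝[K₂] z₂, f₂ w ≤ f₂ z₂ + ⟪q₂, w.1 - z₂.1⟫ + s₂ * (w.2 - z₂.2) +
        ⟪X₂ (w.1 - z₂.1), w.1 - z₂.1⟫ / 2 + C₂ * (w.2 - z₂.2) ^ 2) ∧
      (∀ h, -(L * ‖h‖ ^ 2) ≤ ⟪X₁ h, h⟫) ∧ (∀ h, -(L * ‖h‖ ^ 2) ≤ ⟪X₂ h, h⟫) ∧
      ∀ h k, ⟪X₁ h, h⟫ + ⟪X₂ k, k⟫ ≤ ⟪m (h - k), h - k⟫ + 4 * ν * (‖h‖ ^ 2 + ‖k‖ ^ 2) := by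
  set l : ℝ := min 1 (ν / (2 * (|C| + 1))) with hl
  have hl0 : 0 < l := by positivity
  have hl1 : l ≤ 1 := min_le_left _ _
  have hCl : C * l ^ 2 ≤ ν / 2 := by
    have h1 : l ≤ ν / (2 * (|C| + 1)) := min_le_right _ _
    rw [le_div_iff₀ (by positivity)] at h1
    have h2 : C * l ^ 2 ≤ |C| * l ^ 2 := mul_le_mul_of_nonneg_right (le_abs_self C) (sq_nonneg _)
    have h3 : l ^ 2 ≤ l := by nlinarith
    nlinarith [abs_nonneg C, mul_le_mul_of_nonneg_left h3 (abs_nonneg C)]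
  have hcomp : ∀ K : Set (V × ℝ), IsCompact K →
      IsCompact {z : WithLp 2 (V × ℝ) | (z.fst, l * z.snd) ∈ K} := by
    intro K hK
    have h1 : IsCompact ((fun w : V × ℝ => (w.1, w.2 / l)) '' K) := hK.image (by fun_prop)
    convert isCompact_withLp_prod h1 using 1
    ext z
    constructor
    · exact fun hz => ⟨_, hz, by simp [hl0.ne']⟩
    · rintro ⟨w, hw, hwz⟩
      rw [Prod.mk.injEq] at hwz
      have : (z.fst, l * z.snd) = w := by
        rw [← hwz.1, ← hwz.2]; ext <;> simp; field_simp
      change (z.fst, l * z.snd) ∈ K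
      rwa [this]
  have hcont : ∀ (K : Set (V × ℝ)) (f : V × ℝ → ℝ), ContinuousOn f K →
      ContinuousOn (fun z : WithLp 2 (V × ℝ) => f (z.fst, l * z.snd))
        {z : WithLp 2 (V × ℝ) | (z.fst, l * z.snd) ∈ K} :=
    fun K f hf => hf.comp (by fun_prop) fun z hz => hz
  let d : WithLp 2 (WithLp 2 (V × ℝ) × WithLp 2 (V × ℝ)) →L[ℝ] V :=
    (ContinuousLinearMap.fst ℝ V ℝ) ∘L
    (WithLp.prodContinuousLinearEquiv 2 ℝ V ℝ) ∘L
    (ContinuousLinearMap.fst ℝ (WithLp 2 (V × ℝ)) (WithLp 2 (V × ℝ)) -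
      ContinuousLinearMap.snd ℝ (WithLp 2 (V × ℝ)) (WithLp 2 (V × ℝ))) ∘L
    (WithLp.prodContinuousLinearEquiv 2 ℝ (WithLp 2 (V × ℝ)) (WithLp 2 (V × ℝ)))
  have hd : ∀ v, d v = v.fst.fst - v.snd.fst := fun v => rfl
  let B : WithLp 2 (WithLp 2 (V × ℝ) × WithLp 2 (V × ℝ)) →L[ℝ]
      WithLp 2 (WithLp 2 (V × ℝ) × WithLp 2 (V × ℝ)) :=
    ContinuousLinearMap.adjoint d ∘L m ∘L d + ν • ContinuousLinearMap.id ℝ _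
  have hB : ∀ v w, ⟪B v, w⟫ = ⟪m (d v), d w⟫ + ν * ⟪v, w⟫ := fun v w => by
    simp [B, inner_add_left, inner_smul_left, ContinuousLinearMap.adjoint_inner_left]
  have hdn : ∀ v, ‖d v‖ ^ 2 ≤ 2 * ‖v‖ ^ 2 := by
    intro v
    have h1 := norm_sub_le v.fst.fst v.snd.fst
    have h2 := WithLp.prod_norm_sq_eq_of_L2 v
    have h3 := WithLp.prod_norm_sq_eq_of_L2 v.fst
    have h4 := WithLp.prod_norm_sq_eq_of_L2 v.snd
    rw [hd]
    have h5 := pow_le_pow_left₀ (norm_nonneg _) h1 2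
    nlinarith [sq_nonneg (‖v.fst.fst‖ - ‖v.snd.fst‖), sq_nonneg ‖v.fst.snd‖,
      sq_nonneg ‖v.snd.snd‖]
  have hBM : ∀ v w, ⟪B v, w⟫ ≤ (2 * M + ν) * ‖v‖ * ‖w‖ := by
    intro v w
    have h1 := hM (d v) (d w)
    have h2 : ‖d v‖ * ‖d w‖ ≤ 2 * (‖v‖ * ‖w‖) := by
      rw [← sq_le_sq₀ (by positivity) (by positivity), mul_pow]
      calc ‖d v‖ ^ 2 * ‖d w‖ ^ 2 ≤ (2 * ‖v‖ ^ 2) * (2 * ‖w‖ ^ 2) :=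
            mul_le_mul (hdn v) (hdn w) (by positivity) (by positivity)
        _ = _ := by ring
    have h3 := mul_le_mul_of_nonneg_left (real_inner_le_norm v w) hν.le
    have h4 := mul_le_mul_of_nonneg_left h2 hM0
    rw [hB]
    linarith
  obtain ⟨z₁, hz₁, z₂, hz₂, q₁, q₂, X₁, X₂, hd₁, hd₂, hq₁, hq₂, hs₁, hs₂, hj₁, hj₂, hlow₁, hlow₂,
    hup⟩ := exists_upper_jets_of_add_le (hcomp K₁ hK₁) (hcomp K₂ hK₂)
      (hcont K₁ f₁ hf₁) (hcont K₂ f₂ hf₂) (c₁ := WithLp.toLp 2 (c₁.1, c₁.2 / l))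
      (c₂ := WithLp.toLp 2 (c₂.1, c₂.2 / l)) (p₁ := WithLp.toLp 2 (p₁, l * r₁))
      (p₂ := WithLp.toLp 2 (p₂, l * r₂)) (B := B)
      (by simpa [mul_div_cancel₀ _ hl0.ne'] using hc₁)
      (by simpa [mul_div_cancel₀ _ hl0.ne'] using hc₂)
      (fun v w => by
        rw [← real_inner_comm v, hB, hB, hm, real_inner_comm v w, real_inner_comm (d v)])
      hBM hν hL (lt_of_lt_of_le (by positivity) hL)
      (fun z₁ hz₁ z₂ hz₂ => by
        have h1 := hle _ hz₁ _ hz₂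
        rw [hB, hd, real_inner_self_eq_norm_sq, WithLp.prod_norm_sq_eq_of_L2,
          WithLp.prod_norm_sq_eq_of_L2, WithLp.prod_norm_sq_eq_of_L2, WithLp.prod_inner_apply,
          WithLp.prod_inner_apply]
        simp only [WithLp.toLp_fst, WithLp.toLp_snd, WithLp.sub_fst, WithLp.sub_snd,
          WithLp.ofLp_fst, WithLp.ofLp_snd, WithLp.ofLp_sub, Prod.fst_sub, Prod.snd_sub,
          Real.norm_eq_abs, sq_abs, mul_div_cancel₀ _ hl0.ne', RCLike.inner_apply,
          RCLike.conj_to_real, Prod.mk.eta] at h1 ⊢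
        have e : ∀ a b : ℝ, l * a - b = l * (a - b / l) := fun a b => by field_simp
        rw [e, e] at h1
        have h2 := mul_le_mul_of_nonneg_right hCl (sq_nonneg (z₁.snd - c₁.2 / l))
        have h3 := mul_le_mul_of_nonneg_right hCl (sq_nonneg (z₂.snd - c₂.2 / l))
        linarith)
      (ρ := min (l * ρ) ν) (by positivity)
  have hfst : ∀ w : WithLp 2 (V × ℝ), ‖w.fst‖ ≤ ‖w‖ := fun w => by
    have := WithLp.prod_norm_sq_eq_of_L2 w
    rw [← sq_le_sq₀ (norm_nonneg _) (norm_nonneg _)]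
    nlinarith [sq_nonneg ‖w.snd‖]
  have hsnd : ∀ w : WithLp 2 (V × ℝ), ‖w.snd‖ ≤ ‖w‖ := fun w => by
    have := WithLp.prod_norm_sq_eq_of_L2 w
    rw [← sq_le_sq₀ (norm_nonneg _) (norm_nonneg _)]
    nlinarith [sq_nonneg ‖w.fst‖]
  have hρ1 : min (l * ρ) ν ≤ l * ρ := min_le_left _ _
  have hρ2 : l * ρ ≤ ρ := mul_le_of_le_one_left hρ.le hl1
  have hdist : ∀ (z : WithLp 2 (V × ℝ)) (c : V × ℝ),
      ‖z - WithLp.toLp 2 (c.1, c.2 / l)‖ < min (l * ρ) ν →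
      dist (z.fst, l * z.snd) c < ρ := by
    intro z c h
    have h1 := (hfst _).trans_lt h
    have h2 := (hsnd _).trans_lt h
    simp only [WithLp.sub_fst, WithLp.sub_snd, WithLp.toLp_fst, WithLp.toLp_snd] at h1 h2
    rw [Prod.dist_eq, max_lt_iff, dist_eq_norm, dist_eq_norm]
    refine ⟨by linarith, ?_⟩
    have e : l * z.snd - c.2 = l * (z.snd - c.2 / l) := by field_simp
    change ‖l * z.snd - c.2‖ < ρ
    rw [e, norm_mul, Real.norm_eq_abs, abs_of_pos hl0]
    nlinarith [norm_nonneg (z.snd - c.2 / l)]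
  have hgrad : ∀ (q : WithLp 2 (V × ℝ)) (p : V) (r : ℝ),
      ‖q - WithLp.toLp 2 (p, l * r)‖ < min (l * ρ) ν →
      ‖q.fst - p‖ < ρ ∧ |q.snd / l - r| < ρ := by
    intro q p r h
    have h1 := (hfst _).trans_lt h
    have h2 := (hsnd _).trans_lt h
    simp only [WithLp.sub_fst, WithLp.sub_snd, WithLp.toLp_fst, WithLp.toLp_snd] at h1 h2
    refine ⟨by linarith, ?_⟩
    have e : q.snd / l - r = (q.snd - l * r) / l := by field_simp
    rw [e, abs_div, abs_of_pos hl0, div_lt_iff₀ hl0, ← Real.norm_eq_abs]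
    linarith
  have hblock : ∀ (X : WithLp 2 (V × ℝ) →L[ℝ] WithLp 2 (V × ℝ)) (h : V), ⟪spaceBlock X ν h, h⟫ =
      ⟪X (WithLp.toLp 2 (h, 0)), WithLp.toLp 2 (h, 0)⟫ + ν * ‖h‖ ^ 2 := fun X h => by
    rw [inner_spaceBlock, real_inner_self_eq_norm_sq, spaceIncl_apply]
  have hnorm : ∀ h : V, ‖(WithLp.toLp 2 (h, 0) : WithLp 2 (V × ℝ))‖ = ‖h‖ :=
    fun h => WithLp.norm_toLp_fst 2 V ℝ h
  obtain ⟨C₁, hC₁⟩ := eventually_le_of_rescaled hl0 hν hs₁ hj₁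
  obtain ⟨C₂, hC₂⟩ := eventually_le_of_rescaled hl0 hν hs₂ hj₂
  refine ⟨_, hz₁, _, hz₂, q₁.fst, q₂.fst, q₁.snd / l, q₂.snd / l, spaceBlock X₁ ν,
    spaceBlock X₂ ν, C₁, C₂, hdist _ _ hd₁, hdist _ _ hd₂, (hgrad _ _ _ hq₁).1,
    (hgrad _ _ _ hq₂).1, (hgrad _ _ _ hq₁).2, (hgrad _ _ _ hq₂).2, spaceBlock_symm hs₁ ν,
    spaceBlock_symm hs₂ ν, hC₁, hC₂, fun h => ?_, fun h => ?_, fun h k => ?_⟩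
  · have := hlow₁ (WithLp.toLp 2 (h, 0))
    rw [hnorm] at this
    rw [hblock]
    nlinarith [sq_nonneg ‖h‖]
  · have := hlow₂ (WithLp.toLp 2 (h, 0))
    rw [hnorm] at this
    rw [hblock]
    nlinarith [sq_nonneg ‖h‖]
  · have h1 := hup (WithLp.toLp 2 (h, 0)) (WithLp.toLp 2 (k, 0))
    rw [hB, hd, real_inner_self_eq_norm_sq, WithLp.prod_norm_sq_eq_of_L2] at h1
    simp only [WithLp.toLp_fst, WithLp.toLp_snd, hnorm] at h1
    rw [hblock, hblock]
    have h2 := mul_le_mul_of_nonneg_right (min_le_right (l * ρ) ν)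
      (by positivity : 0 ≤ ‖h‖ ^ 2 + ‖k‖ ^ 2)
    linarith

end ParabolicSum

section ViscosityJets

open Filter Topology

variable {n : ℕ} {Ω : Set (EuclideanSpace ℝ (Fin n))} {T : ℝ}
  {ν : EuclideanSpace ℝ (Fin n) → EuclideanSpace ℝ (Fin n)}

theorem isC21Test_quadratic (T : ℝ) (z p : EuclideanSpace ℝ (Fin n)) (t r C : ℝ)
    {X : EuclideanSpace ℝ (Fin n) →L[ℝ] EuclideanSpace ℝ (Fin n)}
    (hX : ∀ v w, ⟪X v, w⟫ = ⟪v, X w⟫) :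
    IsC21Test n T
      (fun w => ⟪p, w.1 - z⟫ + r * (w.2 - t) + ⟪X (w.1 - z), w.1 - z⟫ / 2 + C * (w.2 - t) ^ 2)
      (fun w => r + 2 * C * (w.2 - t)) (fun w => p + X (w.1 - z))
      (fun _ => Matrix.toEuclideanLin.symm X.toLinearMap) := by
  refine ⟨fun w _ => ?_, fun w _ => ?_, fun w _ => ?_, by fun_prop, by fun_prop, by fun_prop⟩
  · have h1 : HasDerivAt (fun s : ℝ => s - t) 1 w.2 := (hasDerivAt_id _).sub_const t
    have h2 := (((h1.const_mul r).const_add ⟪p, w.1 - z⟫).add_const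
      (⟪X (w.1 - z), w.1 - z⟫ / 2)).fun_add ((h1.fun_pow 2).const_mul C)
    exact h2.congr_deriv (by simp; ring)
  · rw [hasGradientAt_iff_hasFDerivAt]
    have h1 : HasFDerivAt (fun x : EuclideanSpace ℝ (Fin n) => x - z)
      (ContinuousLinearMap.id ℝ _) w.1 := (hasFDerivAt_id _).sub_const z
    have h2 := (hasFDerivAt_const p w.1).inner ℝ h1
    have h3 := ((X.hasFDerivAt.comp w.1 h1).inner ℝ h1).const_mul (1 / 2 : ℝ)
    have h4 := ((h2.add_const (r * (w.2 - t))).fun_add h3).add_const (C * (w.2 - t) ^ 2)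
    refine (h4.congr_fderiv ?_).congr_of_eventuallyEq (.of_forall fun x => ?_)
    · ext v
      have e1 : ⟪X v, w.1 - z⟫ = ⟪X (w.1 - z), v⟫ := by rw [hX, real_inner_comm]
      simp [inner_sub_left, fderivInnerCLM_apply, e1]
      ring
    · simp [div_eq_inv_mul]
  · have h1 : HasFDerivAt (fun x : EuclideanSpace ℝ (Fin n) => x - z)
      (ContinuousLinearMap.id ℝ _) w.1 := (hasFDerivAt_id _).sub_const z
    refine ((X.hasFDerivAt.comp w.1 h1).const_add p).congr_fderiv ?_
    ext v
    simp

theorem IsViscositySubsolnNeumann.le_of_upper_jet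
    {A : EuclideanSpace ℝ (Fin n) → ℝ → Matrix (Fin n) (Fin n) ℝ}
    {b : EuclideanSpace ℝ (Fin n) → ℝ → ℝ} {u : EuclideanSpace ℝ (Fin n) × ℝ → ℝ}
    (hu : IsViscositySubsolnNeumann n Ω T ν (fun _ p X t => (A p t * X).trace + b p t)
      (fun _ => 0) u) (hΩ : IsOpen Ω) {z p : EuclideanSpace ℝ (Fin n)} {t r C : ℝ}
    (hz : z ∈ closure Ω) (ht : t ∈ Ioo 0 T)
    {X : EuclideanSpace ℝ (Fin n) →L[ℝ] EuclideanSpace ℝ (Fin n)}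
    (hX : ∀ v w, ⟪X v, w⟫ = ⟪v, X w⟫)
    (hloc : ∀ᶠ w in 𝓝[closure Ω ×ˢ Ioo 0 T] (z, t), u w ≤ u (z, t) + ⟪p, w.1 - z⟫ +
      r * (w.2 - t) + ⟪X (w.1 - z), w.1 - z⟫ / 2 + C * (w.2 - t) ^ 2)
    (hν : z ∈ frontier Ω → 0 < ⟪p, ν z⟫) :
    r ≤ (A p t * Matrix.toEuclideanLin.symm X.toLinearMap).trace + b p t := by
  obtain ⟨h1, h2⟩ := hu _ _ _ _ (isC21Test_quadratic T z p t r C hX) z t hz ht (by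
    filter_upwards [hloc] with w hw
    simp only [sub_self, map_zero, inner_zero_right, mul_zero, add_zero, ne_eq, OfNat.ofNat_ne_zero,
      not_false_eq_true, zero_pow, zero_div]
    linarith)
  simp only [sub_self, map_zero, mul_zero, add_zero] at h1 h2
  by_cases hzΩ : z ∈ Ω
  · exact h1 hzΩ
  · have hf : z ∈ frontier Ω := by rw [hΩ.frontier_eq]; exact ⟨hz, hzΩ⟩
    rcases min_le_iff.1 (h2 hf) with h | h
    · linarith
    · exact absurd (hν hf) (not_lt.2 h)

theorem IsViscositySupersolnNeumann.neg
    {A : EuclideanSpace ℝ (Fin n) → ℝ → Matrix (Fin n) (Fin n) ℝ}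
    {b : EuclideanSpace ℝ (Fin n) → ℝ → ℝ} {u : EuclideanSpace ℝ (Fin n) × ℝ → ℝ}
    (hu : IsViscositySupersolnNeumann n Ω T ν (fun _ p X t => (A p t * X).trace + b p t)
      (fun _ => 0) u) :
    IsViscositySubsolnNeumann n Ω T ν (fun _ p X t => (A (-p) t * X).trace + -b (-p) t)
      (fun _ => 0) (fun w => -u w) := by
  rintro φ φt Dφ D2φ ⟨h1, h2, h3, h4, h5, h6⟩ x t hx ht hmax
  obtain ⟨g1, g2⟩ := hu (fun w => -φ w) (fun w => -φt w) (fun w => -Dφ w) (fun w => -D2φ w)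
    ⟨fun w hw => (h1 w hw).neg, fun w hw => by
      have := h2 w hw
      rw [hasGradientAt_iff_hasFDerivAt] at this ⊢
      rw [map_neg]
      exact this.neg, fun w hw => by
      rw [map_neg, map_neg]
      exact (h3 w hw).neg, h4.neg, h5.neg, h6.neg⟩ x t hx ht (by
      filter_upwards [hmax] with w hw
      linarith)
  simp only [Matrix.mul_neg, Matrix.trace_neg, inner_neg_left, add_zero] at g1 g2 ⊢
  refine ⟨fun h => by linarith [g1 h], fun h => ?_⟩
  rcases le_max_iff.1 (g2 h) with h | h
  · exact min_le_iff.2 (Or.inl (by linarith))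
  · exact min_le_iff.2 (Or.inr (by linarith))

end ViscosityJets

section TraceInequality

open Matrix

variable {n : ℕ}

theorem toEuclideanLin_symm_mulVec
    (X : EuclideanSpace ℝ (Fin n) →L[ℝ] EuclideanSpace ℝ (Fin n)) (v : EuclideanSpace ℝ (Fin n)) :
    X v = WithLp.toLp 2 (toEuclideanLin.symm X.toLinearMap *ᵥ v.ofLp) := by
  rw [← toLpLin_apply, LinearEquiv.apply_symm_apply]
  rfl

theorem toEuclideanLin_symm_apply_apply
    (X : EuclideanSpace ℝ (Fin n) →L[ℝ] EuclideanSpace ℝ (Fin n)) (i j : Fin n) :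
    toEuclideanLin.symm X.toLinearMap i j =
      ⟪X (EuclideanSpace.single j 1), EuclideanSpace.single i 1⟫ := by
  rw [toEuclideanLin_symm_mulVec]
  generalize toEuclideanLin.symm X.toLinearMap = Y
  simp [EuclideanSpace.inner_single_right]

theorem trace_transpose_mul_self_mul_symm (C : Matrix (Fin n) (Fin n) ℝ)
    (X : EuclideanSpace ℝ (Fin n) →L[ℝ] EuclideanSpace ℝ (Fin n)) :
    (Cᵀ * C * toEuclideanLin.symm X.toLinearMap).trace =
      ∑ i, ⟪X (WithLp.toLp 2 (C i)), WithLp.toLp 2 (C i)⟫ := by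
  rw [Matrix.mul_assoc, Matrix.trace_mul_comm, Matrix.trace]
  refine Finset.sum_congr rfl fun i _ => ?_
  rw [toEuclideanLin_symm_mulVec, EuclideanSpace.inner_eq_star_dotProduct]
  simp [Matrix.mul_assoc, Matrix.mul_apply', Matrix.mulVec, dotProduct]

theorem trace_vecMulVec_self_mul_symm (e : EuclideanSpace ℝ (Fin n))
    (X : EuclideanSpace ℝ (Fin n) →L[ℝ] EuclideanSpace ℝ (Fin n)) :
    (vecMulVec e.ofLp e.ofLp * toEuclideanLin.symm X.toLinearMap).trace = ⟪X e, e⟫ := by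
  rw [toEuclideanLin_symm_mulVec, EuclideanSpace.inner_eq_star_dotProduct, vecMulVec_mul,
    trace_vecMulVec, dotProduct_comm]
  simp [dotProduct_mulVec, dotProduct_comm]

theorem Matrix.PosSemidef.exists_eq_transpose_mul_self {B : Matrix (Fin n) (Fin n) ℝ}
    (hB : B.PosSemidef) : ∃ C : Matrix (Fin n) (Fin n) ℝ, B = Cᵀ * C := by
  open scoped MatrixOrder ComplexOrder in
  obtain ⟨C, hC⟩ := CStarAlgebra.nonneg_iff_eq_star_mul_self.1 hB.nonneg
  exact ⟨C, by simpa [star_eq_conjTranspose] using hC⟩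

theorem Matrix.IsHermitian.posSemidef_sub_smul_vecMulVec {A : Matrix (Fin n) (Fin n) ℝ}
    (hA : A.IsHermitian) {e : EuclideanSpace ℝ (Fin n)} {a : ℝ}
    (h : ∀ v : EuclideanSpace ℝ (Fin n), a * ⟪v, e⟫ ^ 2 ≤ ∑ i, ∑ j, v i * A i j * v j) :
    (A - a • vecMulVec e.ofLp e.ofLp).PosSemidef := by
  refine .of_dotProduct_mulVec_nonneg ?_ fun v => ?_
  · refine hA.sub ?_
    ext i j
    simp [vecMulVec_apply, mul_comm]
  · have h1 := h (WithLp.toLp 2 v)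
    have h2 : v ⬝ᵥ A *ᵥ v = ∑ i, ∑ j, v i * A i j * v j := by
      simp [dotProduct, mulVec, Finset.mul_sum, mul_assoc]
    have h3 : ⟪WithLp.toLp 2 v, e⟫ = v ⬝ᵥ e.ofLp := by
      rw [EuclideanSpace.inner_eq_star_dotProduct, dotProduct_comm]; simp
    rw [h3] at h1
    simp only [star_trivial, sub_mulVec, dotProduct_sub, h2, smul_mulVec, dotProduct_smul,
      vecMulVec_mulVec, smul_eq_mul]
    simp only [MulOpposite.smul_eq_mul_unop, MulOpposite.unop_op, dotProduct_comm e.ofLp v] at *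
    nlinarith

theorem trace_mul_add_trace_mul_le {A : Matrix (Fin n) (Fin n) ℝ} {e : EuclideanSpace ℝ (Fin n)}
    {a : ℝ} (ha : 0 ≤ a) (he : ‖e‖ = 1) (hA : (A - a • vecMulVec e.ofLp e.ofLp).PosSemidef)
    {X₁ X₂ m : EuclideanSpace ℝ (Fin n) →L[ℝ] EuclideanSpace ℝ (Fin n)} {c : ℝ}
    (hX : ∀ h k, ⟪X₁ h, h⟫ + ⟪X₂ k, k⟫ ≤ ⟪m (h - k), h - k⟫ + c * (‖h‖ ^ 2 + ‖k‖ ^ 2)) :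
    (A * toEuclideanLin.symm X₁.toLinearMap).trace +
      (A * toEuclideanLin.symm X₂.toLinearMap).trace ≤ 4 * a * ⟪m e, e⟫ + 2 * c * A.trace := by
  obtain ⟨C, hC⟩ := hA.exists_eq_transpose_mul_self
  have hA' : A = Cᵀ * C + a • vecMulVec e.ofLp e.ofLp := by rw [← hC]; abel
  have htr : A.trace = ∑ i, ‖WithLp.toLp 2 (C i)‖ ^ 2 + a := by
    have h1 := trace_transpose_mul_self_mul_symm C (.id ℝ _)
    have h2 := trace_vecMulVec_self_mul_symm e (.id ℝ _)
    have h3 : toEuclideanLin.symm (ContinuousLinearMap.id ℝ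
        (EuclideanSpace ℝ (Fin n))).toLinearMap = 1 := by
      rw [LinearEquiv.symm_apply_eq]
      ext v
      simp
    rw [h3, Matrix.mul_one] at h1 h2
    rw [hA', trace_add, trace_smul, h1, h2]
    simp [he]
  have key (X : EuclideanSpace ℝ (Fin n) →L[ℝ] EuclideanSpace ℝ (Fin n)) :
      (A * toEuclideanLin.symm X.toLinearMap).trace =
        ∑ i, ⟪X (WithLp.toLp 2 (C i)), WithLp.toLp 2 (C i)⟫ + a * ⟪X e, e⟫ := by
    rw [hA', Matrix.add_mul, trace_add, smul_mul_assoc, trace_smul,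
      trace_transpose_mul_self_mul_symm, trace_vecMulVec_self_mul_symm, smul_eq_mul]
  have h1 : ∑ i, (⟪X₁ (WithLp.toLp 2 (C i)), WithLp.toLp 2 (C i)⟫ +
      ⟪X₂ (WithLp.toLp 2 (C i)), WithLp.toLp 2 (C i)⟫) ≤
      ∑ i, 2 * c * ‖WithLp.toLp 2 (C i)‖ ^ 2 := by
    refine Finset.sum_le_sum fun i _ => (hX _ _).trans ?_
    simp only [sub_self, map_zero, inner_zero_right]
    linarith
  have h2 := hX e (-e)
  have h3 : e - -e = (2 : ℝ) • e := by rw [two_smul]; abel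
  rw [h3, map_smul, inner_smul_left, inner_smul_right, map_neg, inner_neg_neg, norm_neg, he] at h2
  simp only [conj_trivial] at h2
  rw [Finset.sum_add_distrib, ← Finset.mul_sum] at h1
  rw [key, key, htr]
  nlinarith [mul_le_mul_of_nonneg_left h2 ha]

theorem abs_toEuclideanLin_symm_apply_le
    {X : EuclideanSpace ℝ (Fin n) →L[ℝ] EuclideanSpace ℝ (Fin n)}
    (hX : ∀ v w, ⟪X v, w⟫ = ⟪v, X w⟫) {Λ : ℝ} (h1 : ∀ h, -(Λ * ‖h‖ ^ 2) ≤ ⟪X h, h⟫)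
    (h2 : ∀ h, ⟪X h, h⟫ ≤ Λ * ‖h‖ ^ 2) (i j : Fin n) :
    |toEuclideanLin.symm X.toLinearMap i j| ≤ Λ := by
  rw [toEuclideanLin_symm_apply_apply]
  set v : EuclideanSpace ℝ (Fin n) := EuclideanSpace.single j 1
  set w : EuclideanSpace ℝ (Fin n) := EuclideanSpace.single i 1
  have hv : ‖v‖ = 1 := by simp [v]
  have hw : ‖w‖ = 1 := by simp [w]
  have e : ⟪X v, w⟫ = (⟪X (v + w), v + w⟫ - ⟪X (v - w), v - w⟫) / 4 := by
    have : ⟪X w, v⟫ = ⟪X v, w⟫ := by rw [hX, real_inner_comm]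
    simp only [map_add, map_sub, inner_add_left, inner_add_right, inner_sub_left, inner_sub_right,
      this]
    ring
  have hp := parallelogram_law_with_norm ℝ v w
  rw [hv, hw] at hp
  rw [e, abs_le]
  constructor <;> nlinarith [h1 (v + w), h1 (v - w), h2 (v + w), h2 (v - w)]

theorem trace_mul_le_trace_mul_add {A B Y : Matrix (Fin n) (Fin n) ℝ} {ε Λ : ℝ}
    (hAB : ∀ i j, |B i j - A i j| ≤ ε) (hY : ∀ i j, |Y i j| ≤ Λ) :
    (B * Y).trace ≤ (A * Y).trace + n ^ 2 * (ε * Λ) := by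
  have h : (B * Y).trace - (A * Y).trace ≤ ∑ _i : Fin n, ∑ _j : Fin n, ε * Λ := by
    rw [← trace_sub, ← Matrix.sub_mul]
    refine Finset.sum_le_sum fun i _ => ?_
    rw [diag_apply, mul_apply]
    refine Finset.sum_le_sum fun j _ => ?_
    refine (le_abs_self _).trans ?_
    rw [abs_mul]
    exact mul_le_mul (hAB i j) (hY j i) (abs_nonneg _) ((abs_nonneg _).trans (hAB i j))
  simp only [Finset.sum_const, Finset.card_univ, Fintype.card_fin, nsmul_eq_mul] at h
  linarith

theorem posSemidef_sub_smul_vecMulVec_of_le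
    {A : EuclideanSpace ℝ (Fin n) → ℝ → Matrix (Fin n) (Fin n) ℝ} {α : ℝ → ℝ → ℝ}
    (hA : Continuous fun q : EuclideanSpace ℝ (Fin n) × ℝ => A q.1 q.2)
    (hApsd : ∀ p t, (A p t).PosSemidef) (hα : Continuous fun q : ℝ × ℝ => α q.1 q.2) {t : ℝ}
    (hαpos : ∀ R > (0 : ℝ), 0 < α R t)
    (hαle : ∀ R > (0 : ℝ), ∀ p v : EuclideanSpace ℝ (Fin n), ‖p‖ = R → ⟪v, p⟫ ≠ 0 →
      α R t ≤ R ^ 2 * ((∑ i, ∑ j, v i * A p t i j * v j) / ⟪v, p⟫ ^ 2))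
    {R : ℝ} (hR : 0 ≤ R) {e : EuclideanSpace ℝ (Fin n)} (he : ‖e‖ = 1) :
    0 ≤ α R t ∧ (A (R • e) t - α R t • vecMulVec e.ofLp e.ofLp).PosSemidef := by
  have hcl : R ∈ closure (Ioi (0 : ℝ)) := by rw [closure_Ioi]; exact hR
  have hα' : Continuous fun R => α R t := hα.comp (by fun_prop : Continuous fun R : ℝ => (R, t))
  have hA' : Continuous fun R : ℝ => A (R • e) t :=
    hA.comp (by fun_prop : Continuous fun R : ℝ => (R • e, t))
  refine ⟨?_, (hApsd _ _).isHermitian.posSemidef_sub_smul_vecMulVec fun v => ?_⟩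
  · have : IsClosed {R : ℝ | 0 ≤ α R t} := isClosed_le continuous_const hα'
    exact closure_minimal (fun S hS => (hαpos S hS).le) this hcl
  · have : IsClosed {R : ℝ | α R t * ⟪v, e⟫ ^ 2 ≤ ∑ i, ∑ j, v i * A (R • e) t i j * v j} := by
      refine isClosed_le (by fun_prop) ?_
      refine continuous_finsetSum _ fun i _ => continuous_finsetSum _ fun j _ => ?_
      exact (continuous_const.mul (hA'.matrix_elem i j)).mul continuous_const
    refine closure_minimal (fun S (hS : 0 < S) => ?_) this hcl
    rw [mem_ofPred_eq]
    rcases eq_or_ne ⟪v, e⟫ 0 with h0 | h0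
    · rw [h0]
      have := (hApsd (S • e) t).dotProduct_mulVec_nonneg v.ofLp
      simpa [dotProduct, mulVec, Finset.mul_sum, mul_assoc] using this
    · have h1 := hαle S hS (S • e) v (by rw [norm_smul, he, mul_one, Real.norm_of_nonneg hS.le])
        (by rw [inner_smul_right]; exact mul_ne_zero hS.ne' h0)
      rw [inner_smul_right, mul_pow, mul_div_assoc', mul_div_mul_left _ _ (by positivity),
        le_div_iff₀ (by positivity)] at h1
      exact h1

end TraceInequality

section Doubling

open Filter Topology

variable {n : ℕ} {Ω : Set (EuclideanSpace ℝ (Fin n))} {T : ℝ}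
  {ν : EuclideanSpace ℝ (Fin n) → EuclideanSpace ℝ (Fin n)}

theorem exists_hessians_of_doubling (hΩ : IsOpen Ω)
    {A : EuclideanSpace ℝ (Fin n) → ℝ → Matrix (Fin n) (Fin n) ℝ}
    {b : EuclideanSpace ℝ (Fin n) → ℝ → ℝ} {u : EuclideanSpace ℝ (Fin n) × ℝ → ℝ}
    (hu : ContinuousOn u (closure Ω ×ˢ Ioo 0 T))
    (hsub : IsViscositySubsolnNeumann n Ω T ν (fun _ p X t => (A p t * X).trace + b p t)
      (fun _ => 0) u)
    (hsup : IsViscositySupersolnNeumann n Ω T ν (fun _ p X t => (A p t * X).trace + b p t)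
      (fun _ => 0) u)
    {c₁ c₂ : EuclideanSpace ℝ (Fin n) × ℝ} (hc₁ : c₁ ∈ closure Ω ×ˢ Ioo 0 T)
    (hc₂ : c₂ ∈ closure Ω ×ˢ Ioo 0 T) {p₁ p₂ : EuclideanSpace ℝ (Fin n)} {r₁ r₂ : ℝ}
    {m : EuclideanSpace ℝ (Fin n) →L[ℝ] EuclideanSpace ℝ (Fin n)}
    (hm : ∀ v w, ⟪m v, w⟫ = ⟪v, m w⟫) {M δ L C r : ℝ} (hM0 : 0 ≤ M)
    (hM : ∀ v w, ⟪m v, w⟫ ≤ M * ‖v‖ * ‖w‖) (hδ : 0 < δ)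
    (hL : 2 * M + δ + (2 * M + δ) ^ 2 / δ ≤ L) (hr : 0 < r)
    (hle : ∀ z₁ ∈ closure Ω ×ˢ Ioo 0 T, ∀ z₂ ∈ closure Ω ×ˢ Ioo 0 T, dist z₁ c₁ ≤ r →
      dist z₂ c₂ ≤ r → u z₁ - u z₂ ≤ u c₁ - u c₂ + ⟪p₁, z₁.1 - c₁.1⟫ + ⟪p₂, z₂.1 - c₂.1⟫ +
        r₁ * (z₁.2 - c₁.2) + r₂ * (z₂.2 - c₂.2) +
        (⟪m ((z₁.1 - c₁.1) - (z₂.1 - c₂.1)), (z₁.1 - c₁.1) - (z₂.1 - c₂.1)⟫ +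
          δ * (‖z₁.1 - c₁.1‖ ^ 2 + ‖z₂.1 - c₂.1‖ ^ 2)) / 2 +
        C * ((z₁.2 - c₁.2) ^ 2 + (z₂.2 - c₂.2) ^ 2))
    (hν₁ : ∃ ρ > 0, ∀ z ∈ frontier Ω, ∀ q, ‖z - c₁.1‖ < ρ → ‖q - p₁‖ < ρ → 0 < ⟪q, ν z⟫)
    (hν₂ : ∃ ρ > 0, ∀ z ∈ frontier Ω, ∀ q, ‖z - c₂.1‖ < ρ → ‖q - p₂‖ < ρ → 0 < ⟪q, ν z⟫)
    {ε : ℝ} (hε : 0 < ε) :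
    ∃ (q₁ q₂ : EuclideanSpace ℝ (Fin n)) (t₁ t₂ : ℝ)
      (X₁ X₂ : EuclideanSpace ℝ (Fin n) →L[ℝ] EuclideanSpace ℝ (Fin n)),
      ‖q₁ - p₁‖ < ε ∧ ‖q₂ + p₂‖ < ε ∧ |t₁ - c₁.2| < ε ∧ |t₂ - c₂.2| < ε ∧
      (∀ v w, ⟪X₁ v, w⟫ = ⟪v, X₁ w⟫) ∧ (∀ v w, ⟪X₂ v, w⟫ = ⟪v, X₂ w⟫) ∧
      (∀ h, -(L * ‖h‖ ^ 2) ≤ ⟪X₁ h, h⟫) ∧ (∀ h, -(L * ‖h‖ ^ 2) ≤ ⟪X₂ h, h⟫) ∧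
      (∀ h k, ⟪X₁ h, h⟫ + ⟪X₂ k, k⟫ ≤ ⟪m (h - k), h - k⟫ + 4 * δ * (‖h‖ ^ 2 + ‖k‖ ^ 2)) ∧
      r₁ + r₂ ≤ (A q₁ t₁ * Matrix.toEuclideanLin.symm X₁.toLinearMap).trace + b q₁ t₁ +
        ((A q₂ t₂ * Matrix.toEuclideanLin.symm X₂.toLinearMap).trace - b q₂ t₂) + ε := by
  obtain ⟨ρ₁, hρ₁, hν₁⟩ := hν₁
  obtain ⟨ρ₂, hρ₂, hν₂⟩ := hν₂
  have hball (c : EuclideanSpace ℝ (Fin n) × ℝ) (hc : c ∈ closure Ω ×ˢ Ioo 0 T) :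
      ∃ s > 0, ∀ z ∈ closure Ω ×ˢ (univ : Set ℝ) ∩ Metric.closedBall c s,
        z ∈ closure Ω ×ˢ Ioo 0 T := by
    obtain ⟨s, hs, h⟩ := Metric.nhds_basis_closedBall.mem_iff.1 (Ioo_mem_nhds hc.2.1 hc.2.2)
    refine ⟨s, hs, fun z hz => ⟨hz.1.1, h ?_⟩⟩
    have := hz.2
    rw [Metric.mem_closedBall, Prod.dist_eq] at this
    exact (le_max_right _ _).trans this
  obtain ⟨s₁, hs₁, hb₁⟩ := hball c₁ hc₁
  obtain ⟨s₂, hs₂, hb₂⟩ := hball c₂ hc₂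
  obtain ⟨s, hs⟩ : ∃ s, s = min r (min s₁ s₂) := ⟨_, rfl⟩
  have hs0 : 0 < s := hs ▸ lt_min hr (lt_min hs₁ hs₂)
  have hsr : s ≤ r := hs ▸ min_le_left _ _
  have hss₁ : s ≤ s₁ := hs ▸ (min_le_right _ _).trans (min_le_left _ _)
  have hss₂ : s ≤ s₂ := hs ▸ (min_le_right _ _).trans (min_le_right _ _)
  have hK (c : EuclideanSpace ℝ (Fin n) × ℝ) :
      IsCompact (closure Ω ×ˢ (univ : Set ℝ) ∩ Metric.closedBall c s) :=
    (isCompact_closedBall c s).inter_left (isClosed_closure.prod isClosed_univ)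
  have hsub₁ : closure Ω ×ˢ (univ : Set ℝ) ∩ Metric.closedBall c₁ s ⊆ closure Ω ×ˢ Ioo 0 T :=
    fun z hz => hb₁ z ⟨hz.1, Metric.closedBall_subset_closedBall hss₁ hz.2⟩
  have hsub₂ : closure Ω ×ˢ (univ : Set ℝ) ∩ Metric.closedBall c₂ s ⊆ closure Ω ×ˢ Ioo 0 T :=
    fun z hz => hb₂ z ⟨hz.1, Metric.closedBall_subset_closedBall hss₂ hz.2⟩
  obtain ⟨ρ, hρ⟩ : ∃ ρ, ρ = min (min s (ε / 2)) (min ρ₁ ρ₂) := ⟨_, rfl⟩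
  have hρ0 : 0 < ρ := hρ ▸ lt_min (lt_min hs0 (by positivity)) (lt_min hρ₁ hρ₂)
  have hρs : ρ ≤ s := hρ ▸ (min_le_left _ _).trans (min_le_left _ _)
  have hρε : ρ ≤ ε / 2 := hρ ▸ (min_le_left _ _).trans (min_le_right _ _)
  have hρρ₁ : ρ ≤ ρ₁ := hρ ▸ (min_le_right _ _).trans (min_le_left _ _)
  have hρρ₂ : ρ ≤ ρ₂ := hρ ▸ (min_le_right _ _).trans (min_le_right _ _)
  obtain ⟨z₁, hz₁, z₂, hz₂, q₁, q₂, σ₁, σ₂, X₁, X₂, C₁, C₂, hd₁, hd₂, hq₁, hq₂, hσ₁, hσ₂, hX₁,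
    hX₂, hj₁, hj₂, hl₁, hl₂, hX⟩ :=
    exists_parabolic_upper_jets_of_add_le (hK c₁) (hK c₂) (hu.mono hsub₁)
      ((hu.mono hsub₂).neg) ⟨⟨hc₁.1, mem_univ _⟩, Metric.mem_closedBall_self hs0.le⟩
      ⟨⟨hc₂.1, mem_univ _⟩, Metric.mem_closedBall_self hs0.le⟩ (p₁ := p₁) (p₂ := p₂) (r₁ := r₁)
      (r₂ := r₂) (C := C) hm hM0 hM hδ hL (fun w₁ hw₁ w₂ hw₂ => by
        have := hle w₁ (hsub₁ hw₁) w₂ (hsub₂ hw₂) ((Metric.mem_closedBall.1 hw₁.2).trans hsr)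
          ((Metric.mem_closedBall.1 hw₂.2).trans hsr)
        simp only [Pi.neg_apply]
        linarith) hρ0
  have hloc {c z : EuclideanSpace ℝ (Fin n) × ℝ} (h : dist z c < ρ) :
      𝓝[closure Ω ×ˢ Ioo 0 T] z ≤ 𝓝[closure Ω ×ˢ (univ : Set ℝ) ∩ Metric.closedBall c s] z := by
    rw [nhdsWithin_inter_of_mem' (mem_nhdsWithin_of_mem_nhds
      (Metric.closedBall_mem_nhds_of_mem (Metric.mem_ball.2 (h.trans_le hρs))))]
    exact nhdsWithin_mono _ (prod_mono subset_rfl (subset_univ _))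
  have hfst {c z : EuclideanSpace ℝ (Fin n) × ℝ} (h : dist z c < ρ) : ‖z.1 - c.1‖ < ρ := by
    rw [← dist_eq_norm]
    exact lt_of_le_of_lt ((le_max_left _ _).trans_eq Prod.dist_eq.symm) h
  have hsnd {c z : EuclideanSpace ℝ (Fin n) × ℝ} (h : dist z c < ρ) : |z.2 - c.2| < ρ := by
    rw [← Real.dist_eq]
    exact lt_of_le_of_lt ((le_max_right _ _).trans_eq Prod.dist_eq.symm) h
  have g₁ := hsub.le_of_upper_jet hΩ (hsub₁ hz₁).1 (hsub₁ hz₁).2 hX₁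
    (hj₁.filter_mono (hloc hd₁)) (fun hf => hν₁ _ hf _ ((hfst hd₁).trans_le hρρ₁)
      (hq₁.trans_le hρρ₁))
  have g₂ := hsup.neg.le_of_upper_jet hΩ (hsub₂ hz₂).1 (hsub₂ hz₂).2 hX₂
    (hj₂.filter_mono (hloc hd₂)) (fun hf => hν₂ _ hf _ ((hfst hd₂).trans_le hρρ₂)
      (hq₂.trans_le hρρ₂))
  refine ⟨q₁, -q₂, z₁.2, z₂.2, X₁, X₂, by linarith, ?_, by linarith [hsnd hd₁],
    by linarith [hsnd hd₂], hX₁, hX₂, hl₁, hl₂, hX, ?_⟩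
  · rw [← norm_neg, neg_add, neg_neg, ← sub_eq_add_neg]
    linarith
  · have := (abs_lt.1 hσ₁).1
    have := (abs_lt.1 hσ₂).1
    linarith

theorem le_of_forall_exists_hessians
    {A : EuclideanSpace ℝ (Fin n) → ℝ → Matrix (Fin n) (Fin n) ℝ}
    {b : EuclideanSpace ℝ (Fin n) → ℝ → ℝ}
    (hA : Continuous fun q : EuclideanSpace ℝ (Fin n) × ℝ => A q.1 q.2)
    (hb : Continuous fun q : EuclideanSpace ℝ (Fin n) × ℝ => b q.1 q.2)
    {p e : EuclideanSpace ℝ (Fin n)} {t a r M : ℝ} (ha : 0 ≤ a) (he : ‖e‖ = 1)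
    (hpsd : (A p t - a • Matrix.vecMulVec e.ofLp e.ofLp).PosSemidef)
    {m : EuclideanSpace ℝ (Fin n) →L[ℝ] EuclideanSpace ℝ (Fin n)}
    (hM0 : 0 ≤ M) (hM : ∀ v w, ⟪m v, w⟫ ≤ M * ‖v‖ * ‖w‖)
    (h : ∀ δ > 0, ∃ L ≥ 0, ∀ ε > 0, ∃ (q₁ q₂ : EuclideanSpace ℝ (Fin n)) (t₁ t₂ : ℝ)
      (X₁ X₂ : EuclideanSpace ℝ (Fin n) →L[ℝ] EuclideanSpace ℝ (Fin n)),
      ‖q₁ - p‖ < ε ∧ ‖q₂ - p‖ < ε ∧ |t₁ - t| < ε ∧ |t₂ - t| < ε ∧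
      (∀ v w, ⟪X₁ v, w⟫ = ⟪v, X₁ w⟫) ∧ (∀ v w, ⟪X₂ v, w⟫ = ⟪v, X₂ w⟫) ∧
      (∀ h, -(L * ‖h‖ ^ 2) ≤ ⟪X₁ h, h⟫) ∧ (∀ h, -(L * ‖h‖ ^ 2) ≤ ⟪X₂ h, h⟫) ∧
      (∀ h k, ⟪X₁ h, h⟫ + ⟪X₂ k, k⟫ ≤ ⟪m (h - k), h - k⟫ + 4 * δ * (‖h‖ ^ 2 + ‖k‖ ^ 2)) ∧
      r ≤ (A q₁ t₁ * Matrix.toEuclideanLin.symm X₁.toLinearMap).trace + b q₁ t₁ +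
        ((A q₂ t₂ * Matrix.toEuclideanLin.symm X₂.toLinearMap).trace - b q₂ t₂) + ε) :
    r ≤ 4 * a * ⟪m e, e⟫ := by
  have key : ∀ δ > 0, r ≤ 4 * a * ⟪m e, e⟫ + 8 * δ * (A p t).trace := by
    intro δ hδ
    obtain ⟨L, hL, h⟩ := h δ hδ
    refine le_of_forall_pos_le_add fun η hη => ?_
    obtain ⟨κ, hκ0, hκ⟩ : ∃ κ > 0, (2 * n ^ 2 * (L + M + 4 * δ) + 3) * κ = η := by
      have : 0 < 2 * (n : ℝ) ^ 2 * (L + M + 4 * δ) + 3 := by positivity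
      exact ⟨η / (2 * n ^ 2 * (L + M + 4 * δ) + 3), by positivity, by field_simp⟩
    have hev : ∀ᶠ w in 𝓝 (p, t), (∀ i j, |A w.1 w.2 i j - A p t i j| ≤ κ) ∧
        |b w.1 w.2 - b p t| ≤ κ := by
      refine Filter.Eventually.and ?_ ?_
      · refine eventually_all.2 fun i => eventually_all.2 fun j => ?_
        have h1 := (hA.matrix_elem i j).continuousAt (x := (p, t))
        filter_upwards [Metric.continuousAt_iff'.1 h1 κ hκ0] with w hw
        exact (Real.dist_eq _ _ ▸ hw).le
      · filter_upwards [Metric.continuousAt_iff'.1 (hb.continuousAt (x := (p, t))) κ hκ0] with w hw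
        exact (Real.dist_eq _ _ ▸ hw).le
    obtain ⟨ε, hε, hev⟩ := Metric.eventually_nhds_iff.1 hev
    obtain ⟨q₁, q₂, t₁, t₂, X₁, X₂, hq₁, hq₂, ht₁, ht₂, hX₁, hX₂, hl₁, hl₂, hX, hle⟩ :=
      h (min ε κ) (lt_min hε hκ0)
    have hd {q : EuclideanSpace ℝ (Fin n)} {s : ℝ} (hq : ‖q - p‖ < min ε κ)
        (hs : |s - t| < min ε κ) : dist (q, s) (p, t) < ε := by
      rw [Prod.dist_eq, dist_eq_norm, Real.dist_eq]
      exact max_lt (hq.trans_le (min_le_left _ _)) (hs.trans_le (min_le_left _ _))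
    obtain ⟨hA₁, hb₁⟩ := hev (hd hq₁ ht₁)
    obtain ⟨hA₂, hb₂⟩ := hev (hd hq₂ ht₂)
    have hu₁ (v : EuclideanSpace ℝ (Fin n)) : ⟪X₁ v, v⟫ ≤ (L + M + 4 * δ) * ‖v‖ ^ 2 := by
      have h1 := hX v 0
      have h2 := hM v v
      simp only [map_zero, inner_zero_left, sub_zero, norm_zero] at h1
      nlinarith [mul_nonneg hL (sq_nonneg ‖v‖)]
    have hu₂ (v : EuclideanSpace ℝ (Fin n)) : ⟪X₂ v, v⟫ ≤ (L + M + 4 * δ) * ‖v‖ ^ 2 := by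
      have h1 := hX 0 v
      have h2 := hM v v
      simp only [map_zero, inner_zero_left, zero_sub, norm_zero, map_neg, inner_neg_neg] at h1
      nlinarith [mul_nonneg hL (sq_nonneg ‖v‖)]
    have hl (v : EuclideanSpace ℝ (Fin n)) :
        -((L + M + 4 * δ) * ‖v‖ ^ 2) ≤ -(L * ‖v‖ ^ 2) := by
      nlinarith [mul_nonneg (by positivity : 0 ≤ M + 4 * δ) (sq_nonneg ‖v‖)]
    have e₁ := trace_mul_le_trace_mul_add hA₁
      (abs_toEuclideanLin_symm_apply_le hX₁ (fun v => (hl v).trans (hl₁ v)) hu₁)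
    have e₂ := trace_mul_le_trace_mul_add hA₂
      (abs_toEuclideanLin_symm_apply_le hX₂ (fun v => (hl v).trans (hl₂ v)) hu₂)
    have e₃ := trace_mul_add_trace_mul_le ha he hpsd hX
    have e₄ := (abs_le.1 hb₁).2
    have e₅ := (abs_le.1 hb₂).1
    have e₆ := min_le_right ε κ
    simp only at e₁ e₂ e₄ e₅
    rw [← hκ]
    linarith
  have hlim : Tendsto (fun δ : ℝ => 4 * a * ⟪m e, e⟫ + 8 * δ * (A p t).trace) (𝓝[>] 0)
      (𝓝 (4 * a * ⟪m e, e⟫ + 8 * 0 * (A p t).trace)) :=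
    ((by fun_prop : Continuous fun δ : ℝ => 4 * a * ⟪m e, e⟫ + 8 * δ * (A p t).trace).tendsto
      0).mono_left nhdsWithin_le_nhds
  rw [mul_zero, zero_mul, add_zero] at hlim
  exact ge_of_tendsto hlim (eventually_nhdsWithin_of_forall fun δ hδ => key δ hδ)

end Doubling

section DoublingPenalty

open Filter Topology

variable {V : Type*} [NormedAddCommGroup V] [InnerProductSpace ℝ V]

theorem exists_pos_inner_outward_normal {Ω : Set V} {ν : V → V}
    (hν : ∀ x ∈ frontier Ω, ‖ν x‖ = 1 ∧ ∀ y ∈ closure Ω, ⟪y - x, ν x⟫ ≤ 0) {z₀ : V} {r : ℝ}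
    (hr : 0 < r) (hz₀ : Metric.closedBall z₀ r ⊆ closure Ω) {a c : V} (hc : c ∈ closure Ω)
    {p κ : ℝ} (hp : 0 ≤ p) (hκ : 0 < κ) :
    ∃ ρ > 0, ∀ z ∈ frontier Ω, ∀ q, ‖z - a‖ < ρ → ‖q - (p • (a - c) + κ • (a - z₀))‖ < ρ →
      0 < ⟪q, ν z⟫ := by
  refine ⟨κ * r / (1 + p + κ), by positivity, fun z hz q hza hq => ?_⟩
  obtain ⟨hν1, hν2⟩ := hν z hz
  obtain ⟨ρ, hρ⟩ : ∃ ρ, ρ = κ * r / (1 + p + κ) := ⟨_, rfl⟩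
  rw [← hρ] at hza hq
  have hρ' : ρ * (1 + p + κ) = κ * r := by rw [hρ]; field_simp
  have h1 : ⟪c - z, ν z⟫ ≤ 0 := hν2 c hc
  have h2 : ⟪z₀ + r • ν z - z, ν z⟫ ≤ 0 := hν2 _ (hz₀ (by
    rw [Metric.mem_closedBall, dist_eq_norm, add_sub_cancel_left, norm_smul, hν1, mul_one,
      Real.norm_of_nonneg hr.le]))
  have h3 : -ρ ≤ ⟪a - z, ν z⟫ := by
    have := (abs_le.1 (abs_real_inner_le_norm (a - z) (ν z))).1
    rw [hν1, norm_sub_rev] at this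
    linarith
  have h4 : -ρ < ⟪q - (p • (a - c) + κ • (a - z₀)), ν z⟫ := by
    have := (abs_le.1 (abs_real_inner_le_norm (q - (p • (a - c) + κ • (a - z₀))) (ν z))).1
    rw [hν1] at this
    linarith
  have h5 : ⟪ν z, ν z⟫ = 1 := by rw [real_inner_self_eq_norm_sq, hν1, one_pow]
  simp only [inner_sub_left, inner_add_left, inner_smul_left, conj_trivial, h5] at h1 h2 h3 h4
  nlinarith [mul_nonneg hp (sub_nonneg.2 h1), mul_nonneg hκ.le (sub_nonneg.2 h2)]

/-- The operator `ζ ↦ p ζ + (q / 2) ⟪d, ζ⟫ d`. -/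
noncomputable def radialHessian (p q : ℝ) (d : V) : V →L[ℝ] V :=
  p • ContinuousLinearMap.id ℝ V + (q / 2) • (innerSL ℝ d).smulRight d

theorem inner_radialHessian (p q : ℝ) (d v w : V) :
    ⟪radialHessian p q d v, w⟫ = p * ⟪v, w⟫ + q / 2 * (⟪d, v⟫ * ⟪d, w⟫) := by
  simp [radialHessian, inner_add_left, inner_smul_left]

theorem inner_radialHessian_le {p : ℝ} (hp : 0 ≤ p) (q : ℝ) (d v w : V) :
    ⟪radialHessian p q d v, w⟫ ≤ (p + |q| / 2 * ‖d‖ ^ 2) * ‖v‖ * ‖w‖ := by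
  rw [inner_radialHessian]
  have h1 := real_inner_le_norm v w
  have h2 : q / 2 * (⟪d, v⟫ * ⟪d, w⟫) ≤ |q| / 2 * ((‖d‖ * ‖v‖) * (‖d‖ * ‖w‖)) := by
    refine (le_abs_self _).trans ?_
    rw [abs_mul, abs_mul, abs_div, abs_two]
    gcongr <;> exact abs_real_inner_le_norm _ _
  nlinarith [mul_le_mul_of_nonneg_left h1 hp]

theorem two_mul_quadratic_le {p p₁ q η δ : ℝ} {d d₁ ζ : V} (hp : |p - p₁| ≤ η)
    (hd : ‖d - d₁‖ ≤ η) (hζ : ‖ζ‖ ≤ η) (hη : η ≤ 1) (hδ : η * (1 + |q| * (‖d₁‖ + 1)) ≤ δ) :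
    2 * (p * (⟪d, ζ⟫ / 2 + ‖ζ‖ ^ 2 / 4) + q / 2 * (⟪d, ζ⟫ / 2 + ‖ζ‖ ^ 2 / 4) ^ 2) ≤
      p * ⟪d, ζ⟫ + ⟪radialHessian p₁ q d₁ ζ, ζ⟫ / 2 + δ * ‖ζ‖ ^ 2 := by
  rw [inner_radialHessian, real_inner_self_eq_norm_sq]
  have hη0 : 0 ≤ η := (norm_nonneg _).trans hζ
  have hz : ‖ζ‖ ^ 2 ≤ η := by nlinarith [norm_nonneg ζ]
  have hdn : ‖d‖ ≤ ‖d₁‖ + 1 := by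
    have := norm_le_norm_add_norm_sub' d d₁
    linarith
  have e1 : |⟪d, ζ⟫| ≤ (‖d₁‖ + 1) * η :=
    (abs_real_inner_le_norm d ζ).trans (by gcongr)
  have e2 : |⟪d, ζ⟫ ^ 2 - ⟪d₁, ζ⟫ ^ 2| ≤ η * (2 * ‖d₁‖ + 1) * ‖ζ‖ ^ 2 := by
    have h1 : ⟪d, ζ⟫ ^ 2 - ⟪d₁, ζ⟫ ^ 2 = ⟪d - d₁, ζ⟫ * ⟪d + d₁, ζ⟫ := by
      rw [inner_sub_left, inner_add_left]; ring
    have h2 := abs_real_inner_le_norm (d - d₁) ζ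
    have h3 := abs_real_inner_le_norm (d + d₁) ζ
    have h4 : ‖d + d₁‖ ≤ 2 * ‖d₁‖ + 1 := by linarith [norm_add_le d d₁]
    rw [h1, abs_mul]
    calc _ ≤ (‖d - d₁‖ * ‖ζ‖) * (‖d + d₁‖ * ‖ζ‖) := by gcongr
      _ ≤ (η * ‖ζ‖) * ((2 * ‖d₁‖ + 1) * ‖ζ‖) := by gcongr
      _ = _ := by ring
  have e3 : (p - p₁) * ‖ζ‖ ^ 2 ≤ η * ‖ζ‖ ^ 2 := by
    gcongr
    exact (le_abs_self _).trans hp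
  have e4 : q * ((⟪d, ζ⟫ ^ 2 - ⟪d₁, ζ⟫ ^ 2) / 4 + ⟪d, ζ⟫ * ‖ζ‖ ^ 2 / 4 + ‖ζ‖ ^ 2 * ‖ζ‖ ^ 2 / 16) ≤
      |q| * (η * (‖d₁‖ + 1) * ‖ζ‖ ^ 2) := by
    refine (le_abs_self _).trans ?_
    rw [abs_mul]
    refine mul_le_mul_of_nonneg_left ?_ (abs_nonneg q)
    have f1 : |⟪d, ζ⟫ * ‖ζ‖ ^ 2| ≤ (‖d₁‖ + 1) * η * ‖ζ‖ ^ 2 := by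
      rw [abs_mul, abs_of_nonneg (sq_nonneg ‖ζ‖)]; gcongr
    have f2 : ‖ζ‖ ^ 2 * ‖ζ‖ ^ 2 ≤ η * ‖ζ‖ ^ 2 := by gcongr
    have f3 : 0 ≤ η * ‖ζ‖ ^ 2 := by positivity
    have f4 : 0 ≤ η * ‖d₁‖ * ‖ζ‖ ^ 2 := by positivity
    have f5 : 0 ≤ ‖ζ‖ ^ 2 * ‖ζ‖ ^ 2 := by positivity
    rw [abs_le] at e2 f1 ⊢
    constructor <;> linarith [e2.1, e2.2, f1.1, f1.2]
  have e5 := mul_le_mul_of_nonneg_right hδ (sq_nonneg ‖ζ‖)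
  have e6 : 0 ≤ η * ‖ζ‖ ^ 2 := by positivity
  linarith

theorem sqrt_add_sq_le {s σ κ : ℝ} (hκ : 0 < κ) :
    √((s + σ) ^ 2 + κ ^ 2) ≤
      √(s ^ 2 + κ ^ 2) + s / √(s ^ 2 + κ ^ 2) * σ + σ ^ 2 / (2 * κ) := by
  have h1 : κ ≤ √(s ^ 2 + κ ^ 2) := Real.le_sqrt_of_sq_le (by linarith [sq_nonneg s])
  have h2 : √(s ^ 2 + κ ^ 2) ^ 2 = s ^ 2 + κ ^ 2 := Real.sq_sqrt (by positivity)
  set θ := √(s ^ 2 + κ ^ 2)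
  have h3 : 0 < θ := hκ.trans_le h1
  have h4 : √((s + σ) ^ 2 + κ ^ 2) ≤ θ + s / θ * σ + σ ^ 2 / (2 * θ) := by
    have h5 : √((s + σ) ^ 2 + κ ^ 2) ^ 2 = (s + σ) ^ 2 + κ ^ 2 := Real.sq_sqrt (by positivity)
    have h6 : θ + s / θ * σ + σ ^ 2 / (2 * θ) =
        (√((s + σ) ^ 2 + κ ^ 2) ^ 2 + θ ^ 2) / (2 * θ) := by
      rw [h5]
      field_simp
      linarith
    rw [h6, le_div_iff₀ (by positivity)]
    nlinarith [sq_nonneg (√((s + σ) ^ 2 + κ ^ 2) - θ)]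
  have h7 : σ ^ 2 / (2 * θ) ≤ σ ^ 2 / (2 * κ) := by gcongr
  linarith

theorem abs_div_sqrt_add_sq_le_one {s κ : ℝ} (hκ : 0 < κ) : |s / √(s ^ 2 + κ ^ 2)| ≤ 1 := by
  rw [abs_div, abs_of_nonneg (Real.sqrt_nonneg _), div_le_one (by positivity)]
  exact Real.abs_le_sqrt (by linarith [sq_nonneg κ])

/-- The penalty for doubling variables: the two-point function `2 χ (|y - x|² / 4)`, a smoothing
of `2 (a (t - t₀) + 2 η |t - t₀|)`, a quadratic penalty on the difference of the times, and a
small confinement of both points around `z₀`. -/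
noncomputable def doublingPenalty (χ : ℝ → ℝ) (a η t₀ : ℝ) (z₀ : V) (κ : ℝ) (w₁ w₂ : V × ℝ) : ℝ :=
  2 * χ (‖w₁.1 - w₂.1‖ ^ 2 / 4) + 2 * a * (w₁.2 - t₀) + 4 * η * √((w₁.2 - t₀) ^ 2 + κ ^ 2) +
    (w₁.2 - w₂.2) ^ 2 / (2 * κ ^ 2) + κ / 2 * (‖w₁.1 - z₀‖ ^ 2 + ‖w₂.1 - z₀‖ ^ 2)

theorem doublingPenalty_le {χ : ℝ → ℝ} {a η t₀ κ p p₁ q η' δ h₀ : ℝ} {z₀ d₁ : V}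
    {c₁ c₂ w₁ w₂ : V × ℝ} (hη : 0 ≤ η) (hκ : 0 < κ) (hκδ : κ ≤ δ / 2) (hp : |p - p₁| ≤ η')
    (hd : ‖c₁.1 - c₂.1 - d₁‖ ≤ η') (hη' : η' ≤ 1) (hδ : η' * (1 + |q| * (‖d₁‖ + 1)) ≤ δ / 8)
    (hχ : ∀ h, |h| < h₀ → χ (‖c₁.1 - c₂.1‖ ^ 2 / 4 + h) ≤
      χ (‖c₁.1 - c₂.1‖ ^ 2 / 4) + p * h + q / 2 * h ^ 2)
    (hw : ‖(w₁.1 - c₁.1) - (w₂.1 - c₂.1)‖ ≤ η')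
    (hw' : |‖w₁.1 - w₂.1‖ ^ 2 / 4 - ‖c₁.1 - c₂.1‖ ^ 2 / 4| < h₀) :
    doublingPenalty χ a η t₀ z₀ κ w₁ w₂ ≤ doublingPenalty χ a η t₀ z₀ κ c₁ c₂ +
      ⟪p • (c₁.1 - c₂.1) + κ • (c₁.1 - z₀), w₁.1 - c₁.1⟫ +
      ⟪p • (c₂.1 - c₁.1) + κ • (c₂.1 - z₀), w₂.1 - c₂.1⟫ +
      (2 * a + 4 * η * ((c₁.2 - t₀) / √((c₁.2 - t₀) ^ 2 + κ ^ 2)) + (c₁.2 - c₂.2) / κ ^ 2) *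
        (w₁.2 - c₁.2) + -((c₁.2 - c₂.2) / κ ^ 2) * (w₂.2 - c₂.2) +
      (⟪radialHessian p₁ q d₁ ((w₁.1 - c₁.1) - (w₂.1 - c₂.1)),
          (w₁.1 - c₁.1) - (w₂.1 - c₂.1)⟫ +
        δ * (‖w₁.1 - c₁.1‖ ^ 2 + ‖w₂.1 - c₂.1‖ ^ 2)) / 2 +
      (1 / κ ^ 2 + 2 * η / κ) * ((w₁.2 - c₁.2) ^ 2 + (w₂.2 - c₂.2) ^ 2) := by
  obtain ⟨ζ₁, hζ₁⟩ : ∃ ζ, ζ = w₁.1 - c₁.1 := ⟨_, rfl⟩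
  obtain ⟨ζ₂, hζ₂⟩ : ∃ ζ, ζ = w₂.1 - c₂.1 := ⟨_, rfl⟩
  obtain ⟨σ₁, hσ₁⟩ : ∃ σ, σ = w₁.2 - c₁.2 := ⟨_, rfl⟩
  obtain ⟨σ₂, hσ₂⟩ : ∃ σ, σ = w₂.2 - c₂.2 := ⟨_, rfl⟩
  rw [← hζ₁, ← hζ₂] at hw
  have e1 := two_mul_quadratic_le (p₁ := p₁) (q := q) hp hd hw hη' hδ
  have e2 : ‖w₁.1 - w₂.1‖ ^ 2 / 4 = ‖c₁.1 - c₂.1‖ ^ 2 / 4 +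
      (⟪c₁.1 - c₂.1, ζ₁ - ζ₂⟫ / 2 + ‖ζ₁ - ζ₂‖ ^ 2 / 4) := by
    have : w₁.1 - w₂.1 = (c₁.1 - c₂.1) + (ζ₁ - ζ₂) := by rw [hζ₁, hζ₂]; abel
    rw [this, norm_add_sq_real]
    ring
  have e3 := hχ (⟪c₁.1 - c₂.1, ζ₁ - ζ₂⟫ / 2 + ‖ζ₁ - ζ₂‖ ^ 2 / 4) (by
    rwa [e2, add_sub_cancel_left] at hw')
  rw [← e2] at e3
  have e4 : ‖ζ₁ - ζ₂‖ ^ 2 ≤ 2 * (‖ζ₁‖ ^ 2 + ‖ζ₂‖ ^ 2) := by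
    have := parallelogram_law_with_norm ℝ ζ₁ ζ₂
    linarith [sq_nonneg ‖ζ₁ + ζ₂‖, sq ‖ζ₁ + ζ₂‖, sq ‖ζ₁ - ζ₂‖, sq ‖ζ₁‖, sq ‖ζ₂‖]
  have e5 : √((w₁.2 - t₀) ^ 2 + κ ^ 2) ≤ √((c₁.2 - t₀) ^ 2 + κ ^ 2) +
      (c₁.2 - t₀) / √((c₁.2 - t₀) ^ 2 + κ ^ 2) * σ₁ + σ₁ ^ 2 / (2 * κ) := by
    have : w₁.2 - t₀ = c₁.2 - t₀ + σ₁ := by rw [hσ₁]; ring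
    rw [this]
    exact sqrt_add_sq_le hκ
  have e6 : ‖w₁.1 - z₀‖ ^ 2 = ‖c₁.1 - z₀‖ ^ 2 + 2 * ⟪c₁.1 - z₀, ζ₁⟫ + ‖ζ₁‖ ^ 2 := by
    rw [← norm_add_sq_real, hζ₁]; congr 2; abel
  have e7 : ‖w₂.1 - z₀‖ ^ 2 = ‖c₂.1 - z₀‖ ^ 2 + 2 * ⟪c₂.1 - z₀, ζ₂⟫ + ‖ζ₂‖ ^ 2 := by
    rw [← norm_add_sq_real, hζ₂]; congr 2; abel
  have e8 : (w₁.2 - w₂.2) ^ 2 / (2 * κ ^ 2) = (c₁.2 - c₂.2) ^ 2 / (2 * κ ^ 2) +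
      (c₁.2 - c₂.2) / κ ^ 2 * (σ₁ - σ₂) + (σ₁ - σ₂) ^ 2 / (2 * κ ^ 2) := by
    rw [hσ₁, hσ₂]
    field_simp
    ring
  have e9 : (σ₁ - σ₂) ^ 2 / (2 * κ ^ 2) ≤ 1 / κ ^ 2 * (σ₁ ^ 2 + σ₂ ^ 2) := by
    rw [div_le_iff₀ (by positivity)]
    have : 1 / κ ^ 2 * (σ₁ ^ 2 + σ₂ ^ 2) * (2 * κ ^ 2) = 2 * (σ₁ ^ 2 + σ₂ ^ 2) := by field_simp
    rw [this]
    linarith [sq_nonneg (σ₁ + σ₂), add_sq σ₁ σ₂, sub_sq σ₁ σ₂]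
  have e10 : 4 * η * (σ₁ ^ 2 / (2 * κ)) ≤ 2 * η / κ * (σ₁ ^ 2 + σ₂ ^ 2) := by
    have : 4 * η * (σ₁ ^ 2 / (2 * κ)) = 2 * η / κ * σ₁ ^ 2 := by field_simp; ring
    rw [this, mul_add]
    exact le_add_of_nonneg_right (by positivity)
  have e11 := mul_le_mul_of_nonneg_left e5 (by positivity : 0 ≤ 4 * η)
  have e12 : p * ⟪c₁.1 - c₂.1, ζ₁ - ζ₂⟫ =
      p * ⟪c₁.1 - c₂.1, ζ₁⟫ + p * ⟪c₂.1 - c₁.1, ζ₂⟫ := by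
    rw [← neg_sub c₁.1 c₂.1, inner_neg_left, inner_sub_right]; ring
  have e13 := mul_le_mul_of_nonneg_left e4 (by linarith : 0 ≤ δ / 8)
  have e14 := mul_le_mul_of_nonneg_right hκδ (by positivity : 0 ≤ ‖ζ₁‖ ^ 2 + ‖ζ₂‖ ^ 2)
  have e15 : 2 * a * (w₁.2 - t₀) = 2 * a * (c₁.2 - t₀) + 2 * a * σ₁ := by rw [hσ₁]; ring
  rw [← hζ₁, ← hζ₂, ← hσ₁, ← hσ₂]
  simp only [inner_add_left, inner_smul_left, conj_trivial, doublingPenalty]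
  rw [e6, e7, e8, e15]
  linarith

end DoublingPenalty

section Maximizers

open Filter Topology

variable {V : Type*} [NormedAddCommGroup V]

theorem continuous_doublingPenalty {χ : ℝ → ℝ} (hχ : Continuous χ) (a η t₀ : ℝ) (z₀ : V) (κ : ℝ) :
    Continuous fun w : (V × ℝ) × V × ℝ => doublingPenalty χ a η t₀ z₀ κ w.1 w.2 := by
  unfold doublingPenalty
  fun_prop

theorem exists_doubling_maximizers {K : Set V} (hK : IsCompact K) {T : ℝ} {u : V × ℝ → ℝ}
    (hu : ContinuousOn u (K ×ˢ Ioo 0 T)) {χ : ℝ → ℝ} (hχ : Continuous χ) {S a η t₀ r : ℝ}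
    (hη : 0 < η) (hr : 0 < r) (hrT : Icc (t₀ - r) (t₀ + r) ⊆ Ioo 0 T) {x₀ y₀ : V} (hx₀ : x₀ ∈ K)
    (hy₀ : y₀ ∈ K) (hS : ‖y₀ - x₀‖ ^ 2 / 4 = S) (hχS : χ S = 0)
    (hle : ∀ x ∈ K, ∀ y ∈ K, ∀ t, |‖y - x‖ ^ 2 / 4 - S| ≤ r → |t - t₀| ≤ r →
      u (y, t) - u (x, t) ≤ u (y₀, t₀) - u (x₀, t₀) +
        2 * (χ (‖y - x‖ ^ 2 / 4) + a * (t - t₀) + η * |t - t₀|))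
    (heq : ∀ x ∈ K, ∀ y ∈ K, |‖y - x‖ ^ 2 / 4 - S| ≤ r →
      u (y, t₀) - u (x, t₀) = u (y₀, t₀) - u (x₀, t₀) + 2 * χ (‖y - x‖ ^ 2 / 4) →
      ‖y - x‖ ^ 2 / 4 = S) (z₀ : V) :
    ∃ x₁ ∈ K, ∃ y₁ ∈ K, ‖y₁ - x₁‖ ^ 2 / 4 = S ∧ ∀ ρ > 0, ∃ κ, 0 < κ ∧ κ < ρ ∧
      ∃ c₁ ∈ K ×ˢ Ioo 0 T, ∃ c₂ ∈ K ×ˢ Ioo 0 T, dist c₁ (y₁, t₀) < ρ ∧ dist c₂ (x₁, t₀) < ρ ∧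
        ∀ᶠ w in 𝓝 (c₁, c₂), w.1 ∈ K ×ˢ Ioo 0 T → w.2 ∈ K ×ˢ Ioo 0 T →
          u w.1 - u w.2 - doublingPenalty χ a η t₀ z₀ κ w.1 w.2 ≤
            u c₁ - u c₂ - doublingPenalty χ a η t₀ z₀ κ c₁ c₂ := by
  obtain ⟨Q, hQ⟩ : ∃ Q : Set ((V × ℝ) × V × ℝ), Q = (K ×ˢ Icc (t₀ - r) (t₀ + r)) ×ˢ
      (K ×ˢ Icc (t₀ - r) (t₀ + r)) ∩ {w | |‖w.1.1 - w.2.1‖ ^ 2 / 4 - S| ≤ r} := ⟨_, rfl⟩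
  have hQc : IsCompact Q := by
    rw [hQ]
    exact ((hK.prod isCompact_Icc).prod (hK.prod isCompact_Icc)).inter_right
      (isClosed_le (by fun_prop) continuous_const)
  have hQ₁ : ∀ w ∈ Q, w.1 ∈ K ×ˢ Ioo 0 T := fun w hw => by
    rw [hQ] at hw; exact ⟨hw.1.1.1, hrT hw.1.1.2⟩
  have hQ₂ : ∀ w ∈ Q, w.2 ∈ K ×ˢ Ioo 0 T := fun w hw => by
    rw [hQ] at hw; exact ⟨hw.1.2.1, hrT hw.1.2.2⟩
  have huQ : ContinuousOn (fun w : (V × ℝ) × V × ℝ => u w.1 - u w.2) Q :=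
    (hu.comp continuousOn_fst hQ₁).sub (hu.comp continuousOn_snd hQ₂)
  have ht₀ : t₀ ∈ Icc (t₀ - r) (t₀ + r) := ⟨by linarith, by linarith⟩
  have hw₀ : ((y₀, t₀), (x₀, t₀)) ∈ Q := by
    rw [hQ]
    refine ⟨⟨⟨hy₀, ht₀⟩, ⟨hx₀, ht₀⟩⟩, ?_⟩
    simp [hS, hr.le]
  have hmax (κ : ℝ) : ∃ w ∈ Q, ∀ w' ∈ Q,
      u w'.1 - u w'.2 - doublingPenalty χ a η t₀ z₀ κ w'.1 w'.2 ≤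
        u w.1 - u w.2 - doublingPenalty χ a η t₀ z₀ κ w.1 w.2 :=
    hQc.exists_isMaxOn ⟨_, hw₀⟩
      (huQ.sub (continuous_doublingPenalty hχ a η t₀ z₀ κ).continuousOn)
  choose f hfQ hf using hmax
  obtain ⟨H, hH⟩ : ∃ H : (V × ℝ) × V × ℝ → ℝ, H = fun w => u w.1 - u w.2 -
    (2 * χ (‖w.1.1 - w.2.1‖ ^ 2 / 4) + 2 * a * (w.1.2 - t₀) + 4 * η * |w.1.2 - t₀|) := ⟨_, rfl⟩
  have hHc : ContinuousOn H Q := by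
    rw [hH]
    exact huQ.sub (by fun_prop)
  obtain ⟨B, hB⟩ := hQc.bddAbove_image hHc
  rw [mem_upperBounds, forall_mem_image] at hB
  obtain ⟨c, hc⟩ : ∃ c, c = ‖y₀ - z₀‖ ^ 2 + ‖x₀ - z₀‖ ^ 2 := ⟨_, rfl⟩
  have hlow : ∀ κ > 0, u (y₀, t₀) - u (x₀, t₀) - (4 * η * κ + κ / 2 * c) +
      ((f κ).1.2 - (f κ).2.2) ^ 2 / (2 * κ ^ 2) ≤ H (f κ) := by
    intro κ hκ
    have h1 := hf κ _ hw₀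
    have h2 : |(f κ).1.2 - t₀| ≤ √(((f κ).1.2 - t₀) ^ 2 + κ ^ 2) :=
      Real.abs_le_sqrt (by linarith [sq_nonneg κ])
    have h3 := mul_le_mul_of_nonneg_left h2 (by positivity : 0 ≤ 4 * η)
    have h4 : 0 ≤ κ / 2 * (‖(f κ).1.1 - z₀‖ ^ 2 + ‖(f κ).2.1 - z₀‖ ^ 2) := by positivity
    simp only [doublingPenalty, hS, hχS, sub_self, mul_zero, zero_add, add_zero, ne_eq,
      OfNat.ofNat_ne_zero, not_false_eq_true, zero_pow, zero_div, Real.sqrt_sq hκ.le, ← hc] at h1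
    rw [hH]
    linarith
  obtain ⟨w₁, hw₁Q, hw₁⟩ := hQc.ultrafilter_le_nhds ((Ultrafilter.of (𝓝[>] (0 : ℝ))).map f)
    (le_principal_iff.2 (Ultrafilter.mem_map.2 (Filter.univ_mem' hfQ)))
  have hlim : Tendsto f (Ultrafilter.of (𝓝[>] (0 : ℝ))) (𝓝 w₁) := hw₁
  have hle0 : (Ultrafilter.of (𝓝[>] (0 : ℝ)) : Filter ℝ) ≤ 𝓝[>] 0 := Ultrafilter.of_le _
  have hpos : ∀ᶠ κ in (Ultrafilter.of (𝓝[>] (0 : ℝ)) : Filter ℝ), 0 < κ :=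
    hle0 self_mem_nhdsWithin
  have hκ0 : Tendsto (fun κ : ℝ => κ) (Ultrafilter.of (𝓝[>] (0 : ℝ))) (𝓝 0) :=
    hle0.trans nhdsWithin_le_nhds
  have hsq : (w₁.1.2 - w₁.2.2) ^ 2 ≤ 0 := by
    have h1 : Tendsto (fun κ => ((f κ).1.2 - (f κ).2.2) ^ 2) (Ultrafilter.of (𝓝[>] (0 : ℝ)))
        (𝓝 ((w₁.1.2 - w₁.2.2) ^ 2)) :=
      ((by fun_prop : Continuous fun w : (V × ℝ) × V × ℝ => (w.1.2 - w.2.2) ^ 2).tendsto w₁).comp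
        hlim
    have h2 : Tendsto (fun κ : ℝ => 2 * κ ^ 2 *
        (B - (u (y₀, t₀) - u (x₀, t₀)) + (4 * η * κ + κ / 2 * c)))
        (Ultrafilter.of (𝓝[>] (0 : ℝ))) (𝓝 (2 * 0 ^ 2 *
          (B - (u (y₀, t₀) - u (x₀, t₀)) + (4 * η * 0 + 0 / 2 * c)))) :=
      ((by fun_prop : Continuous fun κ : ℝ => 2 * κ ^ 2 *
        (B - (u (y₀, t₀) - u (x₀, t₀)) + (4 * η * κ + κ / 2 * c))).tendsto 0).comp hκ0
    rw [zero_pow two_ne_zero, mul_zero, zero_mul] at h2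
    refine le_of_tendsto_of_tendsto h1 h2 ?_
    filter_upwards [hpos] with κ hκ
    have h3 := hlow κ hκ
    have h4 := hB (hfQ κ)
    have h5 : ((f κ).1.2 - (f κ).2.2) ^ 2 / (2 * κ ^ 2) ≤
        B - (u (y₀, t₀) - u (x₀, t₀)) + (4 * η * κ + κ / 2 * c) := by linarith
    rw [div_le_iff₀ (by positivity)] at h5
    linarith
  have htt : w₁.1.2 = w₁.2.2 := by
    have := pow_eq_zero_iff two_ne_zero |>.1 (le_antisymm hsq (sq_nonneg _))
    linarith
  have hHw : u (y₀, t₀) - u (x₀, t₀) ≤ H w₁ := by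
    have h1 : Tendsto (fun κ => H (f κ)) (Ultrafilter.of (𝓝[>] (0 : ℝ))) (𝓝 (H w₁)) :=
      (hHc w₁ hw₁Q).tendsto.comp
        (tendsto_nhdsWithin_iff.2 ⟨hlim, Eventually.of_forall hfQ⟩)
    have h2 : Tendsto (fun κ : ℝ => u (y₀, t₀) - u (x₀, t₀) - (4 * η * κ + κ / 2 * c))
        (Ultrafilter.of (𝓝[>] (0 : ℝ)))
        (𝓝 (u (y₀, t₀) - u (x₀, t₀) - (4 * η * 0 + 0 / 2 * c))) :=
      ((by fun_prop : Continuous fun κ : ℝ =>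
        u (y₀, t₀) - u (x₀, t₀) - (4 * η * κ + κ / 2 * c)).tendsto 0).comp hκ0
    rw [mul_zero, zero_div, zero_mul, add_zero, sub_zero] at h2
    refine le_of_tendsto_of_tendsto h2 h1 ?_
    filter_upwards [hpos] with κ hκ
    have h3 := hlow κ hκ
    have h4 : 0 ≤ ((f κ).1.2 - (f κ).2.2) ^ 2 / (2 * κ ^ 2) := by positivity
    linarith
  obtain ⟨⟨y₁, t₁⟩, ⟨x₁, t₂⟩⟩ := w₁
  simp only at htt
  subst htt
  have hmem := hw₁Q
  rw [hQ] at hmem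
  obtain ⟨⟨⟨hy₁, ht₁⟩, ⟨hx₁, -⟩⟩, hS₁⟩ := hmem
  simp only at hy₁ hx₁ ht₁
  rw [mem_ofPred_eq] at hS₁
  rw [hH] at hHw
  simp only at hHw hS₁
  have h1 := hle x₁ hx₁ y₁ hy₁ t₁ hS₁ (abs_le.2 ⟨by linarith [ht₁.1], by linarith [ht₁.2]⟩)
  have ht : t₁ = t₀ := by
    have : η * |t₁ - t₀| ≤ 0 := by linarith
    have : |t₁ - t₀| ≤ 0 := by
      by_contra! h
      linarith [mul_pos hη h]
    linarith [abs_nonpos_iff.1 this]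
  subst ht
  rw [sub_self, abs_zero] at hHw h1
  have hSS := heq x₁ hx₁ y₁ hy₁ hS₁ (by linarith)
  refine ⟨x₁, hx₁, y₁, hy₁, hSS, fun ρ hρ => ?_⟩
  obtain ⟨N, hN⟩ : ∃ N : Set ((V × ℝ) × V × ℝ), N = (fun w => w.1.2) ⁻¹' Ioo (t₁ - r) (t₁ + r) ∩
      (fun w => w.2.2) ⁻¹' Ioo (t₁ - r) (t₁ + r) ∩ {w | |‖w.1.1 - w.2.1‖ ^ 2 / 4 - S| < r} :=
    ⟨_, rfl⟩
  have hNo : IsOpen N := by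
    rw [hN]
    exact ((isOpen_Ioo.preimage (by fun_prop)).inter (isOpen_Ioo.preimage (by fun_prop))).inter
      (isOpen_lt (by fun_prop) continuous_const)
  have hNmem : ((y₁, t₁), (x₁, t₁)) ∈ N := by
    rw [hN]
    refine ⟨⟨⟨?_, ?_⟩, ⟨?_, ?_⟩⟩, ?_⟩ <;> simp [hSS, hr]
  have hev := hlim.eventually (hNo.mem_nhds hNmem)
  have hd := hlim.eventually (Metric.ball_mem_nhds _ hρ)
  obtain ⟨κ, hκp, hκρ, hκN, hκd⟩ := (hpos.and ((hκ0.eventually (gt_mem_nhds hρ)).and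
    (hev.and hd))).exists
  rw [Prod.dist_eq] at hκd
  refine ⟨κ, hκp, hκρ, (f κ).1, hQ₁ _ (hfQ κ), (f κ).2, hQ₂ _ (hfQ κ),
    (le_max_left _ _).trans_lt hκd, (le_max_right _ _).trans_lt hκd, ?_⟩
  filter_upwards [hNo.mem_nhds hκN] with w hw hw₁ hw₂
  refine hf κ w ?_
  rw [hN] at hw
  rw [hQ]
  refine ⟨⟨⟨hw₁.1, Ioo_subset_Icc_self hw.1.1⟩, ⟨hw₂.1, Ioo_subset_Icc_self hw.1.2⟩⟩, ?_⟩
  have := hw.2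
  rw [mem_ofPred_eq] at this ⊢
  exact this.le

end Maximizers

section TouchingTwoPointFunction

open Filter Topology

theorem norm_smul_add_smul_sub_le {V : Type*} [NormedAddCommGroup V] [InnerProductSpace ℝ V]
    {c c' z z₀ d : V} {p p' κ ρ s C : ℝ} (hp : 0 ≤ p) (hκ : 0 ≤ κ) (hκρ : κ ≤ ρ) (hρ : ρ ≤ 1)
    (hp' : |p' - p| ≤ ρ) (hs : |s| = 1) (hc : ‖c - z‖ ≤ ρ / 2) (hcc : ‖c - c' - s • d‖ ≤ ρ)
    (hz : ‖z - z₀‖ ≤ C) :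
    ‖p' • (c - c') + κ • (c - z₀) - s • p • d‖ ≤ ρ * (‖d‖ + 1 + p + (C + 1)) := by
  have e1 : p' • (c - c') + κ • (c - z₀) - s • p • d =
      (p' - p) • (c - c') + p • (c - c' - s • d) + κ • (c - z₀) := by module
  have e2 : ‖c - z₀‖ ≤ C + 1 := by
    linarith [norm_sub_le_norm_sub_add_norm_sub c z z₀]
  have e3 : ‖c - c'‖ ≤ ‖d‖ + 1 := by
    have h1 := norm_le_norm_add_norm_sub' (c - c') (s • d)
    rw [norm_smul, Real.norm_eq_abs, hs, one_mul] at h1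
    linarith
  have hρ0 : 0 ≤ ρ := hκ.trans hκρ
  rw [e1]
  refine norm_add₃_le.trans ?_
  rw [norm_smul, norm_smul, norm_smul, Real.norm_eq_abs, Real.norm_eq_abs, Real.norm_eq_abs,
    abs_of_nonneg hp, abs_of_nonneg hκ]
  have f1 := mul_le_mul hp' e3 (norm_nonneg _) hρ0
  have f2 := mul_le_mul_of_nonneg_left hcc hp
  have f3 := mul_le_mul hκρ e2 (norm_nonneg _) hρ0
  linarith

theorem exists_local_bounds {V : Type*} [NormedAddCommGroup V] {c₁ c₂ : V × ℝ} {ρ h₀ : ℝ}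
    (hρ : 0 < ρ) (hh₀ : 0 < h₀) {Q : (V × ℝ) × V × ℝ → Prop} (hQ : ∀ᶠ w in 𝓝 (c₁, c₂), Q w) :
    ∃ r > 0, ∀ w₁ w₂ : V × ℝ, dist w₁ c₁ ≤ r → dist w₂ c₂ ≤ r → Q (w₁, w₂) ∧
      ‖(w₁.1 - c₁.1) - (w₂.1 - c₂.1)‖ ≤ ρ ∧
      |‖w₁.1 - w₂.1‖ ^ 2 / 4 - ‖c₁.1 - c₂.1‖ ^ 2 / 4| < h₀ := by
  have h1 : ∀ᶠ w : (V × ℝ) × V × ℝ in 𝓝 (c₁, c₂),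
      ‖(w.1.1 - c₁.1) - (w.2.1 - c₂.1)‖ < ρ := by
    refine Continuous.tendsto (by fun_prop) (c₁, c₂) |>.eventually (gt_mem_nhds ?_)
    simpa using hρ
  have h2 : ∀ᶠ w : (V × ℝ) × V × ℝ in 𝓝 (c₁, c₂),
      |‖w.1.1 - w.2.1‖ ^ 2 / 4 - ‖c₁.1 - c₂.1‖ ^ 2 / 4| < h₀ := by
    refine Continuous.tendsto (by fun_prop) (c₁, c₂) |>.eventually (gt_mem_nhds ?_)
    simpa using hh₀
  obtain ⟨r, hr, h⟩ := Metric.nhds_basis_closedBall.eventually_iff.1 (hQ.and (h1.and h2))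
  refine ⟨r, hr, fun w₁ w₂ hw₁ hw₂ => ?_⟩
  obtain ⟨g1, g2, g3⟩ := h (x := (w₁, w₂)) (by
    rw [Metric.mem_closedBall, Prod.dist_eq]
    exact max_le hw₁ hw₂)
  exact ⟨g1, g2.le, g3⟩

set_option maxHeartbeats 1000000 in
theorem le_of_two_point_touching {n : ℕ} {Ω : Set (EuclideanSpace ℝ (Fin n))} (hΩo : IsOpen Ω)
    (hΩne : Ω.Nonempty) (hΩb : Bornology.IsBounded Ω)
    {ν : EuclideanSpace ℝ (Fin n) → EuclideanSpace ℝ (Fin n)}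
    (hν : ∀ x ∈ frontier Ω, ‖ν x‖ = 1 ∧ ∀ y ∈ closure Ω, ⟪y - x, ν x⟫ ≤ 0) {T : ℝ}
    {A : EuclideanSpace ℝ (Fin n) → ℝ → Matrix (Fin n) (Fin n) ℝ}
    {b : EuclideanSpace ℝ (Fin n) → ℝ → ℝ}
    (hAc : Continuous fun q : EuclideanSpace ℝ (Fin n) × ℝ => A q.1 q.2)
    (hbc : Continuous fun q : EuclideanSpace ℝ (Fin n) × ℝ => b q.1 q.2)
    {u : EuclideanSpace ℝ (Fin n) × ℝ → ℝ} (hu : ContinuousOn u (closure Ω ×ˢ Ioo 0 T))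
    (hsub : IsViscositySubsolnNeumann n Ω T ν (fun _ p X t => (A p t * X).trace + b p t)
      (fun _ => 0) u)
    (hsup : IsViscositySupersolnNeumann n Ω T ν (fun _ p X t => (A p t * X).trace + b p t)
      (fun _ => 0) u)
    {χ : ℝ → ℝ} (hχ : Continuous χ) {S a η t₀ r p q : ℝ} (hS0 : 0 < S) (hp : 0 ≤ p)
    (hη : 0 < η) (hr : 0 < r) (hrT : Icc (t₀ - r) (t₀ + r) ⊆ Ioo 0 T)
    {α : ℝ} (hα0 : 0 ≤ α) (hα : ∀ e : EuclideanSpace ℝ (Fin n), ‖e‖ = 1 →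
      (A ((2 * √S * p) • e) t₀ - α • Matrix.vecMulVec e.ofLp e.ofLp).PosSemidef)
    {x₀ y₀ : EuclideanSpace ℝ (Fin n)} (hx₀ : x₀ ∈ closure Ω) (hy₀ : y₀ ∈ closure Ω)
    (hS : ‖y₀ - x₀‖ ^ 2 / 4 = S) (hχS : χ S = 0)
    (hle : ∀ x ∈ closure Ω, ∀ y ∈ closure Ω, ∀ t, |‖y - x‖ ^ 2 / 4 - S| ≤ r → |t - t₀| ≤ r →
      u (y, t) - u (x, t) ≤ u (y₀, t₀) - u (x₀, t₀) +
        2 * (χ (‖y - x‖ ^ 2 / 4) + a * (t - t₀) + η * |t - t₀|))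
    (heq : ∀ x ∈ closure Ω, ∀ y ∈ closure Ω, |‖y - x‖ ^ 2 / 4 - S| ≤ r →
      u (y, t₀) - u (x, t₀) = u (y₀, t₀) - u (x₀, t₀) + 2 * χ (‖y - x‖ ^ 2 / 4) →
      ‖y - x‖ ^ 2 / 4 = S)
    (hjet : ∀ ρ > 0, ∀ᶠ s in 𝓝 S, ∃ p' ≥ 0, |p' - p| ≤ ρ ∧
      ∀ᶠ h in 𝓝 0, χ (s + h) ≤ χ s + p' * h + q / 2 * h ^ 2) :
    a - 2 * η ≤ 2 * α * (p + 2 * q * S) := by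
  have hK : IsCompact (closure Ω) := hΩb.isCompact_closure
  obtain ⟨z₀, hz₀⟩ := hΩne
  obtain ⟨r₀, hr₀, hball⟩ := Metric.nhds_basis_closedBall.mem_iff.1 (hΩo.mem_nhds hz₀)
  have hball' : Metric.closedBall z₀ r₀ ⊆ closure Ω := hball.trans subset_closure
  obtain ⟨x₁, hx₁, y₁, hy₁, hS₁, hmax⟩ := exists_doubling_maximizers hK hu hχ hη hr hrT hx₀ hy₀ hS
    hχS hle heq z₀
  obtain ⟨d, hd⟩ : ∃ d, d = y₁ - x₁ := ⟨_, rfl⟩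
  rw [← hd] at hS₁
  have hdn : ‖d‖ = 2 * √S := by
    rw [← hS₁, Real.sqrt_div (by positivity), Real.sqrt_sq (norm_nonneg _),
      show (4 : ℝ) = 2 ^ 2 by norm_num, Real.sqrt_sq zero_le_two]
    ring
  have hd0 : 0 < ‖d‖ := by rw [hdn]; positivity
  obtain ⟨e, he⟩ : ∃ e, e = ‖d‖⁻¹ • d := ⟨_, rfl⟩
  have hen : ‖e‖ = 1 := by
    rw [he, norm_smul, norm_inv, norm_norm, inv_mul_cancel₀ hd0.ne']
  have hde : d = ‖d‖ • e := by rw [he, smul_inv_smul₀ hd0.ne']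
  have hpd : (2 * √S * p) • e = p • d := by
    rw [← hdn, mul_comm, mul_smul, ← hde]
  have hpsd := hα e hen
  rw [hpd] at hpsd
  have hM0 : 0 ≤ p + |q| / 2 * ‖d‖ ^ 2 := by positivity
  have hmain : 2 * a - 4 * η ≤ 4 * α * ⟪radialHessian p q d e, e⟫ := by
    refine le_of_forall_exists_hessians hAc hbc hα0 hen hpsd hM0
      (inner_radialHessian_le hp q d) fun δ hδ => ?_
    obtain ⟨L, hL⟩ : ∃ L, L = 2 * (p + |q| / 2 * ‖d‖ ^ 2) + δ +
      (2 * (p + |q| / 2 * ‖d‖ ^ 2) + δ) ^ 2 / δ := ⟨_, rfl⟩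
    refine ⟨L, by rw [hL]; positivity, fun ε hε => ?_⟩
    obtain ⟨η₁, hη₁0, hη₁1, hη₁⟩ : ∃ η₁ > 0, η₁ ≤ 1 ∧ η₁ * (1 + |q| * (‖d‖ + 1)) ≤ δ / 8 := by
      have hpos : 0 < 1 + |q| * (‖d‖ + 1) := by positivity
      refine ⟨min 1 (δ / 8 / (1 + |q| * (‖d‖ + 1))), by positivity, min_le_left _ _, ?_⟩
      calc _ ≤ δ / 8 / (1 + |q| * (‖d‖ + 1)) * (1 + |q| * (‖d‖ + 1)) := by
            gcongr; exact min_le_right _ _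
        _ = δ / 8 := by field_simp
    obtain ⟨G, hG⟩ : ∃ G, G = ‖d‖ + 1 + p + (‖y₁ - z₀‖ + ‖x₁ - z₀‖ + 1) := ⟨_, rfl⟩
    have hG0 : 0 < G := by rw [hG]; positivity
    obtain ⟨ρ₁, hρ₁⟩ : ∃ ρ, ρ = min η₁ (ε / 2 / G) := ⟨_, rfl⟩
    have hρ₁0 : 0 < ρ₁ := by rw [hρ₁]; positivity
    have hρ₁G : ρ₁ * G ≤ ε / 2 := by
      calc _ ≤ ε / 2 / G * G := by gcongr; rw [hρ₁]; exact min_le_right _ _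
        _ = ε / 2 := by field_simp
    have hρ₁η : ρ₁ ≤ η₁ := by rw [hρ₁]; exact min_le_left _ _
    obtain ⟨ρ₂, hρ₂, hjet'⟩ : ∃ ρ₂ > 0, ∀ c₁ c₂ : EuclideanSpace ℝ (Fin n) × ℝ,
        dist c₁ (y₁, t₀) < ρ₂ → dist c₂ (x₁, t₀) < ρ₂ → ∃ p' ≥ 0, |p' - p| ≤ ρ₁ ∧
        ∀ᶠ h in 𝓝 0, χ (‖c₁.1 - c₂.1‖ ^ 2 / 4 + h) ≤
          χ (‖c₁.1 - c₂.1‖ ^ 2 / 4) + p' * h + q / 2 * h ^ 2 := by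
      have hcont : Tendsto (fun w : (EuclideanSpace ℝ (Fin n) × ℝ) × EuclideanSpace ℝ (Fin n) × ℝ =>
          ‖w.1.1 - w.2.1‖ ^ 2 / 4) (𝓝 ((y₁, t₀), (x₁, t₀))) (𝓝 S) := by
        have := (by fun_prop : Continuous fun w : (EuclideanSpace ℝ (Fin n) × ℝ) ×
          EuclideanSpace ℝ (Fin n) × ℝ => ‖w.1.1 - w.2.1‖ ^ 2 / 4).tendsto ((y₁, t₀), (x₁, t₀))
        simpa only [← hd, hS₁] using this
      obtain ⟨ρ₂, hρ₂, h⟩ := Metric.eventually_nhds_iff.1 (hcont.eventually (hjet ρ₁ hρ₁0))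
      refine ⟨ρ₂, hρ₂, fun c₁ c₂ h₁ h₂ => h (y := (c₁, c₂)) ?_⟩
      rw [Prod.dist_eq]
      exact max_lt h₁ h₂
    obtain ⟨κ, hκ0, hκ, c₁, hc₁, c₂, hc₂, hd₁, hd₂, hmx⟩ :=
      hmax (min (min ρ₂ (min (ρ₁ / 2) (ε / 2))) (δ / 2)) (by positivity)
    have hκδ : κ ≤ δ / 2 := hκ.le.trans (min_le_right _ _)
    have hmin₂ : min (min ρ₂ (min (ρ₁ / 2) (ε / 2))) (δ / 2) ≤ ρ₂ :=
      (min_le_left _ _).trans (min_le_left _ _)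
    have hminρ : min (min ρ₂ (min (ρ₁ / 2) (ε / 2))) (δ / 2) ≤ ρ₁ / 2 :=
      (min_le_left _ _).trans ((min_le_right _ _).trans (min_le_left _ _))
    have hminε : min (min ρ₂ (min (ρ₁ / 2) (ε / 2))) (δ / 2) ≤ ε / 2 :=
      (min_le_left _ _).trans ((min_le_right _ _).trans (min_le_right _ _))
    obtain ⟨p', hp'0, hp', hj⟩ := hjet' c₁ c₂ (hd₁.trans_le hmin₂) (hd₂.trans_le hmin₂)
    obtain ⟨h₀, hh₀, hj⟩ := Metric.eventually_nhds_iff.1 hj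
    have hfst {c : EuclideanSpace ℝ (Fin n) × ℝ} {z t ρ} (h : dist c (z, t) < ρ) :
        ‖c.1 - z‖ < ρ := by
      rw [← dist_eq_norm]
      rw [Prod.dist_eq] at h
      exact (le_max_left _ _).trans_lt h
    have hsnd {c : EuclideanSpace ℝ (Fin n) × ℝ} {z t ρ} (h : dist c (z, t) < ρ) :
        |c.2 - t| < ρ := by
      rw [← Real.dist_eq]
      rw [Prod.dist_eq] at h
      exact (le_max_right _ _).trans_lt h
    have hcy := (hfst hd₁).trans_le hminρ
    have hcx := (hfst hd₂).trans_le hminρ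
    have hcd : ‖c₁.1 - c₂.1 - d‖ ≤ ρ₁ := by
      have : c₁.1 - c₂.1 - d = (c₁.1 - y₁) - (c₂.1 - x₁) := by rw [hd]; abel
      rw [this]
      linarith [norm_sub_le (c₁.1 - y₁) (c₂.1 - x₁)]
    have hκρ : κ ≤ ρ₁ := by linarith
    have hP₁ := norm_smul_add_smul_sub_le (c := c₁.1) (c' := c₂.1) (s := 1) (d := d) (z₀ := z₀)
      (C := ‖y₁ - z₀‖ + ‖x₁ - z₀‖) hp hκ0.le hκρ (hρ₁η.trans hη₁1) hp' abs_one hcy.le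
      (by rwa [one_smul]) (by linarith [norm_nonneg (x₁ - z₀)])
    have hP₂ := norm_smul_add_smul_sub_le (c := c₂.1) (c' := c₁.1) (s := -1) (d := d) (z₀ := z₀)
      (C := ‖y₁ - z₀‖ + ‖x₁ - z₀‖) hp hκ0.le hκρ (hρ₁η.trans hη₁1) hp' (by simp) hcx.le (by
        rwa [← norm_neg, show -(c₂.1 - c₁.1 - (-1 : ℝ) • d) = c₁.1 - c₂.1 - d by module])
        (by linarith [norm_nonneg (y₁ - z₀)])
    rw [← hG] at hP₁ hP₂
    obtain ⟨r₁, hr₁, hloc⟩ := exists_local_bounds hρ₁0 hh₀ hmx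
    have hη₁' : ρ₁ * (1 + |q| * (‖d‖ + 1)) ≤ δ / 8 := le_trans (by gcongr) hη₁
    obtain ⟨q₁, q₂, t₁, t₂, X₁, X₂, hq₁, hq₂, ht₁, ht₂, hrest⟩ :=
      exists_hessians_of_doubling (m := radialHessian p q d) (δ := δ) (L := L)
        (C := 1 / κ ^ 2 + 2 * η / κ)
        (p₁ := p' • (c₁.1 - c₂.1) + κ • (c₁.1 - z₀))
        (p₂ := p' • (c₂.1 - c₁.1) + κ • (c₂.1 - z₀))
        (r₁ := 2 * a + 4 * η * ((c₁.2 - t₀) / √((c₁.2 - t₀) ^ 2 + κ ^ 2)) + (c₁.2 - c₂.2) / κ ^ 2)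
        (r₂ := -((c₁.2 - c₂.2) / κ ^ 2)) hΩo hu hsub hsup hc₁ hc₂
        (fun v w => by
          rw [inner_radialHessian, real_inner_comm (radialHessian p q d w), inner_radialHessian,
            real_inner_comm v w]
          ring) hM0
        (inner_radialHessian_le hp q d) hδ hL.ge hr₁
        (fun w₁ hw₁ w₂ hw₂ hwd₁ hwd₂ => by
          obtain ⟨g1, g2, g3⟩ := hloc w₁ w₂ hwd₁ hwd₂
          have g4 := doublingPenalty_le (a := a) (t₀ := t₀) (z₀ := z₀) hη.le hκ0 hκδ hp' hcd
            (hρ₁η.trans hη₁1) hη₁' (fun h hh => hj (by rwa [Real.dist_0_eq_abs])) g2 g3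
          have g5 : u w₁ - u w₂ - doublingPenalty χ a η t₀ z₀ κ w₁ w₂ ≤
            u c₁ - u c₂ - doublingPenalty χ a η t₀ z₀ κ c₁ c₂ := g1 hw₁ hw₂
          linarith)
        (exists_pos_inner_outward_normal hν hr₀ hball' hc₂.1 hp'0 hκ0)
        (exists_pos_inner_outward_normal hν hr₀ hball' hc₁.1 hp'0 hκ0)
        (by positivity : 0 < ε / 2)
    obtain ⟨hX₁, hX₂, hl₁, hl₂, hX, hfin⟩ := hrest
    refine ⟨q₁, q₂, t₁, t₂, X₁, X₂, ?_, ?_, ?_, ?_, hX₁, hX₂, hl₁, hl₂, hX, ?_⟩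
    · rw [one_smul] at hP₁
      have := norm_sub_le_norm_sub_add_norm_sub q₁
        (p' • (c₁.1 - c₂.1) + κ • (c₁.1 - z₀)) (p • d)
      linarith
    · have := norm_sub_le (q₂ + (p' • (c₂.1 - c₁.1) + κ • (c₂.1 - z₀)))
        (p' • (c₂.1 - c₁.1) + κ • (c₂.1 - z₀) - (-1 : ℝ) • p • d)
      rw [show q₂ + (p' • (c₂.1 - c₁.1) + κ • (c₂.1 - z₀)) -
        (p' • (c₂.1 - c₁.1) + κ • (c₂.1 - z₀) - (-1 : ℝ) • p • d) = q₂ - p • d by module] at this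
      linarith
    · linarith [abs_sub_le t₁ c₁.2 t₀, hsnd hd₁]
    · linarith [abs_sub_le t₂ c₂.2 t₀, hsnd hd₂]
    · have h1 := (abs_le.1 (abs_div_sqrt_add_sq_le_one (s := c₁.2 - t₀) hκ0)).1
      have h2 := mul_le_mul_of_nonneg_left h1 (by positivity : 0 ≤ 4 * η)
      linarith
  have hee : ⟪radialHessian p q d e, e⟫ = p + 2 * q * S := by
    have h1 : ⟪d, e⟫ = ‖d‖ := by
      nth_rewrite 1 [hde]
      rw [inner_smul_left, real_inner_self_eq_norm_sq, hen]
      simp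
    rw [inner_radialHessian, real_inner_self_eq_norm_sq, hen, h1, ← hS₁]
    ring
  rw [hee] at hmain
  linarith

end TouchingTwoPointFunction

section Modulus

open Filter Topology

theorem exists_forall_of_eventually_nhds_sq {P : ℝ × ℝ → Prop} {s t₀ : ℝ} (hs : 0 ≤ s)
    (hP : ∀ᶠ w in 𝓝 (s, t₀), P w) :
    ∃ r > 0, ∀ s' ≥ 0, ∀ t, |s' ^ 2 - s ^ 2| ≤ r → |t - t₀| ≤ r → P (s', t) := by
  have hc : Tendsto (fun w : ℝ × ℝ => (√w.1, w.2)) (𝓝 (s ^ 2, t₀)) (𝓝 (s, t₀)) := by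
    have := (by fun_prop : Continuous fun w : ℝ × ℝ => (√w.1, w.2)).tendsto (s ^ 2, t₀)
    simpa only [Real.sqrt_sq hs] using this
  obtain ⟨r, hr, h⟩ := Metric.nhds_basis_closedBall.eventually_iff.1 (hc.eventually hP)
  refine ⟨r, hr, fun s' hs' t h₁ h₂ => ?_⟩
  have := h (x := (s' ^ 2, t)) (by
    rw [Metric.mem_closedBall, Prod.dist_eq]
    exact max_le h₁ h₂)
  simpa only [Real.sqrt_sq hs'] using this

theorem eventually_le_parabolic_taylor {φ φt φs : ℝ × ℝ → ℝ} {q s₀ t₀ η : ℝ}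
    (ht : ∀ᶠ w in 𝓝 (s₀, t₀), HasDerivAt (fun τ => φ (w.1, τ)) (φt w) w.2)
    (hs : ∀ᶠ w in 𝓝 (s₀, t₀), HasDerivAt (fun σ => φ (σ, w.2)) (φs w) w.1)
    (hss : HasDerivAt (fun σ => φs (σ, t₀)) q s₀) (hc : ContinuousAt φt (s₀, t₀)) (hη : 0 < η) :
    ∀ᶠ w in 𝓝 (s₀, t₀), φ w ≤ φ (s₀, t₀) + φs (s₀, t₀) * (w.1 - s₀) +
      (q + η) / 2 * (w.1 - s₀) ^ 2 + φt (s₀, t₀) * (w.2 - t₀) + η * |w.2 - t₀| := by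
  have hcη : ∀ᶠ w in 𝓝 (s₀, t₀), |φt w - φt (s₀, t₀)| < η := by
    have := hc.eventually (Metric.ball_mem_nhds _ hη)
    simpa only [Metric.mem_ball, Real.dist_eq] using this
  have hsη : ∀ᶠ σ in 𝓝 s₀, |φs (σ, t₀) - φs (s₀, t₀) - (σ - s₀) * q| ≤ η / 2 * |σ - s₀| := by
    simpa only [smul_eq_mul, Real.norm_eq_abs] using
      (hasDerivAt_iff_isLittleO.1 hss).def (half_pos hη)
  have hs₀ : ∀ᶠ σ in 𝓝 s₀, HasDerivAt (fun σ => φ (σ, t₀)) (φs (σ, t₀)) σ :=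
    (Continuous.tendsto (by fun_prop : Continuous fun σ : ℝ => (σ, t₀)) s₀).eventually hs
  obtain ⟨r₁, hr₁, h₁⟩ := Metric.nhds_basis_ball.eventually_iff.1 (hcη.and ht)
  obtain ⟨r₂, hr₂, h₂⟩ := Metric.nhds_basis_ball.eventually_iff.1 (hsη.and hs₀)
  filter_upwards [Metric.ball_mem_nhds (s₀, t₀) (lt_min hr₁ hr₂)] with w hw
  rw [Metric.mem_ball, Prod.dist_eq, max_lt_iff, lt_min_iff, lt_min_iff] at hw
  have e₁ : |φ (w.1, w.2) - φt (s₀, t₀) * w.2 - (φ (w.1, t₀) - φt (s₀, t₀) * t₀)| ≤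
      η * |w.2 - t₀| := by
    refine (convex_ball t₀ r₁).norm_image_sub_le_of_norm_hasDerivWithin_le
      (f := fun τ => φ (w.1, τ) - φt (s₀, t₀) * τ)
      (f' := fun τ => φt (w.1, τ) - φt (s₀, t₀)) (fun τ hτ => ?_) (fun τ hτ => ?_)
      (Metric.mem_ball_self hr₁) hw.2.1
    · have := (h₁ (x := (w.1, τ)) (by
        rw [Metric.mem_ball, Prod.dist_eq]; exact max_lt hw.1.1 hτ)).2
      have h := this.sub ((hasDerivAt_id τ).const_mul (φt (s₀, t₀)))
      rw [mul_one] at h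
      exact h.hasDerivWithinAt
    · exact ((h₁ (x := (w.1, τ)) (by
        rw [Metric.mem_ball, Prod.dist_eq]; exact max_lt hw.1.1 hτ)).1).le
  have e₂ : |φ (w.1, t₀) - φs (s₀, t₀) * w.1 - q / 2 * (w.1 - s₀) ^ 2 -
      (φ (s₀, t₀) - φs (s₀, t₀) * s₀ - q / 2 * (s₀ - s₀) ^ 2)| ≤
      η / 2 * |w.1 - s₀| * |w.1 - s₀| := by
    have hsub {σ : ℝ} (hσ : σ ∈ Metric.closedBall s₀ |w.1 - s₀|) : σ ∈ Metric.ball s₀ r₂ :=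
      lt_of_le_of_lt hσ hw.1.2
    refine (convex_closedBall s₀ |w.1 - s₀|).norm_image_sub_le_of_norm_hasDerivWithin_le
      (f := fun σ => φ (σ, t₀) - φs (s₀, t₀) * σ - q / 2 * (σ - s₀) ^ 2)
      (f' := fun σ => φs (σ, t₀) - φs (s₀, t₀) - (σ - s₀) * q) (fun σ hσ => ?_) (fun σ hσ => ?_)
      (Metric.mem_closedBall_self (abs_nonneg _)) (Metric.mem_closedBall.2 le_rfl)
    · have h := ((h₂ (hsub hσ)).2.sub ((hasDerivAt_id σ).const_mul (φs (s₀, t₀)))).sub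
        ((((hasDerivAt_id σ).sub_const s₀).fun_pow 2).const_mul (q / 2))
      refine (h.congr_deriv ?_).hasDerivWithinAt
      simp only [id]
      ring
    · refine (h₂ (hsub hσ)).1.trans ?_
      exact mul_le_mul_of_nonneg_left hσ (half_pos hη).le
  have e₃ : η / 2 * |w.1 - s₀| * |w.1 - s₀| = η / 2 * (w.1 - s₀) ^ 2 := by
    rw [mul_assoc, abs_mul_abs_self, sq]
  rw [sub_self] at e₂
  have f₁ := (abs_le.1 e₁).2
  have f₂ := (abs_le.1 e₂).2
  have : φ w = φ (w.1, w.2) := rfl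
  linarith

theorem bddAbove_two_point {V : Type*} [NormedAddCommGroup V] {K : Set V} (hK : IsCompact K)
    {f : V → ℝ} (hf : ContinuousOn f K) (s : ℝ) :
    BddAbove {r : ℝ | ∃ x ∈ K, ∃ y ∈ K, ‖y - x‖ = 2 * s ∧ r = (f y - f x) / 2} := by
  obtain ⟨M, hM⟩ := hK.exists_bound_of_continuousOn hf
  refine ⟨M, ?_⟩
  rintro _ ⟨x, hx, y, hy, -, rfl⟩
  have h₁ := (abs_le.1 (hM x hx)).1
  have h₂ := (abs_le.1 (hM y hy)).2
  linarith

theorem exists_eq_two_mul_sSup_two_point {V : Type*} [NormedAddCommGroup V] {K : Set V}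
    (hK : IsCompact K) (hKc : IsPreconnected K) {f : V → ℝ} (hf : ContinuousOn f K) {s : ℝ}
    (hs : 0 ≤ s) (hs' : s < Metric.diam K / 2) :
    ∃ x ∈ K, ∃ y ∈ K, ‖y - x‖ = 2 * s ∧ f y - f x =
      2 * sSup {r : ℝ | ∃ x ∈ K, ∃ y ∈ K, ‖y - x‖ = 2 * s ∧ r = (f y - f x) / 2} := by
  obtain ⟨Q, hQ⟩ : ∃ Q : Set (V × V), Q = K ×ˢ K ∩ {w | ‖w.2 - w.1‖ = 2 * s} := ⟨_, rfl⟩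
  have hQc : IsCompact Q := by
    rw [hQ]
    exact (hK.prod hK).inter_right (isClosed_eq (by fun_prop) continuous_const)
  have hQne : Q.Nonempty := by
    obtain ⟨a, ha, b, hb, hab⟩ : ∃ a ∈ K, ∃ b ∈ K, 2 * s < dist b a := by
      by_contra! h
      have := Metric.diam_le_of_forall_dist_le (by linarith) fun b hb a ha => h a ha b hb
      linarith
    have hmem : 2 * s ∈ Icc ‖a - a‖ ‖b - a‖ :=
      ⟨by rw [sub_self, norm_zero]; linarith, by rw [← dist_eq_norm]; exact hab.le⟩
    obtain ⟨w, hw, hws⟩ := (hKc.prod hKc).intermediate_value (a := (a, a)) (b := (a, b))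
      ⟨ha, ha⟩ ⟨ha, hb⟩ (f := fun w => ‖w.2 - w.1‖) (by fun_prop) hmem
    exact ⟨w, by rw [hQ]; exact ⟨hw, hws⟩⟩
  have hfQ : ContinuousOn (fun w : V × V => (f w.2 - f w.1) / 2) Q := by
    rw [hQ]
    exact ((hf.comp continuousOn_snd fun w hw => hw.1.2).sub
      (hf.comp continuousOn_fst fun w hw => hw.1.1)).div_const 2
  obtain ⟨w, hw, hmax⟩ := hQc.exists_isMaxOn hQne hfQ
  rw [hQ] at hw hmax
  refine ⟨w.1, hw.1.1, w.2, hw.1.2, hw.2, ?_⟩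
  have : IsGreatest {r : ℝ | ∃ x ∈ K, ∃ y ∈ K, ‖y - x‖ = 2 * s ∧ r = (f y - f x) / 2}
      ((f w.2 - f w.1) / 2) := by
    refine ⟨⟨w.1, hw.1.1, w.2, hw.1.2, hw.2, rfl⟩, ?_⟩
    rintro _ ⟨x, hx, y, hy, hxy, rfl⟩
    exact hmax (a := (x, y)) ⟨⟨hx, hy⟩, hxy⟩
  rw [this.csSup_eq]
  ring

end Modulus

section ModulusJet

open Filter Topology

variable {n : ℕ} {Ω : Set (EuclideanSpace ℝ (Fin n))} {T : ℝ}
  {ν : EuclideanSpace ℝ (Fin n) → EuclideanSpace ℝ (Fin n)}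
  {A : EuclideanSpace ℝ (Fin n) → ℝ → Matrix (Fin n) (Fin n) ℝ}
  {b : EuclideanSpace ℝ (Fin n) → ℝ → ℝ} {u : EuclideanSpace ℝ (Fin n) × ℝ → ℝ} {ω : ℝ → ℝ → ℝ}

theorem le_of_modulus_touching (hΩo : IsOpen Ω) (hΩne : Ω.Nonempty) (hΩb : Bornology.IsBounded Ω)
    (hν : ∀ x ∈ frontier Ω, ‖ν x‖ = 1 ∧ ∀ y ∈ closure Ω, ⟪y - x, ν x⟫ ≤ 0)
    (hAc : Continuous fun q : EuclideanSpace ℝ (Fin n) × ℝ => A q.1 q.2)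
    (hbc : Continuous fun q : EuclideanSpace ℝ (Fin n) × ℝ => b q.1 q.2)
    (hu : ContinuousOn u (closure Ω ×ˢ Ioo 0 T))
    (hsub : IsViscositySubsolnNeumann n Ω T ν (fun _ p X t => (A p t * X).trace + b p t)
      (fun _ => 0) u)
    (hsup : IsViscositySupersolnNeumann n Ω T ν (fun _ p X t => (A p t * X).trace + b p t)
      (fun _ => 0) u)
    (hω : ∀ t ∈ Ioo 0 T, ∀ x ∈ closure Ω, ∀ y ∈ closure Ω,
      u (y, t) - u (x, t) ≤ 2 * ω (‖y - x‖ / 2) t)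
    {χ : ℝ → ℝ} (hχ : Continuous χ) {s a η t₀ p q : ℝ} (hs : 0 < s) (hp : 0 ≤ p) (hη : 0 < η)
    (ht₀ : t₀ ∈ Ioo 0 T) {α : ℝ} (hα0 : 0 ≤ α)
    (hα : ∀ e : EuclideanSpace ℝ (Fin n), ‖e‖ = 1 →
      (A ((2 * s * p) • e) t₀ - α • Matrix.vecMulVec e.ofLp e.ofLp).PosSemidef)
    {x₀ y₀ : EuclideanSpace ℝ (Fin n)} (hx₀ : x₀ ∈ closure Ω) (hy₀ : y₀ ∈ closure Ω)
    (hxy : ‖y₀ - x₀‖ = 2 * s) (hχs : χ (s ^ 2) = 0)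
    (hle : ∀ᶠ w in 𝓝 (s, t₀), ω w.1 w.2 ≤
      (u (y₀, t₀) - u (x₀, t₀)) / 2 + χ (w.1 ^ 2) + a * (w.2 - t₀) + η * |w.2 - t₀|)
    (heq : ∀ᶠ σ in 𝓝 s, ∀ x ∈ closure Ω, ∀ y ∈ closure Ω, ‖y - x‖ = 2 * σ →
      u (y, t₀) - u (x, t₀) = u (y₀, t₀) - u (x₀, t₀) + 2 * χ (σ ^ 2) → σ = s)
    (hjet : ∀ ρ > 0, ∀ᶠ σ in 𝓝 (s ^ 2), ∃ p' ≥ 0, |p' - p| ≤ ρ ∧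
      ∀ᶠ h in 𝓝 0, χ (σ + h) ≤ χ σ + p' * h + q / 2 * h ^ 2) :
    a - 2 * η ≤ 2 * α * (p + 2 * q * s ^ 2) := by
  obtain ⟨r₁, hr₁, h₁⟩ := exists_forall_of_eventually_nhds_sq hs.le
    (hle.and (continuous_fst.continuousAt.eventually heq))
  obtain ⟨r₂, hr₂, h₂⟩ := Metric.nhds_basis_closedBall.mem_iff.1 (Ioo_mem_nhds ht₀.1 ht₀.2)
  rw [Real.closedBall_eq_Icc] at h₂
  have hsq (x y : EuclideanSpace ℝ (Fin n)) : ‖y - x‖ ^ 2 / 4 = (‖y - x‖ / 2) ^ 2 := by ring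
  refine le_of_two_point_touching (x₀ := x₀) (y₀ := y₀) (r := min r₁ r₂) hΩo hΩne hΩb hν hAc hbc hu
    hsub hsup hχ (pow_pos hs 2) hp hη (lt_min hr₁ hr₂) (fun t ht => h₂
      ⟨by linarith [ht.1, min_le_right r₁ r₂], by linarith [ht.2, min_le_right r₁ r₂]⟩)
    hα0 (by rwa [Real.sqrt_sq hs.le]) hx₀ hy₀ (by rw [hxy]; ring) hχs
    (fun x hx y hy t hxy ht => ?_) (fun x hx y hy hxy hxy' => ?_) hjet
  · rw [hsq] at hxy ⊢
    have e₁ := (h₁ (‖y - x‖ / 2) (by positivity) t (hxy.trans (min_le_left _ _))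
      (ht.trans (min_le_left _ _))).1
    have ht' := abs_le.1 (ht.trans (min_le_right _ _))
    have e₂ := hω t (h₂ ⟨by linarith, by linarith⟩) x hx y hy
    linarith
  · rw [hsq] at hxy hxy' ⊢
    have e : ‖y - x‖ / 2 = s := (h₁ (‖y - x‖ / 2) (by positivity) t₀ (hxy.trans (min_le_left _ _))
      (by rw [sub_self, abs_zero]; exact hr₁.le)).2 x hx y hy (by ring) hxy'
    rw [e]

theorem le_of_modulus_jet_of_pos (hΩo : IsOpen Ω) (hΩne : Ω.Nonempty)
    (hΩb : Bornology.IsBounded Ω)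
    (hν : ∀ x ∈ frontier Ω, ‖ν x‖ = 1 ∧ ∀ y ∈ closure Ω, ⟪y - x, ν x⟫ ≤ 0)
    (hAc : Continuous fun q : EuclideanSpace ℝ (Fin n) × ℝ => A q.1 q.2)
    (hbc : Continuous fun q : EuclideanSpace ℝ (Fin n) × ℝ => b q.1 q.2)
    (hu : ContinuousOn u (closure Ω ×ˢ Ioo 0 T))
    (hsub : IsViscositySubsolnNeumann n Ω T ν (fun _ p X t => (A p t * X).trace + b p t)
      (fun _ => 0) u)
    (hsup : IsViscositySupersolnNeumann n Ω T ν (fun _ p X t => (A p t * X).trace + b p t)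
      (fun _ => 0) u)
    (hω : ∀ t ∈ Ioo 0 T, ∀ x ∈ closure Ω, ∀ y ∈ closure Ω,
      u (y, t) - u (x, t) ≤ 2 * ω (‖y - x‖ / 2) t)
    {s₀ a η t₀ p q : ℝ} (hs₀ : 0 < s₀) (hp : 0 < p) (hη : 0 < η) (ht₀ : t₀ ∈ Ioo 0 T)
    {α : ℝ} (hα0 : 0 ≤ α) (hα : ∀ e : EuclideanSpace ℝ (Fin n), ‖e‖ = 1 →
      (A (p • e) t₀ - α • Matrix.vecMulVec e.ofLp e.ofLp).PosSemidef)
    {x₀ y₀ : EuclideanSpace ℝ (Fin n)} (hx₀ : x₀ ∈ closure Ω) (hy₀ : y₀ ∈ closure Ω)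
    (hxy : ‖y₀ - x₀‖ = 2 * s₀) (hxyω : u (y₀, t₀) - u (x₀, t₀) = 2 * ω s₀ t₀)
    (hjet : ∀ᶠ w in 𝓝 (s₀, t₀), ω w.1 w.2 ≤ ω s₀ t₀ + p * (w.1 - s₀) +
      (q + η) / 2 * (w.1 - s₀) ^ 2 + a * (w.2 - t₀) + η * |w.2 - t₀|) :
    a - 2 * η ≤ α * (q + 2 * η) := by
  obtain ⟨p₁, hp₁⟩ : ∃ p₁, p₁ = p / (2 * s₀) := ⟨_, rfl⟩
  obtain ⟨q₁, hq₁⟩ : ∃ q₁, q₁ = (q + 2 * η - p / s₀) / (4 * s₀ ^ 2) := ⟨_, rfl⟩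
  have hp₁0 : 0 < p₁ := by rw [hp₁]; positivity
  have hp₁s : 2 * s₀ * p₁ = p := by rw [hp₁]; field_simp
  have hq₁s : p₁ + 2 * q₁ * s₀ ^ 2 = (q + 2 * η) / 2 := by
    rw [hp₁, hq₁]
    field_simp
    ring
  obtain ⟨χ, hχ⟩ : ∃ χ : ℝ → ℝ, χ = fun σ => p₁ * (σ - s₀ ^ 2) + q₁ / 2 * (σ - s₀ ^ 2) ^ 2 :=
    ⟨_, rfl⟩
  have hχsq (σ : ℝ) : χ (σ ^ 2) = p * (σ - s₀) +
      (p₁ + q₁ / 2 * (σ + s₀) ^ 2) * (σ - s₀) ^ 2 := by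
    rw [hχ, ← hp₁s]
    ring
  have hstrict : ∀ᶠ σ in 𝓝 s₀, (q + η) / 2 < p₁ + q₁ / 2 * (σ + s₀) ^ 2 := by
    refine Continuous.tendsto (by fun_prop) s₀ |>.eventually (lt_mem_nhds ?_)
    rw [show p₁ + q₁ / 2 * (s₀ + s₀) ^ 2 = p₁ + 2 * q₁ * s₀ ^ 2 by ring, hq₁s]
    linarith
  have hmain := le_of_modulus_touching (χ := χ) (p := p₁) (q := q₁) (a := a) hΩo hΩne hΩb hν hAc
    hbc hu hsub hsup hω (by rw [hχ]; fun_prop) hs₀ hp₁0.le hη ht₀ hα0 (by rwa [hp₁s]) hx₀ hy₀ hxy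
    (by simp [hχ]) ?_ ?_ ?_
  · rw [hq₁s] at hmain
    linarith
  · filter_upwards [hjet, continuous_fst.continuousAt.eventually hstrict] with w h₁ h₂
    have := mul_le_mul_of_nonneg_right h₂.le (sq_nonneg (w.1 - s₀))
    rw [hχsq, hxyω]
    linarith
  · have hjet₀ := (Continuous.tendsto (by fun_prop : Continuous fun σ : ℝ => (σ, t₀))
      s₀).eventually hjet
    filter_upwards [hjet₀, hstrict] with σ h₁ h₂ x hx y hy hxyσ hu'
    by_contra hne
    have h₃ := mul_lt_mul_of_pos_right h₂ (pow_pos (abs_pos.2 (sub_ne_zero.2 hne)) 2)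
    rw [sq_abs] at h₃
    have h₄ := hω t₀ ht₀ x hx y hy
    rw [hxyσ, mul_div_cancel_left₀ σ two_ne_zero] at h₄
    rw [hχsq, hxyω] at hu'
    simp only [sub_self, mul_zero, abs_zero, add_zero] at h₁
    linarith
  · intro ρ hρ
    have h₁ : ∀ᶠ σ in 𝓝 (s₀ ^ 2), 0 < p₁ + q₁ * (σ - s₀ ^ 2) := by
      refine Continuous.tendsto (by fun_prop) (s₀ ^ 2) |>.eventually (lt_mem_nhds ?_)
      simpa using hp₁0
    have h₂ : ∀ᶠ σ in 𝓝 (s₀ ^ 2), |q₁ * (σ - s₀ ^ 2)| < ρ := by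
      refine Continuous.tendsto (by fun_prop) (s₀ ^ 2) |>.eventually (gt_mem_nhds ?_)
      simpa using hρ
    filter_upwards [h₁, h₂] with σ h₁ h₂
    refine ⟨p₁ + q₁ * (σ - s₀ ^ 2), h₁.le, by rw [add_sub_cancel_left]; exact h₂.le,
      Eventually.of_forall fun h => le_of_eq ?_⟩
    rw [hχ]
    ring

theorem exists_closest_pair_of_le_sub {V : Type*} [NormedAddCommGroup V] {K : Set V}
    (hK : IsCompact K) {f : V → ℝ} (hf : ContinuousOn f K) {m : ℝ} {x₀ y₀ : V} (hx₀ : x₀ ∈ K)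
    (hy₀ : y₀ ∈ K) (hm : m ≤ f y₀ - f x₀) :
    ∃ x₁ ∈ K, ∃ y₁ ∈ K, m ≤ f y₁ - f x₁ ∧
      ∀ x ∈ K, ∀ y ∈ K, m ≤ f y - f x → ‖y₁ - x₁‖ ≤ ‖y - x‖ := by
  have hQ : IsCompact {w ∈ K ×ˢ K | f w.2 - f w.1 ∈ Ici m} :=
    (hK.prod hK).of_isClosed_subset (ContinuousOn.preimage_isClosed_of_isClosed
      ((hf.comp continuousOn_snd fun w hw => hw.2).sub
        (hf.comp continuousOn_fst fun w hw => hw.1)) (hK.prod hK).isClosed isClosed_Ici)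
      fun w hw => hw.1
  obtain ⟨w, hw, hmin⟩ := hQ.exists_isMinOn ⟨(x₀, y₀), ⟨hx₀, hy₀⟩, hm⟩
    (f := fun w => ‖w.2 - w.1‖) (by fun_prop)
  exact ⟨w.1, hw.1.1, w.2, hw.1.2, hw.2, fun x hx y hy h => hmin (a := (x, y)) ⟨⟨hx, hy⟩, h⟩⟩

set_option maxHeartbeats 1000000 in
theorem le_of_modulus_jet_of_zero (hΩo : IsOpen Ω) (hΩne : Ω.Nonempty)
    (hΩb : Bornology.IsBounded Ω)
    (hν : ∀ x ∈ frontier Ω, ‖ν x‖ = 1 ∧ ∀ y ∈ closure Ω, ⟪y - x, ν x⟫ ≤ 0)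
    (hAc : Continuous fun q : EuclideanSpace ℝ (Fin n) × ℝ => A q.1 q.2)
    (hbc : Continuous fun q : EuclideanSpace ℝ (Fin n) × ℝ => b q.1 q.2)
    (hu : ContinuousOn u (closure Ω ×ˢ Ioo 0 T))
    (hsub : IsViscositySubsolnNeumann n Ω T ν (fun _ p X t => (A p t * X).trace + b p t)
      (fun _ => 0) u)
    (hsup : IsViscositySupersolnNeumann n Ω T ν (fun _ p X t => (A p t * X).trace + b p t)
      (fun _ => 0) u)
    (hω : ∀ t ∈ Ioo 0 T, ∀ x ∈ closure Ω, ∀ y ∈ closure Ω,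
      u (y, t) - u (x, t) ≤ 2 * ω (‖y - x‖ / 2) t)
    {s₀ s₁ a η t₀ q : ℝ} (hs₀ : 0 < s₀) (hs₁ : s₀ < s₁) (hη : 0 < η) (ht₀ : t₀ ∈ Ioo 0 T)
    (hmono : ∀ t ∈ Ioo (0 : ℝ) T, MonotoneOn (fun s => ω s t) (Icc 0 s₁))
    {α : ℝ} (hα0 : 0 ≤ α) (hα : ∀ e : EuclideanSpace ℝ (Fin n), ‖e‖ = 1 →
      (A ((0 : ℝ) • e) t₀ - α • Matrix.vecMulVec e.ofLp e.ofLp).PosSemidef)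
    {x₀ y₀ : EuclideanSpace ℝ (Fin n)} (hx₀ : x₀ ∈ closure Ω) (hy₀ : y₀ ∈ closure Ω)
    (hxy : ‖y₀ - x₀‖ = 2 * s₀) (hxyω : u (y₀, t₀) - u (x₀, t₀) = 2 * ω s₀ t₀) (hq : 0 ≤ q)
    (hjet : ∀ᶠ w in 𝓝 (s₀, t₀), ω w.1 w.2 ≤ ω s₀ t₀ +
      (q + η) / 2 * (w.1 - s₀) ^ 2 + a * (w.2 - t₀) + η * |w.2 - t₀|) :
    a - 2 * η ≤ α * (q + 2 * η) := by
  have hut : ContinuousOn (fun x => u (x, t₀)) (closure Ω) :=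
    hu.comp (by fun_prop) fun x hx => ⟨hx, ht₀⟩
  obtain ⟨x₁, hx₁, y₁, hy₁, hwω, hmin⟩ := exists_closest_pair_of_le_sub hΩb.isCompact_closure hut
    hx₀ hy₀ hxyω.ge
  obtain ⟨s, hs⟩ : ∃ s, s = ‖y₁ - x₁‖ / 2 := ⟨_, rfl⟩
  have hs_nonneg : 0 ≤ s := by rw [hs]; positivity
  have hss₀ : s ≤ s₀ := by
    have := hmin x₀ hx₀ y₀ hy₀ hxyω.ge
    linarith
  have hwω' : u (y₁, t₀) - u (x₁, t₀) = 2 * ω s₀ t₀ := by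
    refine le_antisymm ?_ hwω
    have h₁ := hω t₀ ht₀ _ hx₁ _ hy₁
    have h₂ := hmono t₀ ht₀ ⟨hs_nonneg, hss₀.trans hs₁.le⟩ ⟨hs₀.le, hs₁.le⟩ hss₀
    simp only [← hs] at h₁ h₂
    linarith
  rcases hs_nonneg.eq_or_lt with h0 | hs_pos
  · have hw0 : y₁ = x₁ := by
      rw [← sub_eq_zero, ← norm_eq_zero]
      linarith
    rw [hw0, sub_self] at hwω'
    have hev : ∀ᶠ t in 𝓝 t₀, 0 ≤ a * (t - t₀) + η * |t - t₀| := by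
      filter_upwards [(Continuous.tendsto (by fun_prop : Continuous fun t : ℝ => (s₀, t))
        t₀).eventually hjet, Ioo_mem_nhds ht₀.1 ht₀.2] with t h₁ h₂
      have h₃ := hω t h₂ _ hx₁ _ hx₁
      have h₄ := hmono t h₂ ⟨le_rfl, hs₀.le.trans hs₁.le⟩ ⟨hs₀.le, hs₁.le⟩ hs₀.le
      simp only [sub_self, norm_zero, zero_div] at h₃ h₄
      simp only [sub_self, ne_eq, OfNat.ofNat_ne_zero, not_false_eq_true, zero_pow, mul_zero,
        add_zero] at h₁
      linarith
    obtain ⟨t, ht, htt⟩ := ((hev.filter_mono nhdsWithin_le_nhds).and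
      (self_mem_nhdsWithin : Iio t₀ ∈ 𝓝[<] t₀)).exists
    have htt' : 0 < t₀ - t := sub_pos.2 htt
    rw [abs_of_neg (sub_neg.2 htt)] at ht
    have h₁ : a ≤ η := by
      refine le_of_mul_le_mul_right ?_ htt'
      linarith
    have h₂ : 0 ≤ α * (q + 2 * η) := by positivity
    linarith
  · obtain ⟨q₁, hq₁⟩ : ∃ q₁, q₁ = (q + 2 * η) / (4 * s ^ 2) := ⟨_, rfl⟩
    have hq₁0 : 0 ≤ q₁ := by rw [hq₁]; positivity
    have hq₁s : q₁ * (2 * s) ^ 2 = q + 2 * η := by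
      rw [hq₁]
      field_simp
      norm_num
    obtain ⟨χ, hχ⟩ : ∃ χ : ℝ → ℝ, χ = fun σ => q₁ / 2 * (max (σ - s ^ 2) 0) ^ 2 := ⟨_, rfl⟩
    have hχ0 {σ : ℝ} (hσ : 0 ≤ σ) (hσs : σ ≤ s) : χ (σ ^ 2) = 0 := by
      have : σ ^ 2 - s ^ 2 ≤ 0 := sub_nonpos.2 (by gcongr)
      simp [hχ, max_eq_right this]
    have hχs {σ : ℝ} (hσs : s ≤ σ) : (q + 2 * η) / 2 * (σ - s) ^ 2 ≤ χ (σ ^ 2) := by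
      have h₁ : 0 ≤ σ ^ 2 - s ^ 2 := sub_nonneg.2 (by gcongr)
      have h₂ : (2 * s) ^ 2 ≤ (σ + s) ^ 2 := by gcongr; linarith
      have h₃ := mul_le_mul_of_nonneg_left h₂ (by positivity : 0 ≤ q₁ / 2 * (σ - s) ^ 2)
      rw [hχ]
      simp only [max_eq_left h₁]
      rw [← hq₁s]
      calc _ = q₁ / 2 * (σ - s) ^ 2 * (2 * s) ^ 2 := by ring
        _ ≤ q₁ / 2 * (σ - s) ^ 2 * (σ + s) ^ 2 := h₃
        _ = _ := by ring
    have hω_le : ∀ᶠ w in 𝓝 (s, t₀), ω w.1 w.2 ≤ ω s₀ t₀ +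
        (q + η) / 2 * (max (w.1 - s) 0) ^ 2 + a * (w.2 - t₀) + η * |w.2 - t₀| := by
      have hcont : Tendsto (fun w : ℝ × ℝ => (s₀ + max (w.1 - s) 0, w.2)) (𝓝 (s, t₀))
          (𝓝 (s₀, t₀)) := by
        have := (by fun_prop : Continuous fun w : ℝ × ℝ =>
          (s₀ + max (w.1 - s) 0, w.2)).tendsto (s, t₀)
        simpa only [sub_self, max_self, add_zero] using this
      filter_upwards [hcont.eventually hjet,
        hcont.eventually (continuous_fst.continuousAt.eventually (gt_mem_nhds hs₁)),
        continuous_snd.continuousAt.eventually (Ioo_mem_nhds ht₀.1 ht₀.2),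
        continuous_fst.continuousAt.eventually (lt_mem_nhds hs_pos)] with w h₁ h₂ h₃ h₄
      have h₅ : w.1 ≤ s₀ + max (w.1 - s) 0 := by linarith [le_max_left (w.1 - s) 0]
      have h₆ := hmono w.2 h₃ ⟨h₄.le, h₅.trans h₂.le⟩ ⟨h₄.le.trans h₅, h₂.le⟩ h₅
      simp only [add_sub_cancel_left] at h₁ h₆
      linarith
    have hmain := le_of_modulus_touching (χ := χ) (p := 0) (q := q₁) (a := a) hΩo hΩne hΩb hν hAc
      hbc hu hsub hsup hω (by rw [hχ]; fun_prop) hs_pos le_rfl hη ht₀ hα0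
      (by rwa [mul_zero]) hx₁ hy₁ (by rw [hs]; ring) (hχ0 hs_pos.le le_rfl) ?_ ?_ ?_
    · rw [zero_add, show 2 * α * (2 * q₁ * s ^ 2) = α * (q₁ * (2 * s) ^ 2) by ring, hq₁s] at hmain
      exact hmain
    · filter_upwards [hω_le, continuous_fst.continuousAt.eventually (lt_mem_nhds hs_pos)]
        with w h₁ h₂
      rw [hwω']
      rcases le_total w.1 s with h₃ | h₃
      · rw [max_eq_right (sub_nonpos.2 h₃)] at h₁
        rw [hχ0 h₂.le h₃]
        linarith
      · rw [max_eq_left (sub_nonneg.2 h₃)] at h₁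
        have h₄ := mul_nonneg hη.le (sq_nonneg (w.1 - s))
        linarith [hχs h₃]
    · filter_upwards [(Continuous.tendsto (by fun_prop : Continuous fun σ : ℝ => (σ, t₀))
        s).eventually hω_le, lt_mem_nhds hs_pos] with σ h₁ h₂ x hx y hy hxyσ hu'
      rw [hwω'] at hu'
      rcases lt_trichotomy σ s with h₃ | h₃ | h₃
      · rw [hχ0 h₂.le h₃.le, mul_zero, add_zero] at hu'
        have := hmin x hx y hy hu'.ge
        linarith
      · exact h₃
      · have h₄ := hω t₀ ht₀ x hx y hy
        rw [hxyσ, mul_div_cancel_left₀ σ two_ne_zero] at h₄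
        simp only [sub_self, mul_zero, abs_zero, add_zero, max_eq_left (sub_pos.2 h₃).le] at h₁
        have h₅ := mul_pos hη (pow_pos (sub_pos.2 h₃) 2)
        linarith [hχs h₃.le]
    · intro ρ hρ
      have h₁ : ∀ᶠ σ in 𝓝 (s ^ 2), |q₁ * max (σ - s ^ 2) 0| < ρ := by
        refine Continuous.tendsto (by fun_prop) (s ^ 2) |>.eventually (gt_mem_nhds ?_)
        simpa using hρ
      filter_upwards [h₁] with σ h₁
      refine ⟨q₁ * max (σ - s ^ 2) 0, by positivity, by rw [sub_zero]; exact h₁.le,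
        Eventually.of_forall fun h => ?_⟩
      have h₂ : (max (σ + h - s ^ 2) 0) ^ 2 ≤ (max (σ - s ^ 2) 0 + h) ^ 2 := by
        rcases le_total (σ + h - s ^ 2) 0 with h₃ | h₃
        · rw [max_eq_right h₃, zero_pow two_ne_zero]
          positivity
        · rw [max_eq_left h₃]
          gcongr
          linarith [le_max_left (σ - s ^ 2) 0]
      have h₃ := mul_le_mul_of_nonneg_left h₂ (by positivity : 0 ≤ q₁ / 2)
      rw [hχ]
      linarith

end ModulusJet

open Filter Topology

/-- Let `Ω ⊂ ℝⁿ` be a smooth bounded open convex domain with diameter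
`D` and outward unit normal `ν`, and `T > 0`.  Let `u` be a viscosity solution of the
Neumann problem `∂ₜu = tr(A(Du,t)D²u) + b(Du,t)` in `Ω × (0,T)`, `⟨Du, ν⟩ = 0` on
`∂Ω × (0,T)`, with `A` positive semidefinite and
`0 < α(R,t) ≤ R² inf{vᵀA(p,t)v/(v·p)² : |p| = R, v·p ≠ 0}`.  If the modulus of
continuity `ω(s,t) = sup{(u(y,t) − u(x,t))/2 : |y − x| = 2s}` is nondecreasing in `s`,
then `ω` is a viscosity subsolution of `ωₜ = α(|ω′|,t) ω″` on `(0,D/2) × (0,T)`. -/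
theorem modulus_viscosity_subsoln_neumann (n : ℕ)
    (Ω : Set (EuclideanSpace ℝ (Fin n))) (hΩo : IsOpen Ω) (hΩne : Ω.Nonempty)
    (hΩb : Bornology.IsBounded Ω) (hΩconv : Convex ℝ Ω)
    (ν : EuclideanSpace ℝ (Fin n) → EuclideanSpace ℝ (Fin n))
    (hν : ∀ x ∈ frontier Ω, ‖ν x‖ = 1 ∧ ∀ y ∈ closure Ω, ⟪y - x, ν x⟫ ≤ 0)
    (T : ℝ) (hT : 0 < T)
    (A : EuclideanSpace ℝ (Fin n) → ℝ → Matrix (Fin n) (Fin n) ℝ)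
    (b : EuclideanSpace ℝ (Fin n) → ℝ → ℝ)
    (hAc : Continuous fun q : EuclideanSpace ℝ (Fin n) × ℝ => A q.1 q.2)
    (hbc : Continuous fun q : EuclideanSpace ℝ (Fin n) × ℝ => b q.1 q.2)
    (hApsd : ∀ p t, (A p t).PosSemidef)
    (α : ℝ → ℝ → ℝ) (hαc : Continuous fun q : ℝ × ℝ => α q.1 q.2)
    (hαpos : ∀ R > (0 : ℝ), ∀ t ∈ Icc (0 : ℝ) T, 0 < α R t)
    (hαle : ∀ R > (0 : ℝ), ∀ t ∈ Icc (0 : ℝ) T, ∀ p v : EuclideanSpace ℝ (Fin n),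
      ‖p‖ = R → ⟪v, p⟫ ≠ 0 →
      α R t ≤ R ^ 2 * ((∑ i, ∑ j, v i * A p t i j * v j) / ⟪v, p⟫ ^ 2))
    (u : EuclideanSpace ℝ (Fin n) × ℝ → ℝ)
    (hu : ContinuousOn u (closure Ω ×ˢ Ioo 0 T))
    (hsub : IsViscositySubsolnNeumann n Ω T ν
      (fun _ p X t => (A p t * X).trace + b p t) (fun _ => 0) u)
    (hsup : IsViscositySupersolnNeumann n Ω T ν
      (fun _ p X t => (A p t * X).trace + b p t) (fun _ => 0) u)
    (D : ℝ) (hD : D = Metric.diam (closure Ω))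
    (ω : ℝ → ℝ → ℝ)
    (hω : ω = fun s t => sSup {r : ℝ | ∃ x ∈ closure Ω, ∃ y ∈ closure Ω,
      ‖y - x‖ = 2 * s ∧ r = (u (y, t) - u (x, t)) / 2})
    (hmono : ∀ t ∈ Ioo (0 : ℝ) T, MonotoneOn (fun s => ω s t) (Icc 0 (D / 2))) :
    ∀ φ φt φs φss : ℝ × ℝ → ℝ,
      (∀ w ∈ Ioo (0 : ℝ) (D / 2) ×ˢ Ioo (0 : ℝ) T,
        HasDerivAt (fun τ => φ (w.1, τ)) (φt w) w.2) →
      (∀ w ∈ Ioo (0 : ℝ) (D / 2) ×ˢ Ioo (0 : ℝ) T,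
        HasDerivAt (fun σ => φ (σ, w.2)) (φs w) w.1) →
      (∀ w ∈ Ioo (0 : ℝ) (D / 2) ×ˢ Ioo (0 : ℝ) T,
        HasDerivAt (fun σ => φs (σ, w.2)) (φss w) w.1) →
      ContinuousOn φt (Ioo (0 : ℝ) (D / 2) ×ˢ Ioo (0 : ℝ) T) →
      ContinuousOn φs (Ioo (0 : ℝ) (D / 2) ×ˢ Ioo (0 : ℝ) T) →
      ContinuousOn φss (Ioo (0 : ℝ) (D / 2) ×ˢ Ioo (0 : ℝ) T) →
      ∀ s₀ t₀ : ℝ, s₀ ∈ Ioo 0 (D / 2) → t₀ ∈ Ioo 0 T →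
      IsLocalMax (fun w : ℝ × ℝ => ω w.1 w.2 - φ w) (s₀, t₀) →
      φt (s₀, t₀) ≤ α |φs (s₀, t₀)| t₀ * φss (s₀, t₀) := by
  intro φ φt φs φss hφt hφs hφss hct _ _ s₀ t₀ hs₀ ht₀ hmax
  have hK : IsCompact (closure Ω) := hΩb.isCompact_closure
  have hut {t : ℝ} (ht : t ∈ Ioo 0 T) : ContinuousOn (fun x => u (x, t)) (closure Ω) :=
    hu.comp (by fun_prop) fun x hx => ⟨hx, ht⟩
  have hωle : ∀ t ∈ Ioo 0 T, ∀ x ∈ closure Ω, ∀ y ∈ closure Ω,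
      u (y, t) - u (x, t) ≤ 2 * ω (‖y - x‖ / 2) t := by
    intro t ht x hx y hy
    have := le_csSup (bddAbove_two_point hK (hut ht) (‖y - x‖ / 2)) ⟨x, hx, y, hy, by ring, rfl⟩
    rw [hω]
    linarith
  obtain ⟨x₀, hx₀, y₀, hy₀, hxy, hxyω⟩ : ∃ x ∈ closure Ω, ∃ y ∈ closure Ω, ‖y - x‖ = 2 * s₀ ∧
      u (y, t₀) - u (x, t₀) = 2 * ω s₀ t₀ := by
    rw [hω]
    exact exists_eq_two_mul_sSup_two_point hK hΩconv.closure.isPreconnected (hut ht₀) hs₀.1.le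
      (hD ▸ hs₀.2)
  have hU : Ioo (0 : ℝ) (D / 2) ×ˢ Ioo (0 : ℝ) T ∈ 𝓝 (s₀, t₀) :=
    prod_mem_nhds (Ioo_mem_nhds hs₀.1 hs₀.2) (Ioo_mem_nhds ht₀.1 ht₀.2)
  have hjet : ∀ η > 0, ∀ᶠ w in 𝓝 (s₀, t₀), ω w.1 w.2 ≤ ω s₀ t₀ + φs (s₀, t₀) * (w.1 - s₀) +
      (φss (s₀, t₀) + η) / 2 * (w.1 - s₀) ^ 2 + φt (s₀, t₀) * (w.2 - t₀) + η * |w.2 - t₀| := by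
    intro η hη
    filter_upwards [hmax, eventually_le_parabolic_taylor (eventually_of_mem hU hφt)
      (eventually_of_mem hU hφs) (hφss _ (mem_of_mem_nhds hU)) (hct.continuousAt hU) hη]
      with w h₁ h₂
    have h₃ : ω w.1 w.2 - φ w ≤ ω s₀ t₀ - φ (s₀, t₀) := h₁
    linarith
  have hincr : ∀ η > 0, ∀ᶠ h in 𝓝[>] (0 : ℝ),
      0 ≤ φs (s₀, t₀) + (φss (s₀, t₀) + η) / 2 * h := by
    intro η hη
    have hlim : Tendsto (fun h : ℝ => s₀ + h) (𝓝[>] 0) (𝓝 s₀) := by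
      simpa only [add_zero] using ((by fun_prop : Continuous fun h : ℝ => s₀ + h).tendsto
        0).mono_left nhdsWithin_le_nhds
    filter_upwards [((Continuous.tendsto (by fun_prop : Continuous fun σ : ℝ => (σ, t₀))
      s₀).comp hlim).eventually (hjet η hη), hlim.eventually (gt_mem_nhds hs₀.2),
      self_mem_nhdsWithin] with h h₁ h₂ h₃
    have h₃' : 0 < h := h₃
    have h₄ := hmono t₀ ht₀ ⟨hs₀.1.le, hs₀.2.le⟩ ⟨by linarith [hs₀.1], h₂.le⟩
      (by linarith : s₀ ≤ s₀ + h)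
    simp only [Function.comp_apply, add_sub_cancel_left, sub_self, mul_zero, abs_zero,
      add_zero] at h₁ h₄
    refine le_of_mul_le_mul_right ?_ h₃'
    linarith
  have hp : 0 ≤ φs (s₀, t₀) := by
    have : Tendsto (fun h : ℝ => φs (s₀, t₀) + (φss (s₀, t₀) + 1) / 2 * h) (𝓝[>] 0)
        (𝓝 (φs (s₀, t₀) + (φss (s₀, t₀) + 1) / 2 * 0)) :=
      ((by fun_prop : Continuous fun h : ℝ => φs (s₀, t₀) + (φss (s₀, t₀) + 1) / 2 * h).tendsto
        0).mono_left nhdsWithin_le_nhds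
    simpa only [mul_zero, add_zero] using ge_of_tendsto this (hincr 1 one_pos)
  have ht₀' : t₀ ∈ Icc 0 T := ⟨ht₀.1.le, ht₀.2.le⟩
  have hα := fun e he => posSemidef_sub_smul_vecMulVec_of_le (e := e) hAc hApsd hαc
    (fun R hR => hαpos R hR t₀ ht₀') (fun R hR => hαle R hR t₀ ht₀') hp he
  have hα0 : 0 ≤ α (φs (s₀, t₀)) t₀ := by
    have hd : 0 < ‖y₀ - x₀‖ := by linarith [hs₀.1]
    exact (hα (‖y₀ - x₀‖⁻¹ • (y₀ - x₀)) (by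
      rw [norm_smul, norm_inv, norm_norm, inv_mul_cancel₀ hd.ne'])).1
  rw [abs_of_nonneg hp]
  have hmain : ∀ η > 0, φt (s₀, t₀) - 2 * η ≤
      α (φs (s₀, t₀)) t₀ * (φss (s₀, t₀) + 2 * η) := by
    intro η hη
    rcases hp.eq_or_lt with h0 | hp0
    · have hq : 0 ≤ φss (s₀, t₀) := by
        refine le_of_forall_pos_le_add fun ε hε => ?_
        obtain ⟨h, h₁, h₂⟩ := ((hincr ε hε).and self_mem_nhdsWithin).exists
        rw [← h0, zero_add] at h₁
        linarith [nonneg_of_mul_nonneg_left h₁ h₂]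
      refine le_of_modulus_jet_of_zero hΩo hΩne hΩb hν hAc hbc hu hsub hsup hωle hs₀.1 hs₀.2 hη ht₀
        hmono hα0 (fun e he => ?_) hx₀ hy₀ hxy hxyω hq ?_
      · rw [h0]
        exact (hα e he).2
      · filter_upwards [hjet η hη] with w hw
        rwa [← h0, zero_mul, add_zero] at hw
    · exact le_of_modulus_jet_of_pos hΩo hΩne hΩb hν hAc hbc hu hsub hsup hωle hs₀.1 hp0 hη ht₀ hα0
        (fun e he => (hα e he).2) hx₀ hy₀ hxy hxyω (hjet η hη)
  have hlim (c d k : ℝ) : Tendsto (fun η : ℝ => c * (d + k * η)) (𝓝[>] 0) (𝓝 (c * (d + k * 0))) :=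
    ((by fun_prop : Continuous fun η : ℝ => c * (d + k * η)).tendsto 0).mono_left
      nhdsWithin_le_nhds
  have := le_of_tendsto_of_tendsto (hlim 1 (φt (s₀, t₀)) (-2))
    (hlim (α (φs (s₀, t₀)) t₀) (φss (s₀, t₀)) 2) (by
      filter_upwards [self_mem_nhdsWithin] with η hη
      linarith [hmain η hη])
  simpa only [mul_zero, add_zero, one_mul] using this
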